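/- The class of quasi-planar graphs is closed under path-addition: if a finite simple graph G admits a quasi-planar drawing, u and v are distinct vertices of G, and P is a path of length at least |V(G)|−1 from u to v whose internal vertices are new, then G ⊕ P ⊕ ∅ admits a quasi-planar drawing. -/

import Mathlib

/-- Points of the plane `ℝ²`. -/
abbrev Plane : Type := ℝ × ℝ

/-- The `i`-th vertex of a path from `a` to `b` whose internal vertices are
`w 0, …, w (t-1)` (so the path has length `t + 1`). -/
def chainVertex {α : Type*} (a b : α) {t : ℕ} (w : Fin t → α) (i : Fin (t + 2)) : α :=
  if _h0 : (i : ℕ) = 0 then a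
  else if _h1 : (i : ℕ) = t + 1 then b
  else w ⟨(i : ℕ) - 1, by have := i.isLt; omega⟩

/-- The edge set of a path from `a` to `b` through the internal vertices
`w 0, …, w (t-1)`. -/
def chainEdges {α : Type*} (a b : α) {t : ℕ} (w : Fin t → α) : Set (Sym2 α) :=
  {e | ∃ i : Fin (t + 1),
    e = s(chainVertex a b w (Fin.castSucc i), chainVertex a b w (Fin.succ i))}

/-- Path-addition `G ⊕ P ⊕ F`: the graph on `V ⊕ Fin t` obtained from `G` by adding an
internally vertex-disjoint path `P = (u, w₁, …, w_t, v)` with `t` new internal vertices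
together with a set `F` of supplementary edges. -/
def pathAdd {V : Type*} (G : SimpleGraph V) (u v : V) (t : ℕ)
    (F : Set (Sym2 (V ⊕ Fin t))) : SimpleGraph (V ⊕ Fin t) :=
  SimpleGraph.fromEdgeSet
    ((Sym2.map Sum.inl '' G.edgeSet)
      ∪ chainEdges (Sum.inl u) (Sum.inl v) (fun i => Sum.inr i)
      ∪ F)

/-- A valid supplementary edge set: every supplementary edge is a non-loop with at least
one endpoint among the internal vertices `w₁, …, w_t` of the added path. -/
def ValidSupp {V : Type*} {t : ℕ} (F : Set (Sym2 (V ⊕ Fin t))) : Prop :=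
  ∀ e ∈ F, ¬ e.IsDiag ∧ ∃ i : Fin t, Sum.inr i ∈ e

/-- A drawing of a finite simple graph `G` in the plane: vertices are mapped to distinct
points, each edge to a continuous injective curve (parametrized over `[0,1]`) joining the
points of its endpoints, whose interior contains no vertex point; curves of two distinct
edges meet in finitely many points, and curves of edges sharing an endpoint meet only at
(the point of) that endpoint. -/
structure Drawing {V : Type*} (G : SimpleGraph V) where
  pos : V → Plane
  curve : Sym2 V → ℝ → Plane
  pos_inj : Function.Injective pos
  curve_cont : ∀ e ∈ G.edgeSet, ContinuousOn (curve e) (Set.Icc 0 1)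
  curve_inj : ∀ e ∈ G.edgeSet, Set.InjOn (curve e) (Set.Icc 0 1)
  curve_ends : ∀ x y : V, G.Adj x y →
    ({curve s(x, y) 0, curve s(x, y) 1} : Set Plane) = {pos x, pos y}
  no_vertex_interior : ∀ e ∈ G.edgeSet, ∀ s ∈ Set.Ioo (0 : ℝ) 1, ∀ x : V, curve e s ≠ pos x
  finite_meets : ∀ e ∈ G.edgeSet, ∀ f ∈ G.edgeSet, e ≠ f →
    (curve e '' Set.Icc 0 1 ∩ curve f '' Set.Icc 0 1).Finite
  shared_endpoint : ∀ e ∈ G.edgeSet, ∀ f ∈ G.edgeSet, e ≠ f → ∀ x : V, x ∈ e → x ∈ f →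
    curve e '' Set.Icc 0 1 ∩ curve f '' Set.Icc 0 1 ⊆ {pos x}

/-- `p` is a crossing point of the edges `e` and `f`: a point interior to both curves. -/
def Drawing.IsCrossingPt {V : Type*} {G : SimpleGraph V} (D : Drawing G)
    (e f : Sym2 V) (p : Plane) : Prop :=
  e ∈ G.edgeSet ∧ f ∈ G.edgeSet ∧ e ≠ f ∧
    (∃ s ∈ Set.Ioo (0 : ℝ) 1, D.curve e s = p) ∧
    (∃ s ∈ Set.Ioo (0 : ℝ) 1, D.curve f s = p)

/-- Two edges cross in the drawing `D`. -/
def Drawing.Crosses {V : Type*} {G : SimpleGraph V} (D : Drawing G) (e f : Sym2 V) : Prop :=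
  ∃ p : Plane, D.IsCrossingPt e f p

/-- The drawing `D` is crossing-free. -/
def Drawing.CrossingFree {V : Type*} {G : SimpleGraph V} (D : Drawing G) : Prop :=
  ∀ e f : Sym2 V, ¬ D.Crosses e f

/-- A graph is planar if it admits a crossing-free drawing in the plane. -/
def IsPlanarGraph {V : Type*} (G : SimpleGraph V) : Prop :=
  ∃ D : Drawing G, D.CrossingFree

/-- A drawing is quasi-planar if it has no three edges that pairwise cross. -/
def Drawing.QuasiPlanar {V : Type*} {G : SimpleGraph V} (D : Drawing G) : Prop :=
  ¬ ∃ e f g : Sym2 V, D.Crosses e f ∧ D.Crosses e g ∧ D.Crosses f g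

/-- A graph is quasi-planar if it admits a quasi-planar drawing. -/
def IsQuasiPlanarGraph {V : Type*} (G : SimpleGraph V) : Prop :=
  ∃ D : Drawing G, D.QuasiPlanar


section
open Set Metric

namespace QPA

/-- `K` is a simple arc from `a` to `b`. -/
def IsArc (a b : ℂ) (K : Set ℂ) : Prop :=
  ∃ γ : ℝ → ℂ, ContinuousOn γ (Icc 0 1) ∧ InjOn γ (Icc 0 1) ∧ γ 0 = a ∧ γ 1 = b ∧
    γ '' Icc 0 1 = K

theorem isArc_of_Icc {γ : ℝ → ℂ} {s t : ℝ} (hst : s < t) (hc : ContinuousOn γ (Icc s t))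
    (hi : InjOn γ (Icc s t)) : IsArc (γ s) (γ t) (γ '' Icc s t) := by
  have hm : ∀ x ∈ Icc (0:ℝ) 1, s + x * (t - s) ∈ Icc s t := by
    intro x hx
    constructor
    · nlinarith [hx.1, hx.2]
    · nlinarith [hx.1, hx.2]
  refine ⟨fun x => γ (s + x * (t - s)), ?_, ?_, by simp, by simp, ?_⟩
  · exact hc.comp (by fun_prop) hm
  · intro x hx y hy hxy
    have := hi (hm x hx) (hm y hy) hxy
    have h0 : t - s ≠ 0 := by linarith
    have : x * (t - s) = y * (t - s) := by linarith
    exact mul_right_cancel₀ h0 this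
  · ext p
    constructor
    · rintro ⟨x, hx, rfl⟩
      exact ⟨_, hm x hx, rfl⟩
    · rintro ⟨x, hx, rfl⟩
      have h0 : 0 < t - s := by linarith
      refine ⟨(x - s) / (t - s), ⟨div_nonneg (by linarith [hx.1]) h0.le, ?_⟩, ?_⟩
      · rw [div_le_one h0]; linarith [hx.2]
      · simp only
        congr 1
        field_simp
        ring

theorem IsArc.symm {a b : ℂ} {K : Set ℂ} (h : IsArc a b K) : IsArc b a K := by
  obtain ⟨γ, hc, hi, h0, h1, hK⟩ := h
  have hm : ∀ x ∈ Icc (0:ℝ) 1, 1 - x ∈ Icc (0:ℝ) 1 := fun x hx =>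
    ⟨by linarith [hx.2], by linarith [hx.1]⟩
  refine ⟨fun x => γ (1 - x), hc.comp (by fun_prop) hm, ?_, by simp [h1], by simp [h0], ?_⟩
  · intro x hx y hy hxy
    have := hi (hm x hx) (hm y hy) hxy
    linarith
  · rw [← hK]
    ext p
    constructor
    · rintro ⟨x, hx, rfl⟩
      exact ⟨_, hm x hx, rfl⟩
    · rintro ⟨x, hx, rfl⟩
      exact ⟨1 - x, hm x hx, by simp⟩

theorem IsArc.isCompact {a b : ℂ} {K : Set ℂ} (h : IsArc a b K) : IsCompact K := by
  obtain ⟨γ, hc, hi, h0, h1, hK⟩ := h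
  rw [← hK]
  exact isCompact_Icc.image_of_continuousOn hc

theorem IsArc.isPreconnected {a b : ℂ} {K : Set ℂ} (h : IsArc a b K) : IsPreconnected K := by
  obtain ⟨γ, hc, hi, h0, h1, hK⟩ := h
  rw [← hK]
  exact isPreconnected_Icc.image _ hc

theorem IsArc.left_mem {a b : ℂ} {K : Set ℂ} (h : IsArc a b K) : a ∈ K := by
  obtain ⟨γ, hc, hi, h0, h1, hK⟩ := h
  rw [← hK]
  exact ⟨0, by simp, h0⟩

theorem IsArc.right_mem {a b : ℂ} {K : Set ℂ} (h : IsArc a b K) : b ∈ K := h.symm.left_mem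

theorem IsArc.ne {a b : ℂ} {K : Set ℂ} (h : IsArc a b K) : a ≠ b := by
  obtain ⟨γ, hc, hi, h0, h1, hK⟩ := h
  rintro rfl
  have := hi (by simp) (by simp) (h0.trans h1.symm)
  norm_num at this

theorem IsArc.infinite {a b : ℂ} {K : Set ℂ} (h : IsArc a b K) : K.Infinite := by
  obtain ⟨γ, hc, hi, h0, h1, hK⟩ := h
  rw [← hK]
  exact (Icc_infinite (by norm_num)).image hi

theorem isArc_segment {a b : ℂ} (h : a ≠ b) : IsArc a b (segment ℝ a b) := by
  refine ⟨fun t => AffineMap.lineMap a b t, ?_, ?_, by simp, by simp, ?_⟩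
  · exact (AffineMap.lineMap_continuous (R := ℝ) (p := a) (q := b)).continuousOn
  · exact (AffineMap.lineMap_injective ℝ h).injOn
  · rw [segment_eq_image_lineMap]

theorem IsArc.map {a b : ℂ} {K D : Set ℂ} (h : IsArc a b K) {φ : ℂ → ℂ} (hc : ContinuousOn φ D)
    (hi : InjOn φ D) (hK : K ⊆ D) : IsArc (φ a) (φ b) (φ '' K) := by
  obtain ⟨γ, hγ, hγi, h0, h1, hK'⟩ := h
  have hm : MapsTo γ (Icc 0 1) D := fun x hx => hK (hK' ▸ ⟨x, hx, rfl⟩)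
  refine ⟨φ ∘ γ, hc.comp hγ hm, hi.comp hγi hm, by simp [h0], by simp [h1], ?_⟩
  rw [image_comp, hK']

theorem IsArc.concat {a b c : ℂ} {K L : Set ℂ} (h : IsArc a b K) (h' : IsArc b c L)
    (hKL : K ∩ L ⊆ {b}) : IsArc a c (K ∪ L) := by
  obtain ⟨γ, hγ, hγi, h0, h1, hK⟩ := h
  obtain ⟨δ, hδ, hδi, h0', h1', hL⟩ := h'
  classical
  let φ : ℝ → ℂ := fun t => if t ≤ 1 then γ t else δ (t - 1)
  have e1 : EqOn φ γ (Icc 0 1) := fun t ht => by simp [φ, ht.2]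
  have e2 : EqOn φ (fun t => δ (t - 1)) (Icc 1 2) := fun t ht => by
    by_cases h : t ≤ 1
    · have : t = 1 := le_antisymm h ht.1
      simp [φ, this, h1, h0']
    · simp [φ, h]
  have m2 : MapsTo (fun t : ℝ => t - 1) (Icc 1 2) (Icc 0 1) := fun t ht =>
    ⟨by linarith [ht.1], by linarith [ht.2]⟩
  have hU : Icc (0:ℝ) 1 ∪ Icc 1 2 = Icc 0 2 := Icc_union_Icc_eq_Icc (by norm_num) (by norm_num)
  have hc1 : ContinuousOn φ (Icc 0 1) := hγ.congr e1
  have hc2 : ContinuousOn φ (Icc 1 2) := (hδ.comp (by fun_prop) m2).congr e2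
  have hc : ContinuousOn φ (Icc 0 2) := by
    rw [← hU]
    exact hc1.union_of_isClosed hc2 isClosed_Icc isClosed_Icc
  have i1 : φ '' Icc 0 1 = K := by rw [e1.image_eq, hK]
  have i2 : φ '' Icc 1 2 = L := by
    rw [e2.image_eq, ← hL]
    ext p
    constructor
    · rintro ⟨x, hx, rfl⟩
      exact ⟨_, m2 hx, rfl⟩
    · rintro ⟨x, hx, rfl⟩
      exact ⟨x + 1, ⟨by linarith [hx.1], by linarith [hx.2]⟩, by simp⟩
  have j1 : InjOn φ (Icc 0 1) := hγi.congr e1.symm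
  have j2 : InjOn φ (Icc 1 2) := by
    refine InjOn.congr ?_ e2.symm
    intro x hx y hy hxy
    have := hδi (m2 hx) (m2 hy) hxy
    linarith
  have hb : φ 1 = b := by simp [φ, h1]
  have key : ∀ x ∈ Icc (0:ℝ) 1, ∀ y ∈ Icc (1:ℝ) 2, φ x = φ y → x = y := by
    intro x hx y hy hxy
    have hxb : φ x = b := hKL ⟨i1 ▸ ⟨x, hx, rfl⟩, i2 ▸ ⟨y, hy, hxy.symm⟩⟩
    have : x = 1 := j1 hx (by simp) (hxb.trans hb.symm)
    have : y = 1 := j2 hy (by simp) (hxy.symm.trans (hxb.trans hb.symm))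
    linarith
  have hi : InjOn φ (Icc 0 2) := by
    rw [← hU]
    rintro x (hx | hx) y (hy | hy) hxy
    · exact j1 hx hy hxy
    · exact key x hx y hy hxy
    · exact (key y hy x hx hxy.symm).symm
    · exact j2 hx hy hxy
  have := isArc_of_Icc (by norm_num) hc hi
  have z0 : φ 0 = a := by simp [φ, h0]
  have z2 : φ 2 = c := by
    have : ¬ ((2:ℝ) ≤ 1) := by norm_num
    simp only [φ, this, if_false]
    rw [← h1']; norm_num
  rw [z0, z2, ← hU, image_union, i1, i2] at this
  exact this

theorem IsArc.split {a b c : ℂ} {K : Set ℂ} (h : IsArc a b K) (hc : c ∈ K) (hca : c ≠ a)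
    (hcb : c ≠ b) : ∃ K1 K2, IsArc a c K1 ∧ IsArc c b K2 ∧ K1 ∪ K2 = K ∧ K1 ∩ K2 ⊆ {c} := by
  obtain ⟨γ, hγ, hγi, rfl, rfl, rfl⟩ := h
  obtain ⟨s, hs, rfl⟩ := hc
  have s0 : 0 < s := lt_of_le_of_ne hs.1 (by rintro rfl; exact hca rfl)
  have s1 : s < 1 := lt_of_le_of_ne hs.2 (by rintro rfl; exact hcb rfl)
  have m1 : Icc 0 s ⊆ Icc (0:ℝ) 1 := Icc_subset_Icc_right hs.2
  have m2 : Icc s 1 ⊆ Icc (0:ℝ) 1 := Icc_subset_Icc_left hs.1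
  refine ⟨γ '' Icc 0 s, γ '' Icc s 1, isArc_of_Icc s0 (hγ.mono m1) (hγi.mono m1),
    isArc_of_Icc s1 (hγ.mono m2) (hγi.mono m2), ?_, ?_⟩
  · rw [← image_union, Icc_union_Icc_eq_Icc hs.1 hs.2]
  · rintro p ⟨⟨x, hx, rfl⟩, ⟨y, hy, hxy⟩⟩
    have := hγi (m2 hy) (m1 hx) hxy
    have : x = s := by linarith [hx.2, hy.1]
    simp [this]

theorem IsArc.mid {a b a' b' : ℂ} {K : Set ℂ} (h : IsArc a b K) (ha : a' ∈ K) (hb : b' ∈ K)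
    (h1 : a' ≠ a) (h2 : a' ≠ b) (h3 : b' ≠ a) (h4 : b' ≠ b) :
    ∃ M ⊆ K, IsCompact M ∧ IsPreconnected M ∧ a ∉ M ∧ b ∉ M ∧ a' ∈ M ∧ b' ∈ M := by
  obtain ⟨γ, hγ, hγi, rfl, rfl, rfl⟩ := h
  obtain ⟨s, hs, rfl⟩ := ha
  obtain ⟨t, ht, rfl⟩ := hb
  have hm : uIcc s t ⊆ Icc (0:ℝ) 1 := uIcc_subset_Icc hs ht
  have s0 : 0 < s := lt_of_le_of_ne hs.1 (by rintro rfl; exact h1 rfl)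
  have s1 : s < 1 := lt_of_le_of_ne hs.2 (by rintro rfl; exact h2 rfl)
  have t0 : 0 < t := lt_of_le_of_ne ht.1 (by rintro rfl; exact h3 rfl)
  have t1 : t < 1 := lt_of_le_of_ne ht.2 (by rintro rfl; exact h4 rfl)
  refine ⟨γ '' uIcc s t, image_mono hm, isCompact_uIcc.image_of_continuousOn (hγ.mono hm),
    isPreconnected_uIcc.image _ (hγ.mono hm), ?_, ?_, ⟨s, by simp, rfl⟩, ⟨t, by simp, rfl⟩⟩
  · rintro ⟨x, hx, hx'⟩
    have := hγi (hm hx) (by simp) hx'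
    subst this
    have := hx.1
    have : 0 < min s t := lt_min s0 t0
    linarith
  · rintro ⟨x, hx, hx'⟩
    have := hγi (hm hx) (by simp) hx'
    subst this
    have := hx.2
    have : max s t < 1 := max_lt s1 t1
    linarith

theorem IsArc.exit {a b : ℂ} {K : Set ℂ} (h : IsArc a b K) {c : ℂ} {r : ℝ} (hac : ‖a - c‖ < r)
    (hb : r < ‖b - c‖) :
    ∃ q ∈ K, ‖q - c‖ = r ∧ ∃ K2 ⊆ K, IsArc q b K2 ∧ ∀ p ∈ K2, ‖p - c‖ ≤ r → p = q := by
  obtain ⟨γ, hγ, hγi, rfl, rfl, rfl⟩ := h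
  have hcont : ContinuousOn (fun s => ‖γ s - c‖) (Icc 0 1) := (hγ.sub continuousOn_const).norm
  have hcomp : IsCompact (Icc (0:ℝ) 1 ∩ (fun s => ‖γ s - c‖) ⁻¹' Iic r) := by
    have := hcont.preimage_isClosed_of_isClosed isClosed_Icc (isClosed_Iic (a := r))
    exact isCompact_Icc.of_isClosed_subset this inter_subset_left
  obtain ⟨s, ⟨hs, hsr⟩, hmax⟩ := hcomp.exists_isMaxOn ⟨0, by simp, hac.le⟩ continuousOn_id
  have hmax' : ∀ x ∈ Icc (0:ℝ) 1, ‖γ x - c‖ ≤ r → x ≤ s := fun x hx hxr => hmax ⟨hx, hxr⟩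
  have m2 : Icc s 1 ⊆ Icc (0:ℝ) 1 := Icc_subset_Icc_left hs.1
  have hsr' : ‖γ s - c‖ ≤ r := hsr
  have hs1 : s < 1 := by
    refine lt_of_le_of_ne hs.2 ?_
    rintro rfl
    linarith
  obtain ⟨x, hx, hxr⟩ := intermediate_value_Icc hs.2 (hcont.mono m2) (show r ∈ Icc _ _ from ⟨hsr', hb.le⟩)
  have hxs : x = s := le_antisymm (hmax' x (m2 hx) hxr.le) hx.1
  subst hxs
  refine ⟨γ x, ⟨x, hs, rfl⟩, hxr, γ '' Icc x 1, image_mono m2,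
    isArc_of_Icc hs1 (hγ.mono m2) (hγi.mono m2), ?_⟩
  rintro p ⟨y, hy, rfl⟩ hyr
  rw [le_antisymm (hmax' y (m2 hy) hyr) hy.1]

/-- a point of the arc outside a finite set -/
theorem IsArc.exists_notMem {a b : ℂ} {K F : Set ℂ} (h : IsArc a b K) (hF : F.Finite) :
    ∃ c ∈ K, c ∉ F := by
  obtain ⟨c, hc, hcF⟩ := h.infinite.exists_notMem_finite hF
  exact ⟨c, hc, hcF⟩

end QPA

end

section
open Set Metric

namespace QPA

theorem seg_inter_of_mem {a b z : ℂ} (hz : z ∈ segment ℝ a b) :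
    segment ℝ z a ∩ segment ℝ z b ⊆ {z} := by
  rintro p ⟨h1, h2⟩
  have e0 := dist_add_dist_of_mem_segment hz
  have e1 := dist_add_dist_of_mem_segment h1
  have e2 := dist_add_dist_of_mem_segment h2
  have e3 := dist_triangle a p b
  rw [dist_comm a p] at e3
  rw [dist_comm a z] at e0
  have : dist z p ≤ 0 := by linarith
  have : z = p := dist_le_zero.1 this
  simp [this]

theorem segment_isCompact (a b : ℂ) : IsCompact (segment ℝ a b) := by
  rw [segment_eq_image_lineMap]
  exact isCompact_Icc.image AffineMap.lineMap_continuous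

theorem seg_sub_left {a b z : ℂ} (hz : z ∈ segment ℝ a b) : segment ℝ a z ⊆ segment ℝ a b :=
  (convex_segment a b).segment_subset (left_mem_segment _ _ _) hz

theorem seg_sub_right {a b z : ℂ} (hz : z ∈ segment ℝ a b) : segment ℝ z b ⊆ segment ℝ a b :=
  (convex_segment a b).segment_subset hz (right_mem_segment _ _ _)

/-- Simple polygonal arcs. -/
inductive PArc : ℂ → ℂ → Set ℂ → Prop
  | seg (a b : ℂ) (h : a ≠ b) : PArc a b (segment ℝ a b)
  | cons (a b c : ℂ) (K : Set ℂ) (h : a ≠ b) (hK : PArc b c K)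
      (hi : segment ℝ a b ∩ K ⊆ {b}) : PArc a c (segment ℝ a b ∪ K)

theorem PArc.isArc {a b : ℂ} {K : Set ℂ} (h : PArc a b K) : IsArc a b K := by
  induction h with
  | seg a b h => exact isArc_segment h
  | cons a b c K h hK hi ih => exact (isArc_segment h).concat ih hi

theorem PArc.snoc {a b c : ℂ} {K : Set ℂ} (h : PArc a b K) (hbc : b ≠ c)
    (hi : K ∩ segment ℝ b c ⊆ {b}) : PArc a c (K ∪ segment ℝ b c) := by
  induction h with
  | seg a b h => exact PArc.cons a b c _ h (PArc.seg b c hbc) hi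
  | cons a d b K h hK hi' ih =>
    rw [union_assoc]
    refine PArc.cons a d c _ h (ih hbc ?_) ?_
    · exact (inter_subset_inter_left _ subset_union_right).trans hi
    · rintro p ⟨h1, h2 | h2⟩
      · exact hi' ⟨h1, h2⟩
      · have : p = b := hi ⟨Or.inl h1, h2⟩
        subst this
        exact hi' ⟨h1, hK.isArc.right_mem⟩

theorem PArc.symm {a b : ℂ} {K : Set ℂ} (h : PArc a b K) : PArc b a K := by
  induction h with
  | seg a b h => rw [segment_symm]; exact PArc.seg _ _ h.symm
  | cons a b c K h hK hi ih =>
    rw [union_comm, segment_symm]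
    refine ih.snoc h.symm ?_
    rw [inter_comm, segment_symm]
    exact hi

theorem PArc.sub {a b z : ℂ} {K : Set ℂ} (h : PArc a b K) (hz : z ∈ K) (hzb : z ≠ b) :
    ∃ K' ⊆ K, PArc z b K' := by
  induction h with
  | seg a b h => exact ⟨_, seg_sub_right hz, PArc.seg z b hzb⟩
  | cons a b c K h hK hi ih =>
    by_cases hzK : z ∈ K
    · obtain ⟨K', hK', hp⟩ := ih hzK hzb
      exact ⟨K', hK'.trans subset_union_right, hp⟩
    · have hz' : z ∈ segment ℝ a b := hz.resolve_right hzK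
      refine ⟨segment ℝ z b ∪ K, union_subset_union_left _ (seg_sub_right hz'), ?_⟩
      refine PArc.cons z b c K ?_ hK ?_
      · rintro rfl; exact hzK hK.isArc.left_mem
      · exact (inter_subset_inter_left _ (seg_sub_right hz')).trans hi

theorem exists_ball_disj {K : Set ℂ} (hK : IsCompact K) {z : ℂ} (hz : z ∉ K) :
    ∃ ρ > 0, ∀ p ∈ K, p ∉ ball z ρ := by
  have : Kᶜ ∈ nhds z := hK.isClosed.isOpen_compl.mem_nhds hz
  obtain ⟨ρ, hρ, hb⟩ := Metric.mem_nhds_iff.1 this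
  exact ⟨ρ, hρ, fun p hp hpb => hb hpb hp⟩

theorem PArc.start {a b : ℂ} {K : Set ℂ} (h : PArc a b K) :
    ∃ p ≠ a, ∃ ρ > 0, segment ℝ a p ⊆ K ∧ K ∩ ball a ρ ⊆ segment ℝ a p := by
  induction h with
  | seg a b h => exact ⟨b, h.symm, 1, one_pos, Subset.rfl, inter_subset_left⟩
  | cons a c b K' h hK hi _ =>
    have haK : a ∉ K' := fun haK => h (hi ⟨left_mem_segment _ _ _, haK⟩)
    obtain ⟨ρ, hρ, hb⟩ := exists_ball_disj hK.isArc.isCompact haK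
    refine ⟨c, h.symm, ρ, hρ, subset_union_left, ?_⟩
    rintro p ⟨h1 | h1, h2⟩
    · exact h1
    · exact absurd h2 (hb p h1)

theorem PArc.loc {a b z : ℂ} {K : Set ℂ} (h : PArc a b K) (hz : z ∈ K) (hza : z ≠ a)
    (hzb : z ≠ b) : ∃ p q, p ≠ z ∧ q ≠ z ∧ ∃ ρ > 0, segment ℝ z p ⊆ K ∧ segment ℝ z q ⊆ K ∧
      segment ℝ z p ∩ segment ℝ z q ⊆ {z} ∧
      K ∩ ball z ρ ⊆ segment ℝ z p ∪ segment ℝ z q := by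
  have segcase : ∀ a b : ℂ, z ∈ segment ℝ a b → segment ℝ a b ⊆ segment ℝ z a ∪ segment ℝ z b := by
    intro a b hz p hp
    have hz' := hz
    rw [segment_eq_image_lineMap] at hp hz'
    obtain ⟨s, hs, rfl⟩ := hp
    obtain ⟨t, ht, rfl⟩ := hz'
    rcases le_total s t with hst | hst
    · left
      rw [segment_symm, segment_eq_image_lineMap]
      rcases eq_or_lt_of_le ht.1 with h0 | h0
      · have : s = 0 := by linarith [hs.1]
        exact ⟨0, by simp, by simp [this]⟩
      · refine ⟨s / t, ⟨div_nonneg hs.1 ht.1, (div_le_one h0).2 hst⟩, ?_⟩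
        simp only [AffineMap.lineMap_apply, vsub_eq_sub, vadd_eq_add, add_sub_cancel_right,
          smul_smul]
        rw [div_mul_cancel₀ _ h0.ne']
    · right
      rw [segment_symm, segment_eq_image_lineMap]
      rcases eq_or_lt_of_le ht.2 with h0 | h0
      · have : s = 1 := by linarith [hs.2]
        exact ⟨0, by simp, by simp [this]⟩
      · refine ⟨(1 - s) / (1 - t), ⟨div_nonneg (by linarith [hs.2]) (by linarith),
          (div_le_one (by linarith)).2 (by linarith)⟩, ?_⟩
        have h0' : (1 - t) ≠ 0 := by linarith
        have h1 : (1 - (t:ℂ)) ≠ 0 := by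
          exact_mod_cast h0'
        simp only [AffineMap.lineMap_apply, vsub_eq_sub, vadd_eq_add, Complex.real_smul]
        push_cast
        field_simp
        ring
  induction h with
  | seg a b h =>
    exact ⟨a, b, hza.symm, hzb.symm, 1, one_pos, by rw [segment_symm]; exact seg_sub_left hz,
      seg_sub_right hz, seg_inter_of_mem hz, inter_subset_left.trans (segcase a b hz)⟩
  | cons a b c K h hK hi ih =>
    by_cases hzK : z ∈ K
    · by_cases hzb' : z = b
      · subst hzb'
        obtain ⟨q, hq, ρ, hρ, h1, h2⟩ := hK.start
        refine ⟨a, q, h, hq, ρ, hρ, ?_, h1.trans subset_union_right, ?_, ?_⟩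
        · rw [segment_symm]; exact subset_union_left
        · rw [segment_symm ℝ z a]
          exact (inter_subset_inter_right _ h1).trans hi
        · rintro p ⟨h3 | h3, h4⟩
          · left; rw [segment_symm]; exact h3
          · right; exact h2 ⟨h3, h4⟩
      · obtain ⟨p, q, hp, hq, ρ, hρ, h1, h2, h3, h4⟩ := ih hzK hzb' hzb
        have hzs : z ∉ segment ℝ a b := fun hzs => hzb' (hi ⟨hzs, hzK⟩)
        obtain ⟨ρ', hρ', hb⟩ := exists_ball_disj (segment_isCompact a b) hzs
        refine ⟨p, q, hp, hq, min ρ ρ', lt_min hρ hρ', h1.trans subset_union_right,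
          h2.trans subset_union_right, h3, ?_⟩
        rintro x ⟨h5 | h5, h6⟩
        · exact absurd (ball_subset_ball (min_le_right _ _) h6) (hb x h5)
        · exact h4 ⟨h5, ball_subset_ball (min_le_left _ _) h6⟩
    · have hz' : z ∈ segment ℝ a b := hz.resolve_right hzK
      have hzb' : z ≠ b := by rintro rfl; exact hzK hK.isArc.left_mem
      obtain ⟨ρ, hρ, hb⟩ := exists_ball_disj hK.isArc.isCompact hzK
      refine ⟨a, b, hza.symm, hzb'.symm, ρ, hρ, ?_, (seg_sub_right hz').trans subset_union_left,
        seg_inter_of_mem hz', ?_⟩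
      · rw [segment_symm]; exact (seg_sub_left hz').trans subset_union_left
      · rintro x ⟨h5 | h5, h6⟩
        · exact segcase a b hz' h5
        · exact absurd h6 (hb x h5)

/-- contained in a finite union of segments -/
def SegFin (K : Set ℂ) : Prop :=
  ∃ F : Set (ℂ × ℂ), F.Finite ∧ K ⊆ ⋃ p ∈ F, segment ℝ p.1 p.2

theorem PArc.segFin {a b : ℂ} {K : Set ℂ} (h : PArc a b K) : SegFin K := by
  induction h with
  | seg a b h => exact ⟨{(a, b)}, finite_singleton _, by simp⟩
  | cons a b c K h hK hi ih =>
    obtain ⟨F, hF, hFK⟩ := ih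
    refine ⟨insert (a, b) F, hF.insert _, ?_⟩
    rw [biUnion_insert]
    exact union_subset_union_right _ hFK

/-- the direction `1 + n i` -/
noncomputable def dir (n : ℕ) : ℂ := 1 + n * Complex.I

def Par2 (m : ℕ) (d : ℂ) : Prop := ∃ c : ℝ, d = c • dir (2 * m) ∨ d = c • dir (2 * m + 1)

/-- contained in a finite union of segments with two special slopes -/
def Stair (m : ℕ) (J : Set ℂ) : Prop :=
  ∃ F : Set (ℂ × ℂ), F.Finite ∧ (∀ p ∈ F, Par2 m (p.2 - p.1)) ∧ J ⊆ ⋃ p ∈ F, segment ℝ p.1 p.2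

theorem seg_fin (n : ℕ) (p p' q q' : ℂ) (c : ℝ) (hp : p' - p = c • dir n)
    (hq : (q' - q).im ≠ n * (q' - q).re ∨ q' = q) :
    (segment ℝ p p' ∩ segment ℝ q q').Finite := by
  rcases hq with hq | rfl
  swap
  · rw [segment_same]
    exact (finite_singleton _).subset inter_subset_right
  apply Set.Subsingleton.finite
  rintro x ⟨hx1, hx2⟩ y ⟨hy1, hy2⟩
  rw [segment_eq_image'] at hx1 hx2 hy1 hy2
  obtain ⟨s, -, rfl⟩ := hx1
  obtain ⟨t, -, ht⟩ := hx2
  obtain ⟨s', -, rfl⟩ := hy1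
  obtain ⟨t', -, ht'⟩ := hy2
  simp only at ht ht' ⊢
  rw [hp] at ht ht' ⊢
  have e : (t - t') • (q' - q) = ((s - s') * c) • dir n := by
    have : (q + t • (q' - q)) - (q + t' • (q' - q)) = (p + s • c • dir n) - (p + s' • c • dir n) := by
      rw [ht, ht']
    rw [sub_smul, mul_smul, sub_smul]
    linear_combination this
  have er := congrArg Complex.re e
  have ei := congrArg Complex.im e
  simp [dir] at er ei
  have h0 : (t - t') * ((q' - q).im - n * (q' - q).re) = 0 := by
    simp only [Complex.sub_im, Complex.sub_re]
    linear_combination ei - n * er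
  have : t - t' = 0 := by
    rcases mul_eq_zero.1 h0 with h | h
    · exact h
    · exact absurd (by linarith) hq
  have : t = t' := by linarith
  rw [← ht, ← ht', this]

theorem fin_of_pieces {F F' : Set (ℂ × ℂ)} (hF : F.Finite) (hF' : F'.Finite) {J K : Set ℂ}
    (hJ : J ⊆ ⋃ p ∈ F, segment ℝ p.1 p.2) (hK : K ⊆ ⋃ p ∈ F', segment ℝ p.1 p.2)
    (h : ∀ p ∈ F, ∀ q ∈ F', (segment ℝ p.1 p.2 ∩ segment ℝ q.1 q.2).Finite) :
    (J ∩ K).Finite := by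
  have : (⋃ p ∈ F, ⋃ q ∈ F', (segment ℝ p.1 p.2 ∩ segment ℝ q.1 q.2)).Finite :=
    hF.biUnion fun p hp => hF'.biUnion fun q hq => h p hp q hq
  refine this.subset ?_
  rintro x ⟨h1, h2⟩
  have h1 := hJ h1
  have h2 := hK h2
  simp only [mem_iUnion] at h1 h2 ⊢
  obtain ⟨p, hp, h1⟩ := h1
  obtain ⟨q, hq, h2⟩ := h2
  exact ⟨p, hp, q, hq, h1, h2⟩

theorem Stair.fin_stair {m m' : ℕ} (hm : m ≠ m') {J J' : Set ℂ} (h : Stair m J)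
    (h' : Stair m' J') : (J ∩ J').Finite := by
  obtain ⟨F, hF, hd, hJ⟩ := h
  obtain ⟨F', hF', hd', hJ'⟩ := h'
  refine fin_of_pieces hF hF' hJ hJ' fun p hp q hq => ?_
  obtain ⟨c, hc⟩ := hd p hp
  obtain ⟨c', hc'⟩ := hd' q hq
  have key : ∀ n n' : ℕ, n ≠ n' → q.2 - q.1 = c' • dir n' →
      (q.2 - q.1).im ≠ n * (q.2 - q.1).re ∨ q.2 = q.1 := by
    intro n n' hn hq'
    by_cases h0 : c' = 0
    · right
      rw [h0, zero_smul] at hq'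
      exact sub_eq_zero.1 hq'
    · left
      rw [hq']
      simp only [dir, Complex.smul_im, Complex.smul_re]
      simp
      intro h
      have h1 : c' * (n' - n : ℝ) = 0 := by linarith
      rcases mul_eq_zero.1 h1 with h1 | h1
      · exact h0 h1
      · apply hn
        have : (n:ℝ) = n' := by linarith
        exact_mod_cast this
  rcases hc with hc | hc <;> rcases hc' with hc' | hc'
  · exact seg_fin _ _ _ _ _ c hc (key _ _ (by omega) hc')
  · exact seg_fin _ _ _ _ _ c hc (key _ _ (by omega) hc')
  · exact seg_fin _ _ _ _ _ c hc (key _ _ (by omega) hc')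
  · exact seg_fin _ _ _ _ _ c hc (key _ _ (by omega) hc')

theorem SegFin.eventually {K : Set ℂ} (h : SegFin K) :
    ∃ M : ℕ, ∀ m ≥ M, ∀ J, Stair m J → (J ∩ K).Finite := by
  obtain ⟨F, hF, hK⟩ := h
  have h1 : ∀ q ∈ F, ∀ᶠ n : ℕ in Filter.atTop,
      (q.2 - q.1).im ≠ n * (q.2 - q.1).re ∨ q.2 = q.1 := by
    intro q _
    by_cases hre : (q.2 - q.1).re = 0
    · by_cases him : (q.2 - q.1).im = 0
      · exact Filter.Eventually.of_forall fun n =>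
          Or.inr (sub_eq_zero.1 (Complex.ext hre him))
      · refine Filter.Eventually.of_forall fun n => Or.inl ?_
        rw [hre, mul_zero]; exact him
    · obtain ⟨M, hM⟩ := exists_nat_gt ((q.2 - q.1).im / (q.2 - q.1).re)
      refine Filter.eventually_atTop.2 ⟨M, fun n hn => Or.inl fun he => ?_⟩
      rw [he, mul_div_assoc, div_self hre, mul_one] at hM
      have : (M:ℝ) ≤ n := by exact_mod_cast hn
      linarith
  have h2 := (Filter.eventually_all_finite hF).2 h1
  obtain ⟨M, hM⟩ := Filter.eventually_atTop.1 h2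
  refine ⟨M, fun m hm J ⟨F', hF', hd, hJ⟩ => fin_of_pieces hF' hF hJ hK fun p hp q hq => ?_⟩
  obtain ⟨c, hc | hc⟩ := hd p hp
  · exact seg_fin _ _ _ _ _ c hc (hM _ (by omega) q hq)
  · exact seg_fin _ _ _ _ _ c hc (hM _ (by omega) q hq)

/-- one step along an allowed segment -/
def Step (m : ℕ) (U : Set ℂ) (a b : ℂ) : Prop := segment ℝ a b ⊆ U ∧ Par2 m (b - a)

theorem Step.symm {m : ℕ} {U : Set ℂ} {a b : ℂ} (h : Step m U a b) : Step m U b a := by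
  obtain ⟨h1, c, h2⟩ := h
  refine ⟨by rw [segment_symm]; exact h1, -c, ?_⟩
  rw [← neg_sub b a, neg_smul, neg_smul]
  rcases h2 with h2 | h2
  · left; rw [h2]
  · right; rw [h2]

theorem reach_symm {m : ℕ} {U : Set ℂ} {a b : ℂ} (h : Relation.ReflTransGen (Step m U) a b) :
    Relation.ReflTransGen (Step m U) b a := by
  induction h with
  | refl => exact .refl
  | tail _ h ih => exact .head h.symm ih

theorem reach_local (m : ℕ) {U : Set ℂ} (hU : IsOpen U) {z : ℂ} (hz : z ∈ U) :
    ∀ᶠ w in nhds z, Relation.ReflTransGen (Step m U) z w := by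
  obtain ⟨ρ, hρ, hb⟩ := Metric.isOpen_iff.1 hU z hz
  let n : ℝ := (2 * m : ℕ)
  let f : ℂ → ℂ := fun w => z + (((w - z).re - (w - z).im + n * (w - z).re : ℝ) : ℂ) * dir (2 * m)
  have hf : Continuous f := by
    have h1 : Continuous fun w : ℂ => (w - z).re :=
      Complex.continuous_re.comp (continuous_id.sub continuous_const)
    have h2 : Continuous fun w : ℂ => (w - z).im :=
      Complex.continuous_im.comp (continuous_id.sub continuous_const)
    exact continuous_const.add ((Complex.continuous_ofReal.comp
      ((h1.sub h2).add (continuous_const.mul h1))).mul continuous_const)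
  have hfz : f z = z := by simp [f]
  have e1 : ∀ᶠ w in nhds z, f w ∈ ball z ρ := by
    apply hf.continuousAt.eventually_mem
    rw [hfz]; exact ball_mem_nhds z hρ
  filter_upwards [e1, ball_mem_nhds z hρ] with w h1 h2
  have hs1 : Step m U z (f w) := by
    refine ⟨((convex_ball z ρ).segment_subset (mem_ball_self hρ) h1).trans hb,
      ((w - z).re - (w - z).im + n * (w - z).re), Or.inl ?_⟩
    · simp only [f, add_sub_cancel_left]
      exact (Complex.real_smul).symm
  have hs2 : Step m U (f w) w := by
    refine ⟨((convex_ball z ρ).segment_subset h1 h2).trans hb,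
      (w - z).im - n * (w - z).re, Or.inr ?_⟩
    apply Complex.ext
    · simp [f, dir]; ring
    · simp [f, dir, n]; ring
  exact (Relation.ReflTransGen.single hs1).tail hs2

theorem reach (m : ℕ) {U : Set ℂ} (hU : IsOpen U) (hc : IsPreconnected U) {a b : ℂ}
    (ha : a ∈ U) (hb : b ∈ U) : Relation.ReflTransGen (Step m U) a b := by
  have := hc.subset_left_of_subset_union
    (u := {w | w ∈ U ∧ Relation.ReflTransGen (Step m U) a w})
    (v := {w | w ∈ U ∧ ¬ Relation.ReflTransGen (Step m U) a w}) ?_ ?_ ?_ ?_ ?_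
  · exact (this hb).2
  · rw [isOpen_iff_mem_nhds]
    rintro z ⟨hz, hr⟩
    filter_upwards [hU.mem_nhds hz, reach_local m hU hz] with w h1 h2
    exact ⟨h1, hr.trans h2⟩
  · rw [isOpen_iff_mem_nhds]
    rintro z ⟨hz, hr⟩
    filter_upwards [hU.mem_nhds hz, reach_local m hU hz] with w h1 h2
    exact ⟨h1, fun h3 => hr (h3.trans (reach_symm h2))⟩
  · rw [Set.disjoint_left]
    rintro w h1 h2
    exact h2.2 h1.2
  · intro w hw
    by_cases h : Relation.ReflTransGen (Step m U) a w
    · exact Or.inl ⟨hw, h⟩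
    · exact Or.inr ⟨hw, h⟩
  · exact ⟨a, ha, ha, .refl⟩

/-- point, or polygonal arc inside `Y` -/
def PP (Y : Set ℂ) (b c : ℂ) : Prop := b = c ∨ ∃ K ⊆ Y, PArc b c K

theorem PP.step {Y : Set ℂ} {b c : ℂ} (h : PP Y b c) (a : ℂ) : PP (segment ℝ a b ∪ Y) a c := by
  by_cases hac : a = c
  · exact Or.inl hac
  right
  rcases h with rfl | ⟨K, hKY, hK⟩
  · exact ⟨_, subset_union_left, PArc.seg a b hac⟩
  have hcomp : IsCompact (segment ℝ a b ∩ K) := (segment_isCompact a b).inter hK.isArc.isCompact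
  obtain ⟨z, ⟨hz1, hz2⟩, hmin⟩ := hcomp.exists_isMinOn
    ⟨b, right_mem_segment _ _ _, hK.isArc.left_mem⟩ (f := fun p => dist a p) (by fun_prop)
  have hi : ∀ p ∈ segment ℝ a z, p ∈ K → p = z := by
    intro p hp hpK
    have h1 : dist a z ≤ dist a p := hmin ⟨seg_sub_left hz1 hp, hpK⟩
    have h2 := dist_add_dist_of_mem_segment hp
    exact dist_le_zero.1 (by linarith)
  by_cases hzc : z = c
  · subst hzc
    exact ⟨_, (seg_sub_left hz1).trans subset_union_left, PArc.seg a z hac⟩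
  obtain ⟨K', hK', hp⟩ := hK.sub hz2 hzc
  by_cases haz : a = z
  · subst haz
    exact ⟨K', (hK'.trans hKY).trans subset_union_right, hp⟩
  · refine ⟨segment ℝ a z ∪ K', union_subset_union (seg_sub_left hz1) (hK'.trans hKY),
      PArc.cons a z c K' haz hp ?_⟩
    rintro p ⟨h1, h2⟩
    exact hi p h1 (hK' h2)

theorem PP.mono {Y Y' : Set ℂ} (hY : Y ⊆ Y') {b c : ℂ} (h : PP Y b c) : PP Y' b c := by
  rcases h with h | ⟨K, h1, h2⟩
  · exact Or.inl h
  · exact Or.inr ⟨K, h1.trans hY, h2⟩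

theorem extract_chain {m : ℕ} {U Y : Set ℂ} {q q' c : ℂ}
    (h : Relation.ReflTransGen (Step m U) q q') (hP : PP Y q' c) :
    ∃ J ⊆ U, Stair m J ∧ PP (J ∪ Y) q c := by
  induction h using Relation.ReflTransGen.head_induction_on with
  | refl => exact ⟨∅, empty_subset _, ⟨∅, finite_empty, by simp, by simp⟩, by simpa using hP⟩
  | @head a b hs _ ih =>
    obtain ⟨J, hJ, ⟨F, hF, hd, hJF⟩, hPP⟩ := ih
    refine ⟨segment ℝ a b ∪ J, union_subset hs.1 hJ, ⟨insert (a, b) F, hF.insert _, ?_, ?_⟩, ?_⟩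
    · rintro p (rfl | hp)
      · exact hs.2
      · exact hd p hp
    · rw [biUnion_insert]
      exact union_subset_union_right _ hJF
    · rw [union_assoc]
      exact hPP.step a

theorem extract (m : ℕ) {U : Set ℂ} (hU : IsOpen U) (hc : IsPreconnected U) {q q' x y : ℂ}
    (hq : q ∈ U) (hq' : q' ∈ U) (hxy : x ≠ y) :
    ∃ J ⊆ U, Stair m J ∧ ∃ K ⊆ segment ℝ x q ∪ J ∪ segment ℝ q' y, PArc x y K := by
  have h0 : PP (segment ℝ q' y) q' y := by
    have := PP.step (Y := ∅) (b := y) (c := y) (Or.inl rfl) q'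
    simpa using this
  obtain ⟨J, hJ, hS, hP⟩ := extract_chain (reach m hU hc hq hq') h0
  refine ⟨J, hJ, hS, ?_⟩
  have := hP.step x
  rw [← union_assoc] at this
  exact this.resolve_left hxy

end QPA

end

section
open Set Metric

namespace QPA

variable {T ι : Type}

/-- vertex disjoint edges whose curves meet -/
def X (en : ι → Sym2 T) (K : ι → Set ℂ) (e f : ι) : Prop :=
  (∀ z ∈ en e, z ∉ en f) ∧ (K e ∩ K f).Nonempty

theorem X.symm {en : ι → Sym2 T} {K : ι → Set ℂ} {e f : ι} (h : X en K e f) : X en K f e :=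
  ⟨fun z hz hz' => h.1 z hz' hz, by rw [inter_comm]; exact h.2⟩

theorem X.ne {en : ι → Sym2 T} {K : ι → Set ℂ} {e f : ι} (h : X en K e f) : e ≠ f := by
  rintro rfl
  obtain ⟨a, ha⟩ : ∃ a, a ∈ en e := by
    induction h' : en e with
    | _ a b => exact ⟨a, by simp⟩
  exact h.1 a ha ha

/-- good (quasi-planar) multigraph drawings -/
structure Good (S : Set T) (E : Set ι) (en : ι → Sym2 T) (pos : T → ℂ) (K : ι → Set ℂ) : Prop where
  inj : InjOn pos S
  mem : ∀ e ∈ E, ∀ z ∈ en e, z ∈ S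
  arc : ∀ e ∈ E, ∀ a b, en e = s(a, b) → IsArc (pos a) (pos b) (K e)
  vert : ∀ e ∈ E, ∀ z ∈ S, pos z ∈ K e → z ∈ en e
  fin : ∀ e ∈ E, ∀ f ∈ E, e ≠ f → (K e ∩ K f).Finite
  sh : ∀ e ∈ E, ∀ f ∈ E, e ≠ f → ∀ z, z ∈ en e → z ∈ en f → ∀ p ∈ K e ∩ K f,
    ∃ z', z' ∈ en e ∧ z' ∈ en f ∧ pos z' = p
  qp : ∀ e ∈ E, ∀ f ∈ E, ∀ g ∈ E, X en K e f → X en K e g → X en K f g → False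

variable {S S' : Set T} {E E' : Set ι} {en en' : ι → Sym2 T} {pos pos' : T → ℂ} {K K' : ι → Set ℂ}

theorem Good.congr (G : Good S E en pos K) (hen : ∀ e ∈ E, en' e = en e)
    (hpos : ∀ z ∈ S, pos' z = pos z) (hK : ∀ e ∈ E, K' e = K e) : Good S E en' pos' K' := by
  have hX : ∀ e ∈ E, ∀ f ∈ E, X en' K' e f → X en K e f := by
    intro e he f hf h
    simpa [X, hen e he, hen f hf, hK e he, hK f hf] using h
  refine ⟨?_, ?_, ?_, ?_, ?_, ?_, ?_⟩
  · intro a ha b hb hab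
    rw [hpos a ha, hpos b hb] at hab
    exact G.inj ha hb hab
  · intro e he z hz
    rw [hen e he] at hz
    exact G.mem e he z hz
  · intro e he a b hab
    rw [hen e he] at hab
    have ha : a ∈ S := G.mem e he a (by simp [hab])
    have hb : b ∈ S := G.mem e he b (by simp [hab])
    rw [hpos a ha, hpos b hb, hK e he]
    exact G.arc e he a b hab
  · intro e he z hz hzK
    rw [hpos z hz, hK e he] at hzK
    rw [hen e he]
    exact G.vert e he z hz hzK
  · intro e he f hf hef
    rw [hK e he, hK f hf]
    exact G.fin e he f hf hef
  · intro e he f hf hef z hz hz' p hp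
    rw [hK e he, hK f hf] at hp
    rw [hen e he] at hz ⊢
    rw [hen f hf] at hz' ⊢
    obtain ⟨z', h1, h2, h3⟩ := G.sh e he f hf hef z hz hz' p hp
    exact ⟨z', h1, h2, by rw [hpos z' (G.mem e he z' h1)]; exact h3⟩
  · intro e he f hf g hg h1 h2 h3
    exact G.qp e he f hf g hg (hX _ he _ hf h1) (hX _ he _ hg h2) (hX _ hf _ hg h3)

theorem Good.restrict (G : Good S E en pos K) (hS : S' ⊆ S) (hE : E' ⊆ E)
    (hm : ∀ e ∈ E', ∀ z ∈ en e, z ∈ S') : Good S' E' en pos K where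
  inj := G.inj.mono hS
  mem := hm
  arc e he := G.arc e (hE he)
  vert e he z hz := G.vert e (hE he) z (hS hz)
  fin e he f hf := G.fin e (hE he) f (hE hf)
  sh e he f hf := G.sh e (hE he) f (hE hf)
  qp e he f hf g hg := G.qp e (hE he) f (hE hf) g (hE hg)

theorem Good.redraw (G : Good S E en pos K)
    (arc : ∀ e ∈ E, ∀ a b, en e = s(a, b) → IsArc (pos a) (pos b) (K' e))
    (vert : ∀ e ∈ E, ∀ z ∈ S, pos z ∈ K' e → z ∈ en e)
    (fin : ∀ e ∈ E, ∀ f ∈ E, e ≠ f → (K' e ∩ K' f).Finite)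
    (meet : ∀ e ∈ E, ∀ f ∈ E, e ≠ f → ∀ p ∈ K' e ∩ K' f,
      (∃ z', z' ∈ en e ∧ z' ∈ en f ∧ pos z' = p) ∨ X en K e f) : Good S E en pos K' := by
  have hX : ∀ e ∈ E, ∀ f ∈ E, X en K' e f → X en K e f := by
    intro e he f hf h
    obtain ⟨h1, p, hp⟩ := h
    rcases meet e he f hf (X.ne ⟨h1, p, hp⟩) p hp with ⟨z, h2, h3, -⟩ | h2
    · exact absurd h3 (h1 z h2)
    · exact h2
  refine ⟨G.inj, G.mem, arc, vert, fin, ?_, ?_⟩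
  · intro e he f hf hef z hz hz' p hp
    rcases meet e he f hf hef p hp with h | h
    · exact h
    · exact absurd hz' (h.1 z hz)
  · intro e he f hf g hg h1 h2 h3
    exact G.qp e he f hf g hg (hX _ he _ hf h1) (hX _ he _ hg h2) (hX _ hf _ hg h3)

theorem Good.addIso (G : Good S E en pos K) {w : T} (hpos : ∀ z ∈ S, pos' z = pos z)
    (h1 : ∀ z ∈ S, pos z ≠ pos' w) (h2 : ∀ e ∈ E, pos' w ∉ K e) :
    Good (insert w S) E en pos' K := by
  have G' : Good S E en pos' K := G.congr (fun _ _ => rfl) hpos (fun _ _ => rfl)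
  refine ⟨?_, ?_, G'.arc, ?_, G'.fin, G'.sh, G'.qp⟩
  · have key : ∀ z ∈ S, pos' z ≠ pos' w := fun z hz => by rw [hpos z hz]; exact h1 z hz
    rintro a (rfl | ha) b (rfl | hb) hab
    · rfl
    · exact absurd hab.symm (key b hb)
    · exact absurd hab (key a ha)
    · exact G'.inj ha hb hab
  · exact fun e he z hz => Or.inr (G.mem e he z hz)
  · rintro e he z (rfl | hz) hzK
    · exact absurd hzK (h2 e he)
    · exact G'.vert e he z hz hzK

theorem Good.addEdge (G : Good S E en pos K) {r : ι}
    (mem : ∀ z ∈ en r, z ∈ S)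
    (arc : ∀ a b, en r = s(a, b) → IsArc (pos a) (pos b) (K r))
    (vert : ∀ z ∈ S, pos z ∈ K r → z ∈ en r)
    (fin : ∀ f ∈ E, f ≠ r → (K r ∩ K f).Finite)
    (sh : ∀ f ∈ E, f ≠ r → ∀ z ∈ en r, z ∈ en f → ∀ p ∈ K r, p ∈ K f →
      ∃ z', z' ∈ en r ∧ z' ∈ en f ∧ pos z' = p)
    (qp : ∀ f ∈ E, ∀ g ∈ E, X en K r f → X en K r g → X en K f g → False) :
    Good S (insert r E) en pos K := by
  refine ⟨G.inj, ?_, ?_, ?_, ?_, ?_, ?_⟩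
  · rintro e (rfl | he)
    · exact mem
    · exact G.mem e he
  · rintro e (rfl | he)
    · exact arc
    · exact G.arc e he
  · rintro e (rfl | he)
    · exact vert
    · exact G.vert e he
  · rintro e (rfl | he) f (rfl | hf) hef
    · exact absurd rfl hef
    · exact fin f hf hef.symm
    · rw [inter_comm]; exact fin e he hef
    · exact G.fin e he f hf hef
  · rintro e (rfl | he) f (rfl | hf) hef z hz hz' p hp
    · exact absurd rfl hef
    · exact sh f hf hef.symm z hz hz' p hp.1 hp.2
    · obtain ⟨z', h1, h2, h3⟩ := sh e he hef z hz' hz p hp.2 hp.1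
      exact ⟨z', h2, h1, h3⟩
    · exact G.sh e he f hf hef z hz hz' p hp
  · rintro e (rfl | he) f (rfl | hf) g (rfl | hg) h1 h2 h3
    · exact h1.ne rfl
    · exact h1.ne rfl
    · exact h2.ne rfl
    · exact qp f hf g hg h1 h2 h3
    · exact h3.ne rfl
    · exact qp e he g hg h1.symm h3 h2
    · exact qp e he f hf h2.symm h3.symm h1
    · exact G.qp e he f hf g hg h1 h2 h3

/-- Shorten edge `e = yx` to `yw`. -/
theorem Good.shorten (G : Good S E en pos K) {e : ι} (he : e ∈ E) {x y w : T} (hxy : en e = s(y, x))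
    (hw : w ∉ S) (hen : ∀ h ∈ E, h ≠ e → en' h = en h) (hene : en' e = s(y, w))
    (hpos : ∀ z ∈ S, pos' z = pos z) (hK : ∀ h ∈ E, h ≠ e → K' h = K h)
    (hKe : K' e ⊆ K e) (harc : IsArc (pos y) (pos' w) (K' e)) (hx : pos x ∉ K' e)
    (hc : ∀ h ∈ E, h ≠ e → pos' w ∉ K h) : Good (insert w S) E en' pos' K' := by
  have hyS : y ∈ S := G.mem e he y (by simp [hxy])
  have hxS : x ∈ S := G.mem e he x (by simp [hxy])
  have hwz : ∀ z ∈ S, pos z ≠ pos' w := by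
    intro z hz hzw
    have : z ∈ en e := G.vert e he z hz (hKe (by rw [hzw]; exact harc.right_mem))
    rw [hxy, Sym2.mem_iff] at this
    rcases this with rfl | rfl
    · exact harc.ne hzw
    · apply hx; rw [hzw]; exact harc.right_mem
  have G1 : Good S (E \ {e}) en' pos K' :=
    (G.restrict (Subset.refl S) (E' := E \ {e}) sdiff_subset (fun h hh => G.mem h hh.1)).congr
      (fun h hh => hen h hh.1 hh.2) (fun _ _ => rfl) (fun h hh => hK h hh.1 hh.2)
  have G2 : Good (insert w S) (E \ {e}) en' pos' K' := by
    refine G1.addIso hpos hwz ?_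
    intro h hh
    rw [hK h hh.1 hh.2]
    exact hc h hh.1 hh.2
  have hnx : ∀ h ∈ E, h ≠ e → w ∉ en' h := by
    intro h hh hhe hwh
    rw [hen h hh hhe] at hwh
    exact hw (G.mem h hh w hwh)
  have hX : ∀ f ∈ E, f ≠ e → X en' K' e f → X en K e f := by
    intro f hf hfe ⟨h1, p, hp1, hp2⟩
    rw [hK f hf hfe] at hp2
    rw [hen f hf hfe] at h1
    refine ⟨?_, p, hKe hp1, hp2⟩
    intro z hz hzf
    obtain ⟨z', h2, h3, rfl⟩ := G.sh e he f hf hfe.symm z hz hzf p ⟨hKe hp1, hp2⟩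
    rw [hxy, Sym2.mem_iff] at h2
    rcases h2 with rfl | rfl
    · exact h1 z' (by simp [hene]) h3
    · exact hx hp1
  have : insert e (E \ {e}) = E := by simp [he]
  rw [← this]
  refine G2.addEdge ?_ ?_ ?_ ?_ ?_ ?_
  · intro z hz
    rw [hene, Sym2.mem_iff] at hz
    rcases hz with rfl | rfl
    · exact Or.inr hyS
    · exact Or.inl rfl
  · intro a b hab
    rw [hene] at hab
    rw [← hpos y hyS] at harc
    rcases Sym2.eq_iff.1 hab with ⟨rfl, rfl⟩ | ⟨rfl, rfl⟩
    · exact harc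
    · exact harc.symm
  · rintro z (rfl | hz) hzK
    · simp [hene]
    · rw [hpos z hz] at hzK
      have := G.vert e he z hz (hKe hzK)
      rw [hxy, Sym2.mem_iff] at this
      rcases this with rfl | rfl
      · simp [hene]
      · exact absurd hzK hx
  · rintro f ⟨hf, hfe⟩ -
    rw [hK f hf hfe]
    exact (G.fin e he f hf (Ne.symm hfe)).subset (inter_subset_inter_left _ hKe)
  · rintro f ⟨hf, hfe⟩ - z hz hzf p hp hpf
    have hne := hen f hf hfe
    rw [hK f hf hfe] at hpf
    rw [hene, Sym2.mem_iff] at hz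
    rcases hz with rfl | rfl
    · rw [hne] at hzf ⊢
      obtain ⟨z', h2, h3, rfl⟩ := G.sh e he f hf (Ne.symm hfe) z (by simp [hxy]) hzf p ⟨hKe hp, hpf⟩
      rw [hxy, Sym2.mem_iff] at h2
      rcases h2 with rfl | rfl
      · exact ⟨z', by simp [hene], h3, hpos _ hyS⟩
      · exact absurd hp hx
    · exact absurd hzf (hnx f hf hfe)
  · rintro f ⟨hf, hfe⟩ g ⟨hg, hge⟩ h1 h2 h3
    refine G.qp e he f hf g hg (hX f hf hfe h1) (hX g hg hge h2) ?_
    simpa [X, hen f hf hfe, hen g hg hge, hK f hf hfe, hK g hg hge] using h3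

theorem Good.sub (G : Good S E en pos K) (hE : E.Finite) {e e1 : ι} (he : e ∈ E) (he1 : e1 ∉ E)
    {x y w : T} (hxy : en e = s(y, x)) (hw : w ∉ S)
    (hen : ∀ h ∈ E, h ≠ e → en' h = en h) (hene : en' e = s(y, w)) (hen1 : en' e1 = s(w, x)) :
    ∃ pos' K', Good (insert w S) (insert e1 E) en' pos' K' := by
  classical
  have hyS : y ∈ S := G.mem e he y (by simp [hxy])
  have hxS : x ∈ S := G.mem e he x (by simp [hxy])
  have hA := G.arc e he y x hxy
  -- choose the point
  obtain ⟨c, hcK, hc⟩ : ∃ c ∈ K e, c ∉ ({pos x, pos y} ∪ ⋃ f ∈ E \ {e}, K e ∩ K f : Set ℂ) := by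
    have hfin : ({pos x, pos y} ∪ ⋃ f ∈ E \ {e}, K e ∩ K f : Set ℂ).Finite :=
      Set.Finite.union (by simp) ((hE.subset sdiff_subset).biUnion fun f hf =>
        G.fin e he f hf.1 (Ne.symm hf.2))
    by_contra hcon
    push Not at hcon
    exact hA.infinite (hfin.subset hcon)
  simp only [mem_union, mem_insert_iff, mem_singleton_iff, mem_iUnion, mem_inter_iff, mem_sdiff,
    not_or, not_exists, not_and] at hc
  obtain ⟨⟨hcx, hcy⟩, hcf⟩ := hc
  obtain ⟨K1, K2, hK1, hK2, hU, hI⟩ := hA.split hcK hcy hcx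
  have hK1e : K1 ⊆ K e := hU ▸ subset_union_left
  have hK2e : K2 ⊆ K e := hU ▸ subset_union_right
  have hx1 : pos x ∉ K1 := fun h => hcx (hI ⟨h, hK2.right_mem⟩).symm
  have hy2 : pos y ∉ K2 := fun h => hcy (hI ⟨hK1.left_mem, h⟩).symm
  have hee1 : e1 ≠ e := by rintro rfl; exact he1 he
  have hne1 : ∀ h ∈ E, h ≠ e1 := by rintro h hh rfl; exact he1 hh
  let pos' := Function.update pos w c
  let K' := Function.update (Function.update K e K1) e1 K2
  have hpw : pos' w = c := by simp [pos']
  have hpos : ∀ z ∈ S, pos' z = pos z := by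
    intro z hz
    have : z ≠ w := by rintro rfl; exact hw hz
    simp [pos', this]
  have hK'e : K' e = K1 := by simp [K', hee1.symm]
  have hK'1 : K' e1 = K2 := by simp [K']
  have hK' : ∀ h ∈ E, h ≠ e → K' h = K h := by
    intro h hh hhe
    simp [K', hne1 h hh, hhe]
  have G1 : Good (insert w S) E en' pos' K' := by
    refine G.shorten he hxy hw hen hene hpos hK' (by rw [hK'e]; exact hK1e) ?_ ?_ ?_
    · rw [hpw, hK'e]; exact hK1
    · rw [hK'e]; exact hx1
    · intro h hh hhe
      rw [hpw]; exact hcf h ⟨hh, hhe⟩ hcK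
  refine ⟨pos', K', G1.addEdge ?_ ?_ ?_ ?_ ?_ ?_⟩
  · intro z hz
    rw [hen1, Sym2.mem_iff] at hz
    rcases hz with rfl | rfl
    · exact Or.inl rfl
    · exact Or.inr hxS
  · intro a b hab
    rw [hen1] at hab
    rw [← hpos x hxS, ← hpw] at hK2
    rw [hK'1]
    rcases Sym2.eq_iff.1 hab with ⟨rfl, rfl⟩ | ⟨rfl, rfl⟩
    · exact hK2
    · exact hK2.symm
  · rw [hK'1]
    rintro z (rfl | hz) hzK
    · simp [hen1]
    · rw [hpos z hz] at hzK
      have := G.vert e he z hz (hK2e hzK)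
      rw [hxy, Sym2.mem_iff] at this
      rcases this with rfl | rfl
      · exact absurd hzK hy2
      · simp [hen1]
  · intro f hf _
    rw [hK'1]
    by_cases hfe : f = e
    · subst hfe
      rw [hK'e, inter_comm]
      exact (finite_singleton c).subset hI
    · rw [hK' f hf hfe]
      exact (G.fin e he f hf (Ne.symm hfe)).subset (inter_subset_inter_left _ hK2e)
  · intro f hf _ z hz hzf p hp hpf
    rw [hK'1] at hp
    by_cases hfe : f = e
    · subst hfe
      rw [hK'e] at hpf
      have : p = c := hI ⟨hpf, hp⟩
      exact ⟨w, by simp [hen1], by simp [hene], by rw [hpw, this]⟩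
    · rw [hK' f hf hfe] at hpf
      rw [hen f hf hfe] at hzf ⊢
      rw [hen1, Sym2.mem_iff] at hz
      rcases hz with rfl | rfl
      · exact absurd (G.mem f hf _ hzf) hw
      · obtain ⟨z', h2, h3, rfl⟩ :=
          G.sh e he f hf (Ne.symm hfe) z (by simp [hxy]) hzf p ⟨hK2e hp, hpf⟩
        rw [hxy, Sym2.mem_iff] at h2
        rcases h2 with rfl | rfl
        · exact absurd hp hy2
        · exact ⟨z', by simp [hen1], h3, hpos _ hxS⟩
  · have hX : ∀ f ∈ E, X en' K' e1 f → X en K e f ∧ f ≠ e := by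
      intro f hf ⟨h1, p, hp1, hp2⟩
      have hfe : f ≠ e := by
        rintro rfl
        exact h1 w (by simp [hen1]) (by simp [hene])
      refine ⟨?_, hfe⟩
      rw [hK' f hf hfe] at hp2
      rw [hen f hf hfe] at h1
      rw [hK'1] at hp1
      refine ⟨?_, p, hK2e hp1, hp2⟩
      intro z hz hzf
      obtain ⟨z', h2, h3, rfl⟩ := G.sh e he f hf hfe.symm z hz hzf p ⟨hK2e hp1, hp2⟩
      rw [hxy, Sym2.mem_iff] at h2
      rcases h2 with rfl | rfl
      · exact hy2 hp1
      · exact h1 z' (by simp [hen1]) h3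
    intro f hf g hg h1 h2 h3
    obtain ⟨a1, hfe⟩ := hX f hf h1
    obtain ⟨a2, hge⟩ := hX g hg h2
    refine G.qp e he f hf g hg a1 a2 ?_
    simpa [X, hen f hf hfe, hen g hg hge, hK' f hf hfe, hK' g hg hge] using h3

end QPA

end

section
open Set Metric

namespace QPA

variable {T ι : Type}
variable {S S' : Set T} {E E' : Set ι} {en en' : ι → Sym2 T} {pos pos' : T → ℂ} {K K' : ι → Set ℂ}

theorem seg_closedBall {x q p : ℂ} {r : ℝ} (hq : ‖q - x‖ = r) (hp : p ∈ segment ℝ x q) :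
    ‖p - x‖ ≤ r := by
  have := dist_add_dist_of_mem_segment hp
  have h2 : dist x q = r := by rw [dist_comm, dist_eq_norm]; exact hq
  rw [← dist_eq_norm, dist_comm]
  linarith [dist_nonneg (x := p) (y := q)]

/-- two points of radii with the same positive distance to the centre -/
theorem seg_radius {x q q' p : ℂ} {r : ℝ} (hr : 0 < r) (hq : ‖q - x‖ = r) (hq' : ‖q' - x‖ = r)
    (hp : p ∈ segment ℝ x q) (hp' : p ∈ segment ℝ x q') : p = x ∨ q = q' := by
  rw [segment_eq_image'] at hp hp'
  obtain ⟨s, hs, rfl⟩ := hp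
  obtain ⟨t, ht, h⟩ := hp'
  simp only at h
  have h1 : t • (q' - x) = s • (q - x) := by linear_combination h
  have h2 : t = s := by
    have := congrArg norm h1
    rw [norm_smul, norm_smul, hq, hq', Real.norm_of_nonneg hs.1, Real.norm_of_nonneg ht.1] at this
    exact mul_right_cancel₀ hr.ne' this
  subst h2
  by_cases ht0 : t = 0
  · left; simp [ht0]
  · right
    have := smul_right_injective ℂ ht0 h1
    exact (sub_left_injective this).symm

theorem seg_sphere {x q p p' : ℂ} {r ρ : ℝ} (hr : 0 < r) (hq : ‖q - x‖ = r)
    (hp : p ∈ segment ℝ x q) (hp' : p' ∈ segment ℝ x q) (h : ‖p - x‖ = ρ) (h' : ‖p' - x‖ = ρ) :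
    p = p' := by
  rw [segment_eq_image'] at hp hp'
  obtain ⟨s, hs, rfl⟩ := hp
  obtain ⟨t, ht, rfl⟩ := hp'
  simp only [add_sub_cancel_left] at h h' ⊢
  rw [norm_smul, Real.norm_of_nonneg hs.1, hq] at h
  rw [norm_smul, Real.norm_of_nonneg ht.1, hq] at h'
  have : s = t := mul_right_cancel₀ hr.ne' (h.trans h'.symm)
  rw [this]

theorem Good.exists_radius (G : Good S E en pos K) (hS : S.Finite) (hE : E.Finite) {x : T}
    (hx : x ∈ S) : ∃ r > 0, (∀ z ∈ S, z ≠ x → r < ‖pos z - pos x‖) ∧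
      (∀ h ∈ E, x ∉ en h → ∀ p ∈ K h, r < ‖p - pos x‖) := by
  have h1 : ∀ᶠ r : ℝ in nhdsWithin 0 (Ioi 0), ∀ z ∈ S, z ≠ x → r < ‖pos z - pos x‖ := by
    rw [Filter.eventually_all_finite hS]
    intro z hz
    rw [Filter.eventually_imp_distrib_left]
    intro hzx
    have : 0 < ‖pos z - pos x‖ := norm_pos_iff.2 (sub_ne_zero.2 fun h => hzx (G.inj hz hx h))
    exact nhdsWithin_le_nhds (eventually_lt_nhds this)
  have h2 : ∀ᶠ r : ℝ in nhdsWithin 0 (Ioi 0), ∀ h ∈ E, x ∉ en h → ∀ p ∈ K h, r < ‖p - pos x‖ := by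
    rw [Filter.eventually_all_finite hE]
    intro h hh
    rw [Filter.eventually_imp_distrib_left]
    intro hxh
    have hxK : pos x ∉ K h := fun hk => hxh (G.vert h hh x hx hk)
    have hcomp : IsCompact (K h) := by
      induction h' : en h with
      | _ a b => exact (G.arc h hh a b h').isCompact
    obtain ⟨ρ, hρ, hb⟩ := exists_ball_disj hcomp hxK
    filter_upwards [nhdsWithin_le_nhds (eventually_lt_nhds hρ)] with r hr p hp
    have := hb p hp
    rw [mem_ball, dist_eq_norm, not_lt] at this
    linarith
  obtain ⟨r, ⟨h3, h4⟩, h5⟩ := ((h1.and h2).and self_mem_nhdsWithin).exists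
  exact ⟨r, h5, h3, h4⟩

theorem Good.radial (G : Good S E en pos K) (hS : S.Finite) (hE : E.Finite) {x : T}
    (hx : x ∈ S) : ∃ r > 0, ∃ (q : ι → ℂ) (K2 K' : ι → Set ℂ), Good S E en pos K' ∧
      (∀ z ∈ S, z ≠ x → r < ‖pos z - pos x‖) ∧
      (∀ h ∈ E, x ∉ en h → ∀ p ∈ K' h, r < ‖p - pos x‖) ∧
      (∀ h ∈ E, ∀ y, en h = s(x, y) → ‖q h - pos x‖ = r ∧ K' h = segment ℝ (pos x) (q h) ∪ K2 h ∧
        IsArc (q h) (pos y) (K2 h) ∧ ∀ p ∈ K2 h, ‖p - pos x‖ ≤ r → p = q h) ∧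
      (∀ h ∈ E, ∀ f ∈ E, x ∈ en h → x ∈ en f → h ≠ f → q h ≠ q f) := by
  classical
  obtain ⟨r, hr, h1, h2⟩ := G.exists_radius hS hE hx
  have hex : ∀ h : ι, ∃ (q : ℂ) (K2 : Set ℂ), h ∈ E → ∀ y, en h = s(x, y) → q ∈ K h ∧
      ‖q - pos x‖ = r ∧ K2 ⊆ K h ∧ IsArc q (pos y) K2 ∧ ∀ p ∈ K2, ‖p - pos x‖ ≤ r → p = q := by
    intro h
    by_cases hh : h ∈ E ∧ x ∈ en h
    · obtain ⟨hh, y, hy⟩ := hh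
      have ha := G.arc h hh x y hy
      have hyx : y ≠ x := by rintro rfl; exact ha.ne rfl
      have hyS : y ∈ S := G.mem h hh y (by simp [hy])
      obtain ⟨q, hq, hqr, K2, hK2, hA, hlast⟩ :=
        ha.exit (c := pos x) (r := r) (by simpa using hr) (h1 y hyS hyx)
      refine ⟨q, K2, fun _ y' hy' => ?_⟩
      have : y' = y := (Sym2.congr_right.1 (hy.symm.trans hy')).symm
      subst this
      exact ⟨hq, hqr, hK2, hA, hlast⟩
    · refine ⟨0, ∅, fun hE y hy => absurd ⟨hE, ?_⟩ hh⟩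
      simp [hy]
  choose q K2 hq using hex
  let K' : ι → Set ℂ := fun h => if x ∈ en h then segment ℝ (pos x) (q h) ∪ K2 h else K h
  have hK'1 : ∀ h, x ∈ en h → K' h = segment ℝ (pos x) (q h) ∪ K2 h := fun h hh => if_pos hh
  have hK'2 : ∀ h, x ∉ en h → K' h = K h := fun h hh => if_neg hh
  have hq' : ∀ h ∈ E, x ∈ en h → q h ∈ K h ∧
      ‖q h - pos x‖ = r ∧ K2 h ⊆ K h ∧ ∀ p ∈ K2 h, ‖p - pos x‖ ≤ r → p = q h := by
    rintro h hh ⟨y, hy⟩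
    obtain ⟨a, b, c, d, e⟩ := hq h hh y hy
    exact ⟨a, b, c, e⟩
  have hqne : ∀ h ∈ E, ∀ f ∈ E, x ∈ en h → x ∈ en f → h ≠ f → q h ≠ q f := by
    intro h hh f hf hxh hxf hne heq
    obtain ⟨a, b, -, -⟩ := hq' h hh hxh
    obtain ⟨a', -, -, -⟩ := hq' f hf hxf
    obtain ⟨z, hz1, hz2, hz⟩ := G.sh h hh f hf hne x hxh hxf (q h) ⟨a, heq ▸ a'⟩
    rw [← hz] at b
    by_cases hzx : z = x
    · subst hzx
      simp at b
      exact hr.ne b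
    · exact (h1 z (G.mem h hh z hz1) hzx).ne b.symm
  -- key facts on intersections
  have key1 : ∀ h ∈ E, ∀ f ∈ E, x ∈ en h → x ∈ en f → h ≠ f → ∀ p ∈ K' h, p ∈ K' f →
      p = pos x ∨ p ∈ K h ∩ K f := by
    intro h hh f hf hxh hxf hne p hp hp'
    rw [hK'1 h hxh] at hp
    rw [hK'1 f hxf] at hp'
    obtain ⟨a1, a2, a3, a4⟩ := hq' h hh hxh
    obtain ⟨b1, b2, b3, b4⟩ := hq' f hf hxf
    have hn := hqne h hh f hf hxh hxf hne
    rcases hp with hp | hp <;> rcases hp' with hp' | hp'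
    · exact Or.inl ((seg_radius hr a2 b2 hp hp').resolve_right hn)
    · have := b4 p hp' (seg_closedBall a2 hp)
      subst this
      exact absurd (seg_sphere hr a2 hp (right_mem_segment _ _ _) b2 a2) hn.symm
    · have := a4 p hp (seg_closedBall b2 hp')
      subst this
      exact absurd (seg_sphere hr b2 hp' (right_mem_segment _ _ _) a2 b2) hn
    · exact Or.inr ⟨a3 hp, b3 hp'⟩
  have key2 : ∀ h ∈ E, ∀ f ∈ E, x ∈ en h → x ∉ en f → ∀ p ∈ K' h, p ∈ K' f → p ∈ K h ∩ K f := by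
    intro h hh f hf hxh hxf p hp hp'
    rw [hK'1 h hxh] at hp
    rw [hK'2 f hxf] at hp'
    obtain ⟨a1, a2, a3, a4⟩ := hq' h hh hxh
    refine ⟨?_, hp'⟩
    rcases hp with hp | hp
    · have := seg_closedBall a2 hp
      have := h2 f hf hxf p hp'
      linarith
    · exact a3 hp
  have key : ∀ h ∈ E, ∀ f ∈ E, h ≠ f → ∀ p ∈ K' h ∩ K' f,
      (p = pos x ∧ x ∈ en h ∧ x ∈ en f) ∨ p ∈ K h ∩ K f := by
    intro h hh f hf hne p ⟨hp, hp'⟩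
    by_cases hxh : x ∈ en h <;> by_cases hxf : x ∈ en f
    · rcases key1 h hh f hf hxh hxf hne p hp hp' with h | h
      · exact Or.inl ⟨h, hxh, hxf⟩
      · exact Or.inr h
    · exact Or.inr (key2 h hh f hf hxh hxf p hp hp')
    · exact Or.inr (key2 f hf h hh hxf hxh p hp' hp).symm
    · right
      rw [hK'2 h hxh] at hp
      rw [hK'2 f hxf] at hp'
      exact ⟨hp, hp'⟩
  refine ⟨r, hr, q, K2, K', ?_, h1, ?_, ?_, hqne⟩
  · refine G.redraw ?_ ?_ ?_ ?_
    · intro h hh a b hab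
      by_cases hxh : x ∈ en h
      · rw [hK'1 h hxh]
        have main : ∀ y, en h = s(x, y) → IsArc (pos x) (pos y) (segment ℝ (pos x) (q h) ∪ K2 h) := by
          intro y hy
          obtain ⟨a1, a2, a3, a4, a5⟩ := hq h hh y hy
          refine (isArc_segment ?_).concat a4 ?_
          · intro h0
            rw [← h0] at a2
            simp at a2
            exact hr.ne a2
          · rintro p ⟨hp1, hp2⟩
            exact a5 p hp2 (seg_closedBall a2 hp1)
        rw [hab, Sym2.mem_iff] at hxh
        rcases hxh with rfl | rfl
        · exact main b hab
        · exact (main a (by rw [hab, Sym2.eq_swap])).symm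
      · rw [hK'2 h hxh]
        exact G.arc h hh a b hab
    · intro h hh z hz hzK
      by_cases hxh : x ∈ en h
      · rw [hK'1 h hxh] at hzK
        obtain ⟨a1, a2, a3, a4⟩ := hq' h hh hxh
        rcases hzK with hzK | hzK
        · by_cases hzx : z = x
          · subst hzx; exact hxh
          · have := h1 z hz hzx
            have := seg_closedBall a2 hzK
            linarith
        · exact G.vert h hh z hz (a3 hzK)
      · rw [hK'2 h hxh] at hzK
        exact G.vert h hh z hz hzK
    · intro h hh f hf hne
      refine ((finite_singleton (pos x)).union (G.fin h hh f hf hne)).subset ?_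
      intro p hp
      rcases key h hh f hf hne p hp with h | h
      · exact Or.inl h.1
      · exact Or.inr h
    · intro h hh f hf hne p hp
      rcases key h hh f hf hne p hp with ⟨h1, h2, h3⟩ | h1
      · exact Or.inl ⟨x, h2, h3, h1.symm⟩
      · by_cases hd : ∀ z ∈ en h, z ∉ en f
        · exact Or.inr ⟨hd, p, h1⟩
        · push Not at hd
          obtain ⟨z, hz1, hz2⟩ := hd
          exact Or.inl (G.sh h hh f hf hne z hz1 hz2 p h1)
  · intro h hh hxh
    rw [hK'2 h hxh]
    exact h2 h hh hxh
  · intro h hh y hy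
    obtain ⟨a1, a2, a3, a4, a5⟩ := hq h hh y hy
    exact ⟨a2, hK'1 h (by simp [hy]), a4, a5⟩

end QPA

end

section
open Set Metric

namespace QPA

variable {T ι : Type}
variable {S S' : Set T} {E E' : Set ι} {en en' : ι → Sym2 T} {pos pos' : T → ℂ} {K K' : ι → Set ℂ}

def Free (S : Set T) (E : Set ι) (pos : T → ℂ) (K : ι → Set ℂ) (a b : ℂ) : Prop :=
  ∀ p ∈ openSegment ℝ a b, (∀ z ∈ S, pos z ≠ p) ∧ ∀ h ∈ E, p ∉ K h

theorem trim {x q y : ℂ} {K2 : Set ℂ} {r : ℝ} (hr : 0 < r) (hq : ‖q - x‖ = r)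
    (hA : IsArc q y K2) (hlast : ∀ p ∈ K2, ‖p - x‖ ≤ r → p = q) :
    ∃ c, IsArc y c (segment ℝ c q ∪ K2) ∧ ‖c - x‖ = r / 2 ∧ c ∈ segment ℝ x q ∧
      ∀ p ∈ segment ℝ c q ∪ K2, r / 2 ≤ ‖p - x‖ ∧ (‖p - x‖ = r / 2 → p = c) := by
  let c : ℂ := x + (1 / 2 : ℝ) • (q - x)
  have hcx : ‖c - x‖ = r / 2 := by
    simp only [c, add_sub_cancel_left, norm_smul, hq]
    norm_num
    ring
  have hcs : c ∈ segment ℝ x q := by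
    rw [segment_eq_image']
    exact ⟨1 / 2, by norm_num, rfl⟩
  have hcq : c ≠ q := by
    intro h
    rw [h, hq] at hcx
    linarith
  have hsub : segment ℝ c q ⊆ segment ℝ x q := seg_sub_right hcs
  refine ⟨c, ?_, hcx, hcs, ?_⟩
  · refine ((isArc_segment hcq).concat hA ?_).symm
    rintro p ⟨h1, h2⟩
    exact hlast p h2 (seg_closedBall hq (hsub h1))
  · rintro p (hp | hp)
    · have hp' := hsub hp
      have : r / 2 ≤ ‖p - x‖ := by
        rw [segment_eq_image'] at hp
        obtain ⟨s, hs, rfl⟩ := hp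
        have : c + s • (q - c) - x = ((1 + s) / 2) • (q - x) := by
          simp only [c, Complex.real_smul]
          push_cast
          ring
        simp only [this, norm_smul, hq]
        rw [Real.norm_of_nonneg (by linarith [hs.1])]
        nlinarith [hs.1]
      exact ⟨this, fun h => seg_sphere hr hq hp' hcs h hcx⟩
    · by_cases h : ‖p - x‖ ≤ r
      · have := hlast p hp h
        subst this
        rw [hq]
        exact ⟨by linarith, fun h => by linarith⟩
      · push Not at h
        exact ⟨by linarith, fun h' => by linarith⟩

theorem Good.detach (G : Good S E en pos K) (hS : S.Finite) (hE : E.Finite) {e : ι} (he : e ∈ E)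
    {x y w : T} (hxy : en e = s(y, x)) (hw : w ∉ S)
    (hen : ∀ h ∈ E, h ≠ e → en' h = en h) (hene : en' e = s(y, w)) :
    ∃ pos' K', Good (insert w S) E en' pos' K' ∧
      Free (insert w S) E pos' K' (pos' x) (pos' w) := by
  classical
  have hxS : x ∈ S := G.mem e he x (by simp [hxy])
  obtain ⟨r, hr, q, K2, K', G', h1, h2, h3, h4⟩ := G.radial hS hE hxS
  have hxy' : en e = s(x, y) := by rw [hxy, Sym2.eq_swap]
  obtain ⟨b1, b2, b3, b4⟩ := h3 e he y hxy'
  obtain ⟨c, c1, c2, c3, c4⟩ := trim hr b1 b3 b4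
  let pos' := Function.update pos w c
  let K'' := Function.update K' e (segment ℝ c (q e) ∪ K2 e)
  have hpw : pos' w = c := by simp [pos']
  have hpos : ∀ z ∈ S, pos' z = pos z := by
    intro z hz
    have : z ≠ w := by rintro rfl; exact hw hz
    simp [pos', this]
  have hKe : K'' e = segment ℝ c (q e) ∪ K2 e := by simp [K'']
  have hK : ∀ h ∈ E, h ≠ e → K'' h = K' h := by
    intro h _ hhe
    simp [K'', hhe]
  have hcx : c ≠ pos x := by rintro rfl; simp at c2; linarith
  -- points of the segment [x, q e] on other edges
  have hseg : ∀ h ∈ E, h ≠ e → ∀ p ∈ segment ℝ (pos x) (q e), p ∈ K' h → p = pos x := by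
    intro h hh hhe p hp hpK
    have hpr := seg_closedBall b1 hp
    by_cases hxh : x ∈ en h
    · obtain ⟨y', hy'⟩ := hxh
      obtain ⟨d1, d2, d3, d4⟩ := h3 h hh y' hy'
      have hne := h4 h hh e he (by simp [hy']) (by simp [hxy]) hhe
      rw [d2] at hpK
      rcases hpK with hpK | hpK
      · exact (seg_radius hr d1 b1 hpK hp).resolve_right hne
      · have := d4 p hpK hpr
        subst this
        exact absurd (seg_sphere hr b1 hp (right_mem_segment _ _ _) d1 b1) hne
    · have := h2 h hh hxh p hpK
      linarith
  refine ⟨pos', K'', ?_, ?_⟩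
  · refine G'.shorten he hxy hw hen hene hpos hK ?_ ?_ ?_ ?_
    · rw [hKe, b2]
      exact union_subset_union_left _ (seg_sub_right c3)
    · rw [hpw, hKe]; exact c1
    · rw [hKe]
      intro hx
      have := (c4 _ hx).1
      simp at this
      linarith
    · intro h hh hhe hcK
      rw [hpw] at hcK
      exact hcx (hseg h hh hhe c c3 hcK)
  · intro p hp
    rw [hpw, hpos x hxS] at hp
    have hp1 : p ∈ segment ℝ (pos x) (q e) := seg_sub_left c3 (openSegment_subset_segment _ _ _ hp)
    have hp2 : p ≠ pos x ∧ ‖p - pos x‖ < r / 2 := by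
      rw [openSegment_eq_image'] at hp
      obtain ⟨s, hs, rfl⟩ := hp
      constructor
      · intro h
        have : s • (c - pos x) = 0 := by linear_combination h
        rcases smul_eq_zero.1 this with h | h
        · exact hs.1.ne' h
        · exact hcx (sub_eq_zero.1 h)
      · simp only [add_sub_cancel_left, norm_smul, c2]
        rw [Real.norm_of_nonneg hs.1.le]
        nlinarith [hs.2]
    constructor
    · rintro z (rfl | hz) hzp
      · rw [hpw] at hzp
        subst hzp
        linarith [hp2.2]
      · rw [hpos z hz] at hzp
        by_cases hzx : z = x
        · subst hzx; exact hp2.1 hzp.symm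
        · have := h1 z hz hzx
          rw [hzp] at this
          linarith [hp2.2]
    · intro h hh hpK
      by_cases hhe : h = e
      · subst hhe
        rw [hKe] at hpK
        linarith [(c4 p hpK).1, hp2.2]
      · rw [hK h hh hhe] at hpK
        exact hp2.1 (hseg h hh hhe p hp1 hpK)

theorem sphere_infinite (x : ℂ) {r : ℝ} (hr : 0 < r) : (sphere x r).Infinite := by
  have : (fun t : ℝ => x + r * Complex.exp (t * Complex.I)) '' Icc 0 1 ⊆ sphere x r := by
    rintro _ ⟨t, -, rfl⟩
    simp [abs_of_pos hr, Complex.norm_exp_ofReal_mul_I]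
  refine Set.Infinite.mono this (Set.Infinite.image ?_ (Icc_infinite one_pos))
  intro s hs t ht hst
  have h1 : Complex.exp (s * Complex.I) = Complex.exp (t * Complex.I) := by
    have hr' : (r : ℂ) ≠ 0 := by exact_mod_cast hr.ne'
    exact mul_left_cancel₀ hr' (add_left_cancel hst)
  have h2 := congrArg Complex.arg h1
  rw [Complex.arg_exp_mul_I, Complex.arg_exp_mul_I,
    (toIocMod_eq_self Real.two_pi_pos).2, (toIocMod_eq_self Real.two_pi_pos).2] at h2
  · exact h2
  · constructor <;> linarith [ht.1, ht.2, Real.pi_gt_three]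
  · constructor <;> linarith [hs.1, hs.2, Real.pi_gt_three]

theorem Good.pendant (G : Good S E en pos K) (hS : S.Finite) (hE : E.Finite)
    {x w : T} (hxS : x ∈ S) (hw : w ∉ S) :
    ∃ pos' K', Good (insert w S) E en pos' K' ∧
      Free (insert w S) E pos' K' (pos' x) (pos' w) := by
  classical
  obtain ⟨r, hr, q, K2, K', G', h1, h2, h3, h4⟩ := G.radial hS hE hxS
  obtain ⟨c, hc, hcq⟩ : ∃ c ∈ sphere (pos x) r, c ∉ q '' E :=
    ((sphere_infinite (pos x) hr).sdiff (hE.image q)).nonempty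
  rw [mem_sphere, dist_eq_norm] at hc
  let pos' := Function.update pos w c
  have hpw : pos' w = c := by simp [pos']
  have hpos : ∀ z ∈ S, pos' z = pos z := by
    intro z hz
    have : z ≠ w := by rintro rfl; exact hw hz
    simp [pos', this]
  have hseg : ∀ h ∈ E, ∀ p ∈ segment ℝ (pos x) c, p ∈ K' h → p = pos x := by
    intro h hh p hp hpK
    have hpr := seg_closedBall hc hp
    have hne : q h ≠ c := fun hh' => hcq ⟨h, hh, hh'⟩
    by_cases hxh : x ∈ en h
    · obtain ⟨y', hy'⟩ := hxh
      obtain ⟨d1, d2, d3, d4⟩ := h3 h hh y' hy'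
      rw [d2] at hpK
      rcases hpK with hpK | hpK
      · exact (seg_radius hr d1 hc hpK hp).resolve_right hne
      · have := d4 p hpK hpr
        subst this
        exact absurd (seg_sphere hr hc hp (right_mem_segment _ _ _) d1 hc) hne
    · have := h2 h hh hxh p hpK
      linarith
  have hcx : c ≠ pos x := by rintro rfl; simp at hc; linarith
  refine ⟨pos', K', ?_, ?_⟩
  · refine G'.addIso hpos ?_ ?_
    · intro z hz hzw
      rw [hpw] at hzw
      by_cases hzx : z = x
      · subst hzx; exact hcx hzw.symm
      · have := h1 z hz hzx
        rw [hzw] at this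
        linarith
    · intro h hh hcK
      rw [hpw] at hcK
      exact hcx (hseg h hh c (right_mem_segment _ _ _) hcK)
  · intro p hp
    rw [hpw, hpos x hxS] at hp
    have hp1 : p ∈ segment ℝ (pos x) c := openSegment_subset_segment _ _ _ hp
    have hp2 : p ≠ pos x ∧ ‖p - pos x‖ < r := by
      rw [openSegment_eq_image'] at hp
      obtain ⟨s, hs, rfl⟩ := hp
      constructor
      · intro h
        have : s • (c - pos x) = 0 := by linear_combination h
        rcases smul_eq_zero.1 this with h | h
        · exact hs.1.ne' h
        · exact hcx (sub_eq_zero.1 h)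
      · simp only [add_sub_cancel_left, norm_smul, hc]
        rw [Real.norm_of_nonneg hs.1.le]
        nlinarith [hs.2]
    constructor
    · rintro z (rfl | hz) hzp
      · rw [hpw] at hzp
        subst hzp
        linarith [hp2.2]
      · rw [hpos z hz] at hzp
        by_cases hzx : z = x
        · subst hzx; exact hp2.1 hzp.symm
        · have := h1 z hz hzx
          rw [hzp] at this
          linarith [hp2.2]
    · intro h hh hpK
      exact hp2.1 (hseg h hh p hp1 hpK)

theorem circArc {x c c' : ℂ} {ρ : ℝ} (hρ : 0 < ρ) (hc : ‖c - x‖ = ρ) (hc' : ‖c' - x‖ = ρ)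
    (hne : c ≠ c') : ∃ A, IsArc c c' A ∧ ∀ p ∈ A, ‖p - x‖ = ρ := by
  have main : ∀ c c' : ℂ, ‖c - x‖ = ρ → ‖c' - x‖ = ρ → c ≠ c' →
      Complex.arg (c - x) ≤ Complex.arg (c' - x) → ∃ A, IsArc c c' A ∧ ∀ p ∈ A, ‖p - x‖ = ρ := by
    intro c c' hc hc' hne hle
    have e1 : x + ρ * Complex.exp (Complex.arg (c - x) * Complex.I) = c := by
      rw [← hc, Complex.norm_mul_exp_arg_mul_I]; ring
    have e2 : x + ρ * Complex.exp (Complex.arg (c' - x) * Complex.I) = c' := by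
      rw [← hc', Complex.norm_mul_exp_arg_mul_I]; ring
    have hlt : Complex.arg (c - x) < Complex.arg (c' - x) := by
      refine lt_of_le_of_ne hle fun h => hne ?_
      rw [← e1, ← e2, h]
    refine ⟨(fun t : ℝ => x + ρ * Complex.exp (t * Complex.I)) ''
      Icc (Complex.arg (c - x)) (Complex.arg (c' - x)), ?_, ?_⟩
    · have := isArc_of_Icc hlt (γ := fun t : ℝ => x + ρ * Complex.exp (t * Complex.I))
        (by fun_prop) ?_
      · simp only [e1, e2] at this
        exact this
      · intro s hs t ht hst
        have h1 : Complex.exp (s * Complex.I) = Complex.exp (t * Complex.I) := by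
          have hr' : (ρ : ℂ) ≠ 0 := by exact_mod_cast hρ.ne'
          exact mul_left_cancel₀ hr' (add_left_cancel hst)
        have h2 := congrArg Complex.arg h1
        have l := Complex.neg_pi_lt_arg (c - x)
        have u := Complex.arg_le_pi (c' - x)
        rw [Complex.arg_exp_mul_I, Complex.arg_exp_mul_I,
          (toIocMod_eq_self Real.two_pi_pos).2, (toIocMod_eq_self Real.two_pi_pos).2] at h2
        · exact h2
        · constructor <;> linarith [ht.1, ht.2]
        · constructor <;> linarith [hs.1, hs.2]
    · rintro _ ⟨t, -, rfl⟩
      simp [abs_of_pos hρ, Complex.norm_exp_ofReal_mul_I]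
  rcases le_total (Complex.arg (c - x)) (Complex.arg (c' - x)) with h | h
  · exact main c c' hc hc' hne h
  · obtain ⟨A, h1, h2⟩ := main c' c hc' hc hne.symm h
    exact ⟨A, h1.symm, h2⟩

end QPA

end

section
open Set Metric

namespace QPA

variable {T ι : Type}
variable {S S' : Set T} {E E' : Set ι} {en en' : ι → Sym2 T} {pos pos' : T → ℂ} {K K' : ι → Set ℂ}

theorem Good.rot (G : Good S E en pos K) (hS : S.Finite) (hE : E.Finite) {e e' r : ι} (he : e ∈ E)
    (he' : e' ∈ E) (hee : e ≠ e') (hr : r ∉ E)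
    {x y z w w' : T} (hxy : en e = s(y, x)) (hxz : en e' = s(x, z)) (hw : w ∉ S) (hw' : w' ∉ S)
    (hww : w ≠ w')
    (hen : ∀ h ∈ E, h ≠ e → h ≠ e' → en' h = en h) (hene : en' e = s(y, w))
    (hene' : en' e' = s(w', z)) (henr : en' r = s(w, w')) :
    ∃ pos' K', Good (insert w' (insert w S)) (insert r E) en' pos' K' := by
  classical
  have hxS : x ∈ S := G.mem e he x (by simp [hxy])
  have hyS : y ∈ S := G.mem e he y (by simp [hxy])
  have hzS : z ∈ S := G.mem e' he' z (by simp [hxz])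
  obtain ⟨R, hR, q, K2, K', G', h1, h2, h3, h4⟩ := G.radial hS hE hxS
  have hxy' : en e = s(x, y) := by rw [hxy, Sym2.eq_swap]
  have hxz' : en e' = s(z, x) := by rw [hxz, Sym2.eq_swap]
  obtain ⟨b1, b2, b3, b4⟩ := h3 e he y hxy'
  obtain ⟨b1', b2', b3', b4'⟩ := h3 e' he' z hxz
  obtain ⟨c, c1, c2, c3, c4⟩ := trim hR b1 b3 b4
  obtain ⟨c', c1', c2', c3', c4'⟩ := trim hR b1' b3' b4'
  have hqq := h4 e he e' he' (by simp [hxy]) (by simp [hxz]) hee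
  have hcx : c ≠ pos x := by rintro rfl; simp at c2; linarith
  have hcx' : c' ≠ pos x := by rintro rfl; simp at c2'; linarith
  have hcc : c ≠ c' := by
    rintro rfl
    exact hcx ((seg_radius hR b1 b1' c3 c3').resolve_right hqq)
  obtain ⟨A, hA, hAr⟩ := circArc (half_pos hR) c2 c2' hcc
  have hre : r ≠ e := by rintro rfl; exact hr he
  have hre' : r ≠ e' := by rintro rfl; exact hr he'
  have hseg : ∀ e ∈ E, x ∈ en e → ‖q e - pos x‖ = R → ∀ h ∈ E, h ≠ e →
      ∀ p ∈ segment ℝ (pos x) (q e), p ∈ K' h → p = pos x := by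
    intro e he hxe b1 h hh hhe p hp hpK
    have hpr := seg_closedBall b1 hp
    by_cases hxh : x ∈ en h
    · obtain ⟨y', hy'⟩ := hxh
      obtain ⟨d1, d2, d3, d4⟩ := h3 h hh y' hy'
      have hne := h4 h hh e he (by simp [hy']) hxe hhe
      rw [d2] at hpK
      rcases hpK with hpK | hpK
      · exact (seg_radius hR d1 b1 hpK hp).resolve_right hne
      · have := d4 p hpK hpr
        subst this
        exact absurd (seg_sphere hR b1 hp (right_mem_segment _ _ _) d1 b1) hne
    · have := h2 h hh hxh p hpK
      linarith
  -- first shortening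
  let Ke := segment ℝ c (q e) ∪ K2 e
  let Ke' := segment ℝ c' (q e') ∪ K2 e'
  let pos1 := Function.update pos w c
  let pos2 := Function.update pos1 w' c'
  let K1 := Function.update K' e Ke
  let K3 := Function.update (Function.update K1 e' Ke') r A
  let en1 := Function.update en e s(y, w)
  have hneS : ∀ z ∈ S, z ≠ w ∧ z ≠ w' := by
    intro z hz
    exact ⟨by rintro rfl; exact hw hz, by rintro rfl; exact hw' hz⟩
  have hp1w : pos1 w = c := by simp [pos1]
  have hp1 : ∀ z ∈ S, pos1 z = pos z := fun z hz => by simp [pos1, (hneS z hz).1]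
  have hKeS : Ke ⊆ K' e := by rw [b2]; exact union_subset_union_left _ (seg_sub_right c3)
  have hKeS' : Ke' ⊆ K' e' := by rw [b2']; exact union_subset_union_left _ (seg_sub_right c3')
  have hxKe : pos x ∉ Ke := by
    intro hx
    have := (c4 _ hx).1
    simp at this
    linarith
  have hxKe' : pos x ∉ Ke' := by
    intro hx
    have := (c4' _ hx).1
    simp at this
    linarith
  have G1 : Good (insert w S) E en1 pos1 K1 := by
    refine G'.shorten he hxy hw (fun h _ hhe => by simp [en1, hhe]) (by simp [en1]) hp1
      (fun h _ hhe => by simp [K1, hhe]) (by simpa [K1] using hKeS)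
      (by rw [hp1w]; simpa [K1] using c1) (by simpa [K1] using hxKe) ?_
    intro h hh hhe hc
    rw [hp1w] at hc
    exact hcx (hseg e he (by simp [hxy]) b1 h hh hhe c c3 hc)
  have hp2w' : pos2 w' = c' := by simp [pos2]
  have hp2w : pos2 w = c := by simp [pos2, hww, hp1w]
  have hp2 : ∀ z ∈ S, pos2 z = pos z := fun z hz => by simp [pos2, (hneS z hz).2, hp1 z hz]
  have hp21 : ∀ z ∈ insert w S, pos2 z = pos1 z := by
    rintro z (rfl | hz)
    · rw [hp2w, hp1w]
    · rw [hp2 z hz, hp1 z hz]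
  have hrE : ∀ h ∈ E, h ≠ r := by rintro h hh rfl; exact hr hh
  have hK3e : K3 e = Ke := by simp [K3, K1, hre.symm, hee]
  have hK3e' : K3 e' = Ke' := by simp [K3, hre'.symm]
  have hK3r : K3 r = A := by simp [K3]
  have hK3 : ∀ h ∈ E, h ≠ e → h ≠ e' → K3 h = K' h := by
    intro h hh a b
    simp [K3, K1, hrE h hh, a, b]
  have hK31 : ∀ h ∈ E, h ≠ e' → K3 h = K1 h := by
    intro h hh b
    simp [K3, hrE h hh, b]
  have hK3s : ∀ h ∈ E, K3 h ⊆ K' h := by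
    intro h hh
    by_cases h5 : h = e
    · rw [h5, hK3e]; exact hKeS
    by_cases h6 : h = e'
    · rw [h6, hK3e']; exact hKeS'
    rw [hK3 h hh h5 h6]
  have hen1e' : en1 e' = s(z, x) := by simp [en1, hee.symm, hxz']
  have G2 : Good (insert w' (insert w S)) E en' pos2 K3 := by
    refine G1.shorten he' hen1e' ?_ ?_ (by rw [hene', Sym2.eq_swap]) hp21 hK31 ?_ ?_ ?_ ?_
    · rintro (h | h)
      · exact hww h.symm
      · exact hw' h
    · intro h hh hhe'
      by_cases hhe : h = e
      · subst hhe; simp [en1, hene]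
      · rw [hen h hh hhe hhe']; simp [en1, hhe]
    · rw [hK3e']; simpa [K1, hee.symm] using hKeS'
    · rw [hp1 z hzS, hp2w', hK3e']; exact c1'
    · rw [hp1 x hxS, hK3e']; exact hxKe'
    · intro h hh hhe' hc
      rw [hp2w'] at hc
      have : c' ∈ K' h := by
        have := hK3s h hh
        rw [hK31 h hh hhe'] at this
        exact this hc
      exact hcx' (hseg e' he' (by simp [hxz]) b1' h hh hhe' c' c3' this)
  -- the arc meets edges
  have hAe : ∀ p ∈ A, p ∈ Ke → p = c := fun p hp hp' => (c4 p hp').2 (hAr p hp)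
  have hAe' : ∀ p ∈ A, p ∈ Ke' → p = c' := fun p hp hp' => (c4' p hp').2 (hAr p hp)
  have hAf : ∀ f ∈ E, ∀ p ∈ A, p ∈ K' f → x ∈ en f ∧ p ∈ segment ℝ (pos x) (q f) ∧
      ‖q f - pos x‖ = R := by
    intro f hf p hp hpf
    have hpr := hAr p hp
    by_cases hxf : x ∈ en f
    · refine ⟨hxf, ?_⟩
      obtain ⟨y', hy'⟩ := hxf
      obtain ⟨d1, d2, d3, d4⟩ := h3 f hf y' hy'
      refine ⟨?_, d1⟩
      rw [d2] at hpf
      rcases hpf with hpf | hpf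
      · exact hpf
      · rw [d4 p hpf (by linarith)]; exact right_mem_segment _ _ _
    · have := h2 f hf hxf p hpf
      linarith
  have henw : ∀ f ∈ E, f ≠ e → f ≠ e' → w ∉ en' f ∧ w' ∉ en' f := by
    intro f hf hfe hfe'
    rw [hen f hf hfe hfe']
    exact ⟨fun h => hw (G.mem f hf _ h), fun h => hw' (G.mem f hf _ h)⟩
  refine ⟨pos2, K3, G2.addEdge ?_ ?_ ?_ ?_ ?_ ?_⟩
  · intro a ha
    rw [henr, Sym2.mem_iff] at ha
    rcases ha with rfl | rfl
    · exact Or.inr (Or.inl rfl)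
    · exact Or.inl rfl
  · intro a b hab
    rw [henr] at hab
    rw [hK3r]
    rw [← hp2w, ← hp2w'] at hA
    rcases Sym2.eq_iff.1 hab with ⟨rfl, rfl⟩ | ⟨rfl, rfl⟩
    · exact hA
    · exact hA.symm
  · rw [hK3r]
    rintro v (rfl | rfl | hv) hvA
    · simp [henr]
    · simp [henr]
    · exfalso
      rw [hp2 v hv] at hvA
      have := hAr _ hvA
      by_cases hvx : v = x
      · subst hvx; simp at this; linarith
      · linarith [h1 v hv hvx]
  · intro f hf _
    rw [hK3r]
    apply Set.Subsingleton.finite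
    rintro p ⟨hp1, hp2⟩ p' ⟨hp1', hp2'⟩
    obtain ⟨-, a1, a2⟩ := hAf f hf p hp1 (hK3s f hf hp2)
    obtain ⟨-, a1', -⟩ := hAf f hf p' hp1' (hK3s f hf hp2')
    exact seg_sphere hR a2 a1 a1' (hAr p hp1) (hAr p' hp1')
  · intro f hf _ v hv hvf p hp hpf
    rw [hK3r] at hp
    by_cases hfe : f = e
    · subst hfe
      rw [hK3e] at hpf
      exact ⟨w, by simp [henr], by simp [hene], by rw [hp2w, hAe p hp hpf]⟩
    by_cases hfe' : f = e'
    · subst hfe'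
      rw [hK3e'] at hpf
      exact ⟨w', by simp [henr], by simp [hene'], by rw [hp2w', hAe' p hp hpf]⟩
    exfalso
    obtain ⟨a, b⟩ := henw f hf hfe hfe'
    rw [henr, Sym2.mem_iff] at hv
    rcases hv with rfl | rfl
    · exact a hvf
    · exact b hvf
  · have key : ∀ f ∈ E, X en' K3 r f → x ∈ en' f := by
      intro f hf ⟨d1, p, d2, d3⟩
      rw [hK3r] at d2
      have hfe : f ≠ e := by
        rintro rfl
        exact d1 w (by simp [henr]) (by simp [hene])
      have hfe' : f ≠ e' := by
        rintro rfl
        exact d1 w' (by simp [henr]) (by simp [hene'])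
      rw [hen f hf hfe hfe']
      exact (hAf f hf p d2 (hK3s f hf d3)).1
    intro f hf g hg a1 a2 a3
    exact a3.1 x (key f hf a1) (key g hg a2)

end QPA

end

section
open Set Metric

namespace QPA

section slit

def SD : Set ℂ := {z | ∀ t : ℝ, 0 < t → t < 1 → z ≠ t}

noncomputable def sq (z : ℂ) : ℂ := z ^ (2⁻¹ : ℂ)

theorem sq_sq (z : ℂ) : sq z ^ 2 = z := by
  have := Complex.cpow_nat_inv_pow z (n := 2) (by norm_num)
  simpa [sq] using this

theorem sq_re {z : ℂ} (hz : z ∈ Complex.slitPlane) : 0 < (sq z).re := by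
  rw [sq, Complex.cpow_inv_two_re]
  apply Real.sqrt_pos.2
  have h1 := Complex.abs_re_le_norm z
  rcases Complex.mem_slitPlane_iff.1 hz with h | h
  · have := norm_nonneg z; linarith
  · have h2 := (Complex.abs_re_lt_norm).2 h
    have := (abs_lt.1 h2).1
    linarith

theorem sq_zero : sq 0 = 0 := by
  rw [sq, Complex.zero_cpow]; norm_num

theorem sq_cont {z : ℂ} (hz : z = 0 ∨ z ∈ Complex.slitPlane) : ContinuousAt sq z := by
  apply Complex.continuousAt_cpow_const_of_re_pos
  · rcases hz with rfl | hz
    · simp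
    · rcases Complex.mem_slitPlane_iff.1 hz with h | h
      · exact Or.inl h.le
      · exact Or.inr h
  · norm_num

theorem SD_slit {z : ℂ} (hz : z ∈ SD) (h1 : z ≠ 1) (h0 : z ≠ 0) :
    z / (z - 1) ∈ Complex.slitPlane := by
  by_contra h
  have hz1 : z - 1 ≠ 0 := sub_ne_zero.2 h1
  rw [Complex.mem_slitPlane_iff, not_or, not_lt, not_not] at h
  set ζ := z / (z - 1) with hζ
  obtain ⟨c, hc⟩ : ∃ c : ℝ, ζ = c := ⟨ζ.re, Complex.ext rfl (by simpa using h.2)⟩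
  have hc0 : c ≤ 0 := by rw [hc] at h; simpa using h.1
  have hc1 : c ≠ 0 := by
    rintro rfl
    have : z / (z - 1) = 0 := by rw [← hζ, hc]; simp
    rcases div_eq_zero_iff.1 this with h | h
    · exact h0 h
    · exact hz1 h
  have hcneg : c < 0 := lt_of_le_of_ne hc0 hc1
  have hcc : (c : ℂ) - 1 ≠ 0 := by
    have : c - 1 ≠ 0 := by linarith
    exact_mod_cast this
  refine hz (c / (c - 1)) (div_pos_of_neg_of_neg hcneg (by linarith)) ?_ ?_
  · rw [div_lt_one_of_neg (by linarith)]; linarith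
  · have e : z = c * (z - 1) := by rw [← hc, hζ, div_mul_cancel₀ _ hz1]
    push_cast
    rw [eq_div_iff hcc]
    linear_combination (-1 : ℂ) * e

noncomputable def slit (z : ℂ) : ℂ :=
  if z = 1 then 1 else (Complex.I * sq (z / (z - 1))) / (Complex.I * sq (z / (z - 1)) + 1)

theorem slit_zero : slit 0 = 0 := by simp [slit, sq_zero]
theorem slit_one : slit 1 = 1 := by simp [slit]

theorem slit_denom {z : ℂ} (hz : z ∈ SD) (h1 : z ≠ 1) :
    Complex.I * sq (z / (z - 1)) + 1 ≠ 0 := by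
  intro h
  by_cases h0 : z = 0
  · simp [h0, sq_zero] at h
  · have := sq_re (SD_slit hz h1 h0)
    have h2 := congrArg Complex.im h
    simp at h2
    linarith

theorem slit_im {z : ℂ} (hz : z ∈ SD) (h1 : z ≠ 1) (h0 : z ≠ 0) : 0 < (slit z).im := by
  have hr := sq_re (SD_slit hz h1 h0)
  have hd := slit_denom hz h1
  rw [slit, if_neg h1, Complex.div_im]
  set s := sq (z / (z - 1))
  have hn : 0 < Complex.normSq (Complex.I * s + 1) := Complex.normSq_pos.2 hd
  rw [← sub_div]
  apply div_pos _ hn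
  simp
  nlinarith

theorem slit_inj : InjOn slit SD := by
  have hne1 : ∀ z ∈ SD, z ≠ 1 → slit z ≠ 1 := by
    intro z hz h1 h
    rw [slit, if_neg h1, div_eq_one_iff_eq (slit_denom hz h1)] at h
    simp at h
  intro z hz z' hz' h
  by_cases h1 : z = 1
  · by_contra hne
    subst h1
    exact hne1 z' hz' (Ne.symm hne) (by rw [← h, slit_one])
  by_cases h1' : z' = 1
  · subst h1'
    exact absurd (by rw [h, slit_one]) (hne1 z hz h1)
  have hd := slit_denom hz h1
  have hd' := slit_denom hz' h1'
  rw [slit, slit, if_neg h1, if_neg h1', div_eq_div_iff hd hd'] at h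
  have h2 : sq (z / (z - 1)) = sq (z' / (z' - 1)) := by
    have : Complex.I * sq (z / (z - 1)) = Complex.I * sq (z' / (z' - 1)) := by
      linear_combination h
    exact mul_left_cancel₀ Complex.I_ne_zero this
  have h3 : z / (z - 1) = z' / (z' - 1) := by rw [← sq_sq (z / (z - 1)), h2, sq_sq]
  rw [div_eq_div_iff (sub_ne_zero.2 h1) (sub_ne_zero.2 h1')] at h3
  linear_combination (-1 : ℂ) * h3

theorem slit_cont : ContinuousOn slit SD := by
  intro z hz
  by_cases h1 : z = 1
  · subst h1
    have heq : ∀ w ∈ SD, w ≠ 0 → slit w = 1 / (1 - Complex.I * sq ((w - 1) / w)) := by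
      intro w hw h0
      by_cases h1 : w = 1
      · simp [h1, slit, sq_zero]
      have hs := SD_slit hw h1 h0
      have e : sq ((w - 1) / w) = (sq (w / (w - 1)))⁻¹ := by
        rw [sq, sq, ← Complex.inv_cpow _ _ (Complex.mem_slitPlane_iff_arg.1 hs).1, inv_div]
      have hd := slit_denom hw h1
      rw [slit, if_neg h1, e]
      set s := sq (w / (w - 1))
      have hs0 : s ≠ 0 := by
        intro h
        have := sq_re hs
        change 0 < s.re at this
        rw [h] at this
        simp at this
      have h4 : 1 - Complex.I * s⁻¹ ≠ 0 := by
        intro h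
        apply hd
        have h5 : s = Complex.I := by
          have : s * (1 - Complex.I * s⁻¹) = 0 := by rw [h, mul_zero]
          rw [mul_sub, mul_one, mul_comm Complex.I, ← mul_assoc, mul_inv_cancel₀ hs0] at this
          linear_combination this
        rw [h5]; simp
      rw [div_eq_div_iff hd h4]
      field_simp
      linear_combination (-1 : ℂ) * Complex.I_sq
    have hc : ContinuousAt (fun w : ℂ => 1 / (1 - Complex.I * sq ((w - 1) / w))) 1 := by
      have h2 : ContinuousAt (fun w : ℂ => (w - 1) / w) 1 :=
        ContinuousAt.div (by fun_prop) (by fun_prop) one_ne_zero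
      have h3 : ContinuousAt (fun w : ℂ => sq ((w - 1) / w)) 1 := by
        refine ContinuousAt.comp (f := fun w : ℂ => (w - 1) / w) (g := sq) ?_ h2
        apply sq_cont
        left; simp
      refine ContinuousAt.div continuousAt_const (continuousAt_const.sub
        (continuousAt_const.mul h3)) ?_
      simp [sq_zero]
    refine (hc.continuousWithinAt (s := SD)).congr_of_eventuallyEq ?_ ?_
    · have : ∀ᶠ w : ℂ in nhdsWithin 1 SD, w ≠ 0 :=
        nhdsWithin_le_nhds (isOpen_ne.mem_nhds one_ne_zero)
      filter_upwards [this, self_mem_nhdsWithin] with w h0 hw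
      exact heq w hw h0
    · exact heq 1 hz one_ne_zero
  · have hz1 : z - 1 ≠ 0 := sub_ne_zero.2 h1
    have h2 : ContinuousAt (fun w : ℂ => w / (w - 1)) z :=
      ContinuousAt.div (by fun_prop) (by fun_prop) hz1
    have h3 : ContinuousAt (fun w : ℂ => sq (w / (w - 1))) z := by
      refine ContinuousAt.comp (f := fun w : ℂ => w / (w - 1)) (g := sq) ?_ h2
      apply sq_cont
      by_cases h0 : z = 0
      · left; simp [h0]
      · right; exact SD_slit hz h1 h0
    have h4 : ContinuousAt (fun w : ℂ => (Complex.I * sq (w / (w - 1))) /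
        (Complex.I * sq (w / (w - 1)) + 1)) z :=
      ContinuousAt.div (continuousAt_const.mul h3) ((continuousAt_const.mul h3).add
        continuousAt_const) (slit_denom hz h1)
    refine (h4.congr ?_).continuousWithinAt
    filter_upwards [isOpen_ne.mem_nhds h1] with w hw
    exact (if_neg hw).symm

theorem slit_general {a b : ℂ} (hab : a ≠ b) : ∃ φ : ℂ → ℂ, ContinuousOn φ (openSegment ℝ a b)ᶜ ∧
    InjOn φ (openSegment ℝ a b)ᶜ ∧ φ a = 0 ∧ φ b = 1 ∧
    ∀ z ∉ openSegment ℝ a b, z ≠ a → z ≠ b → 0 < (φ z).im := by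
  have hba : b - a ≠ 0 := sub_ne_zero.2 hab.symm
  let ψ : ℂ → ℂ := fun z => (z - a) / (b - a)
  have hψ : Continuous ψ := by fun_prop
  have hinj : Function.Injective ψ := by
    intro z w h
    have := (div_left_inj' hba).1 h
    exact sub_left_injective this
  have hm : MapsTo ψ (openSegment ℝ a b)ᶜ SD := by
    intro z hz t h0 h1 h
    apply hz
    rw [openSegment_eq_image']
    refine ⟨t, ⟨h0, h1⟩, ?_⟩
    have : z - a = t * (b - a) := (div_eq_iff hba).1 h
    simp only [Complex.real_smul]
    linear_combination (-1 : ℂ) * this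
  have ha : ψ a = 0 := by simp [ψ]
  have hb : ψ b = 1 := div_self hba
  refine ⟨slit ∘ ψ, slit_cont.comp hψ.continuousOn hm, slit_inj.comp hinj.injOn hm, ?_, ?_, ?_⟩
  · simp [ha, slit_zero]
  · simp [hb, slit_one]
  · intro z hz hza hzb
    refine slit_im (hm hz) ?_ ?_
    · rw [← hb]; exact hinj.ne hzb
    · rw [← ha]; exact hinj.ne hza

end slit

variable {T ι : Type}
variable {S S' S1 S2 : Set T} {E E' E1 E2 : Set ι} {en en' : ι → Sym2 T}
  {pos pos' p1 p2 : T → ℂ} {K K' K1 K2 : ι → Set ℂ}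

theorem Good.map (G : Good S E en pos K) {φ : ℂ → ℂ} {D : Set ℂ} (hc : ContinuousOn φ D)
    (hi : InjOn φ D) (hS : ∀ z ∈ S, pos z ∈ D) (hE : ∀ e ∈ E, K e ⊆ D) :
    Good S E en (fun z => φ (pos z)) (fun e => φ '' K e) := by
  have hinter : ∀ e ∈ E, ∀ f ∈ E, φ '' K e ∩ φ '' K f = φ '' (K e ∩ K f) := fun e he f hf =>
    (hi.image_inter (hE e he) (hE f hf)).symm
  have hX : ∀ e ∈ E, ∀ f ∈ E, X en (fun e => φ '' K e) e f → X en K e f := by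
    intro e he f hf ⟨h1, h2⟩
    refine ⟨h1, ?_⟩
    simp only at h2
    rw [hinter e he f hf] at h2
    exact h2.of_image
  refine ⟨?_, G.mem, ?_, ?_, ?_, ?_, ?_⟩
  · intro a ha b hb h
    exact G.inj ha hb (hi (hS a ha) (hS b hb) h)
  · intro e he a b hab
    exact (G.arc e he a b hab).map hc hi (hE e he)
  · rintro e he z hz ⟨p, hp, hpz⟩
    have := hi (hE e he hp) (hS z hz) hpz
    subst this
    exact G.vert e he z hz hp
  · intro e he f hf hne
    rw [hinter e he f hf]
    exact (G.fin e he f hf hne).image φ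
  · intro e he f hf hne z hz hz' p hp
    rw [hinter e he f hf] at hp
    obtain ⟨p, hp, rfl⟩ := hp
    obtain ⟨z', a, b, rfl⟩ := G.sh e he f hf hne z hz hz' p hp
    exact ⟨z', a, b, rfl⟩
  · intro e he f hf g hg h1 h2 h3
    exact G.qp e he f hf g hg (hX _ he _ hf h1) (hX _ he _ hg h2) (hX _ hf _ hg h3)

/-- normal form : all in the upper half plane, `x ↦ 0`, `w ↦ 1` -/
theorem Good.normal (G : Good S E en pos K) {x w : T} (hx : x ∈ S) (hw : w ∈ S) (hxw : x ≠ w)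
    (hF : Free S E pos K (pos x) (pos w)) :
    ∃ pos' K', Good S E en pos' K' ∧ pos' x = 0 ∧ pos' w = 1 ∧
      (∀ z ∈ S, z ≠ x → z ≠ w → 0 < (pos' z).im) ∧
      ∀ e ∈ E, ∀ p ∈ K' e, p ≠ 0 → p ≠ 1 → 0 < p.im := by
  obtain ⟨φ, h1, h2, h3, h4, h5⟩ := slit_general (a := pos x) (b := pos w)
    (fun h => hxw (G.inj hx hw h))
  have hS : ∀ z ∈ S, pos z ∈ (openSegment ℝ (pos x) (pos w))ᶜ := fun z hz h =>
    (hF _ h).1 z hz rfl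
  have hE : ∀ e ∈ E, K e ⊆ (openSegment ℝ (pos x) (pos w))ᶜ := fun e he p hp h =>
    (hF _ h).2 e he hp
  refine ⟨_, _, G.map h1 h2 hS hE, h3, h4, ?_, ?_⟩
  · intro z hz hzx hzw
    exact h5 _ (hS z hz) (fun h => hzx (G.inj hz hx h)) (fun h => hzw (G.inj hz hw h))
  · rintro e he _ ⟨p, hp, rfl⟩ hp0 hp1
    exact h5 p (hE e he hp) (by rintro rfl; exact hp0 h3) (by rintro rfl; exact hp1 h4)

theorem Good.normal' (G : Good S E en pos K) {x w : T} (hx : x ∈ S) (hw : w ∈ S) (hxw : x ≠ w)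
    (hF : Free S E pos K (pos x) (pos w)) :
    ∃ pos' K', Good S E en pos' K' ∧ pos' x = 0 ∧ pos' w = 1 ∧
      (∀ z ∈ S, z ≠ x → z ≠ w → (pos' z).im < 0) ∧
      ∀ e ∈ E, ∀ p ∈ K' e, p ≠ 0 → p ≠ 1 → p.im < 0 := by
  obtain ⟨pos', K', G', h1, h2, h3, h4⟩ := G.normal hx hw hxw hF
  refine ⟨_, _, G'.map (φ := starRingEnd ℂ) (D := univ) Complex.continuous_conj.continuousOn
    (starRingEnd ℂ).injective.injOn (fun _ _ => mem_univ _) (fun _ _ => subset_univ _), ?_, ?_, ?_, ?_⟩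
  · simp [h1]
  · simp [h2]
  · intro z hz a b
    simpa using h3 z hz a b
  · rintro e he _ ⟨p, hp, rfl⟩ hp0 hp1
    have := h4 e he p hp (by rintro rfl; simp at hp0) (by rintro rfl; simp at hp1)
    simpa using this

theorem glue_aux (G1 : Good S1 E1 en pos K) (G2 : Good S2 E2 en pos K) {x w : T}
    (hx : x ∈ S1 ∩ S2) (hw : w ∈ S1 ∩ S2) (h0 : pos x = 0) (h1 : pos w = 1)
    (a1 : ∀ z ∈ S1, z ≠ x → z ≠ w → 0 < (pos z).im)
    (a2 : ∀ z ∈ S2, z ≠ x → z ≠ w → (pos z).im < 0)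
    (b1 : ∀ e ∈ E1, ∀ p ∈ K e, p ≠ 0 → p ≠ 1 → 0 < p.im)
    (b2 : ∀ e ∈ E2, ∀ p ∈ K e, p ≠ 0 → p ≠ 1 → p.im < 0) :
    Good (S1 ∪ S2) (E1 ∪ E2) en pos K := by
  have b12 : ∀ e ∈ E1, ∀ f ∈ E2, ∀ p ∈ K e, p ∈ K f →
      ∃ z, z ∈ en e ∧ z ∈ en f ∧ pos z = p := by
    intro e he f hf p hp hp'
    by_cases hp0 : p = 0
    · rw [← h0] at hp0
      subst hp0
      exact ⟨x, G1.vert e he x hx.1 hp, G2.vert f hf x hx.2 hp', rfl⟩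
    by_cases hp1 : p = 1
    · rw [← h1] at hp1
      subst hp1
      exact ⟨w, G1.vert e he w hw.1 hp, G2.vert f hf w hw.2 hp', rfl⟩
    have := b1 e he p hp hp0 hp1
    have := b2 f hf p hp' hp0 hp1
    linarith
  have key1 : ∀ e ∈ E1, ∀ f ∈ E2, ∀ {P : Prop}, X en K e f → P := by
    intro e he f hf P ⟨h1, p, hp, hp'⟩
    obtain ⟨z, a, b, -⟩ := b12 e he f hf p hp hp'
    exact absurd b (h1 z a)
  have inj12 : ∀ a ∈ S1, ∀ b ∈ S2, pos a = pos b → a = b := by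
    intro a ha b hb hab
    by_cases hax : a = x
    · subst hax; exact G2.inj hx.2 hb hab
    by_cases haw : a = w
    · subst haw; exact G2.inj hw.2 hb hab
    by_cases hbx : b = x
    · subst hbx; exact G1.inj ha hx.1 hab
    by_cases hbw : b = w
    · subst hbw; exact G1.inj ha hw.1 hab
    have := a1 a ha hax haw
    have := a2 b hb hbx hbw
    rw [hab] at *
    linarith
  have fin01 : ∀ e ∈ E1, ∀ f ∈ E2, (K e ∩ K f).Finite := by
    intro e he f hf
    refine Set.Finite.subset (s := {0, 1}) (by simp) ?_
    rintro p ⟨hp, hp'⟩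
    by_contra hcon
    simp only [mem_insert_iff, mem_singleton_iff, not_or] at hcon
    have := b1 e he p hp hcon.1 hcon.2
    have := b2 f hf p hp' hcon.1 hcon.2
    linarith
  refine ⟨?_, ?_, ?_, ?_, ?_, ?_, ?_⟩
  · rintro a (ha | ha) b (hb | hb) hab
    · exact G1.inj ha hb hab
    · exact inj12 a ha b hb hab
    · exact (inj12 b hb a ha hab.symm).symm
    · exact G2.inj ha hb hab
  · rintro e (he | he) z hz
    · exact Or.inl (G1.mem e he z hz)
    · exact Or.inr (G2.mem e he z hz)
  · rintro e (he | he)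
    · exact G1.arc e he
    · exact G2.arc e he
  · rintro e (he | he) z (hz | hz) hzK
    · exact G1.vert e he z hz hzK
    · refine G1.vert e he z ?_ hzK
      by_cases hzx : z = x
      · subst hzx; exact hx.1
      by_cases hzw : z = w
      · subst hzw; exact hw.1
      have n1 := a2 z hz hzx hzw
      have n2 := b1 e he _ hzK (by rw [← h0]; exact fun h => hzx (G2.inj hz hx.2 h))
        (by rw [← h1]; exact fun h => hzw (G2.inj hz hw.2 h))
      linarith
    · refine G2.vert e he z ?_ hzK
      by_cases hzx : z = x
      · subst hzx; exact hx.2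
      by_cases hzw : z = w
      · subst hzw; exact hw.2
      have n1 := a1 z hz hzx hzw
      have n2 := b2 e he _ hzK (by rw [← h0]; exact fun h => hzx (G1.inj hz hx.1 h))
        (by rw [← h1]; exact fun h => hzw (G1.inj hz hw.1 h))
      linarith
    · exact G2.vert e he z hz hzK
  · rintro e (he | he) f (hf | hf) hne
    · exact G1.fin e he f hf hne
    · exact fin01 e he f hf
    · rw [inter_comm]; exact fin01 f hf e he
    · exact G2.fin e he f hf hne
  · rintro e (he | he) f (hf | hf) hne z hz hz' p hp
    · exact G1.sh e he f hf hne z hz hz' p hp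
    · exact b12 e he f hf p hp.1 hp.2
    · obtain ⟨z', a, b, c⟩ := b12 f hf e he p hp.2 hp.1
      exact ⟨z', b, a, c⟩
    · exact G2.sh e he f hf hne z hz hz' p hp
  · rintro e (he | he) f (hf | hf) g (hg | hg) u1 u2 u3
    · exact G1.qp e he f hf g hg u1 u2 u3
    · exact key1 e he g hg u2
    · exact key1 e he f hf u1
    · exact key1 e he f hf u1
    · exact key1 f hf e he u1.symm
    · exact key1 f hf e he u1.symm
    · exact key1 g hg e he u2.symm
    · exact G2.qp e he f hf g hg u1 u2 u3

theorem glue (G1 : Good S1 E1 en p1 K1) (G2 : Good S2 E2 en p2 K2) {x w : T}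
    (hx : x ∈ S1 ∩ S2) (hw : w ∈ S1 ∩ S2) (hxw : x ≠ w) (hS : ∀ z ∈ S1, z ∈ S2 → z = x ∨ z = w)
    (hE : ∀ e ∈ E1, e ∉ E2)
    (F1 : Free S1 E1 p1 K1 (p1 x) (p1 w)) (F2 : Free S2 E2 p2 K2 (p2 x) (p2 w)) :
    ∃ pos K, Good (S1 ∪ S2) (E1 ∪ E2) en pos K ∧
      Free (S1 ∪ S2) (E1 ∪ E2) pos K (pos x) (pos w) := by
  classical
  obtain ⟨q1, L1, G1', a1, a2, a3, a4⟩ := G1.normal hx.1 hw.1 hxw F1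
  obtain ⟨q2, L2, G2', b1, b2, b3, b4⟩ := G2.normal' hx.2 hw.2 hxw F2
  let pos : T → ℂ := fun z => if z ∈ S1 then q1 z else q2 z
  let K : ι → Set ℂ := fun e => if e ∈ E1 then L1 e else L2 e
  have hp1 : ∀ z ∈ S1, pos z = q1 z := fun z hz => if_pos hz
  have hp2 : ∀ z ∈ S2, pos z = q2 z := by
    intro z hz
    by_cases hz1 : z ∈ S1
    · rcases hS z hz1 hz with rfl | rfl
      · rw [hp1 _ hz1, a1, b1]
      · rw [hp1 _ hz1, a2, b2]
    · exact if_neg hz1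
  have hK1 : ∀ e ∈ E1, K e = L1 e := fun e he => if_pos he
  have hK2 : ∀ e ∈ E2, K e = L2 e := fun e he => if_neg fun h => hE e h he
  have h0 : pos x = 0 := by rw [hp1 x hx.1, a1]
  have h1 : pos w = 1 := by rw [hp1 w hw.1, a2]
  have c1 : ∀ z ∈ S1, z ≠ x → z ≠ w → 0 < (pos z).im :=
    fun z hz u v => by rw [hp1 z hz]; exact a3 z hz u v
  have c2 : ∀ z ∈ S2, z ≠ x → z ≠ w → (pos z).im < 0 :=
    fun z hz u v => by rw [hp2 z hz]; exact b3 z hz u v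
  have d1 : ∀ e ∈ E1, ∀ p ∈ K e, p ≠ 0 → p ≠ 1 → 0 < p.im :=
    fun e he => by rw [hK1 e he]; exact a4 e he
  have d2 : ∀ e ∈ E2, ∀ p ∈ K e, p ≠ 0 → p ≠ 1 → p.im < 0 :=
    fun e he => by rw [hK2 e he]; exact b4 e he
  refine ⟨pos, K, glue_aux (G1'.congr (fun _ _ => rfl) hp1 hK1) (G2'.congr (fun _ _ => rfl) hp2 hK2)
    hx hw h0 h1 c1 c2 d1 d2, ?_⟩
  intro p hp
  rw [h0, h1, openSegment_eq_image'] at hp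
  obtain ⟨t, ht, rfl⟩ := hp
  simp only [sub_zero, zero_add, Complex.real_smul, mul_one]
  have ht0 : (t : ℂ) ≠ 0 := by exact_mod_cast ht.1.ne'
  have ht1 : (t : ℂ) ≠ 1 := by exact_mod_cast ht.2.ne
  constructor
  · rintro z hz hzt
    have hzx : z ≠ x := by rintro rfl; exact ht0 (by rw [← hzt, h0])
    have hzw : z ≠ w := by rintro rfl; exact ht1 (by rw [← hzt, h1])
    rcases hz with hz | hz
    · have := c1 z hz hzx hzw
      rw [hzt] at this; simp at this
    · have := c2 z hz hzx hzw
      rw [hzt] at this; simp at this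
  · rintro e (he | he) hpe
    · have := d1 e he _ hpe ht0 ht1
      simp at this
    · have := d2 e he _ hpe ht0 ht1
      simp at this

end QPA

end

section
open Set Metric

namespace QPA

variable {T ι : Type}
variable {S S' S1 S2 : Set T} {E E' E1 E2 : Set ι} {en en' : ι → Sym2 T}
  {pos pos' p1 p2 : T → ℂ} {K K' K1 K2 : ι → Set ℂ}

theorem Good.cutDetach (G : Good S E en pos K) (hS : S.Finite) (hE : E.Finite)
    (hSU : S1 ∪ S2 = S) (hEU : E1 ∪ E2 = E)
    (hm1 : ∀ e ∈ E1, ∀ z ∈ en e, z ∈ S1) (hm2 : ∀ e ∈ E2, ∀ z ∈ en e, z ∈ S2)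
    (hED : ∀ e ∈ E1, e ∉ E2) {e1 e2 : ι} (he1 : e1 ∈ E1) (he2 : e2 ∈ E2) {x y z w : T}
    (hSI : ∀ z ∈ S1, z ∈ S2 → z = x)
    (hxy : en e1 = s(y, x)) (hxz : en e2 = s(x, z)) (hw : w ∉ S)
    (hen : ∀ h ∈ E, h ≠ e1 → h ≠ e2 → en' h = en h) (hene : en' e1 = s(y, w))
    (hene' : en' e2 = s(w, z)) :
    ∃ pos' K', Good (insert w S) E en' pos' K' := by
  have hS1 : S1 ⊆ S := hSU ▸ subset_union_left
  have hS2 : S2 ⊆ S := hSU ▸ subset_union_right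
  have hE1 : E1 ⊆ E := hEU ▸ subset_union_left
  have hE2 : E2 ⊆ E := hEU ▸ subset_union_right
  have hx1 : x ∈ S1 := hm1 e1 he1 x (by simp [hxy])
  have hx2 : x ∈ S2 := hm2 e2 he2 x (by simp [hxz])
  have hxw : x ≠ w := by rintro rfl; exact hw (hS1 hx1)
  obtain ⟨p1, L1, G1, F1⟩ := (G.restrict hS1 hE1 hm1).detach (hS.subset hS1) (hE.subset hE1) he1
    hxy (fun h => hw (hS1 h)) (en' := en') (fun h hh hne => hen h (hE1 hh) hne
      (by rintro rfl; exact hED _ hh he2)) hene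
  obtain ⟨p2, L2, G2, F2⟩ := (G.restrict hS2 hE2 hm2).detach (hS.subset hS2) (hE.subset hE2) he2
    (x := x) (y := z) (by rw [hxz, Sym2.eq_swap]) (fun h => hw (hS2 h)) (en' := en')
    (fun h hh hne => hen h (hE2 hh) (by rintro rfl; exact hED _ he1 hh) hne)
    (by rw [hene', Sym2.eq_swap])
  obtain ⟨pos', K', G', -⟩ := glue G1 G2 (x := x) (w := w) ⟨Or.inr hx1, Or.inr hx2⟩
    ⟨Or.inl rfl, Or.inl rfl⟩ hxw (by
      rintro v (rfl | h1) (h | h2)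
      · exact Or.inr rfl
      · exact Or.inr rfl
      · exact Or.inr h
      · exact Or.inl (hSI v h1 h2)) hED F1 F2
  refine ⟨pos', K', ?_⟩
  rw [hEU] at G'
  have : insert w S1 ∪ insert w S2 = insert w S := by
    rw [← hSU]; ext v; simp only [mem_union, mem_insert_iff]; tauto
  rwa [this] at G'

theorem Good.disconnect (G : Good S E en pos K) (hS : S.Finite) (hE : E.Finite)
    (hSU : S1 ∪ S2 = S) (hEU : E1 ∪ E2 = E)
    (hm1 : ∀ e ∈ E1, ∀ z ∈ en e, z ∈ S1) (hm2 : ∀ e ∈ E2, ∀ z ∈ en e, z ∈ S2)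
    (hED : ∀ e ∈ E1, e ∉ E2) {u v : T} (hu : u ∈ S1) (hv : v ∈ S2)
    (hSI : ∀ z ∈ S1, z ∉ S2) {r : ι} (hr : r ∉ E) (henr : en r = s(u, v)) :
    ∃ pos' K', Good S (insert r E) en pos' K' := by
  classical
  have hS1 : S1 ⊆ S := hSU ▸ subset_union_left
  have hS2 : S2 ⊆ S := hSU ▸ subset_union_right
  have hE1 : E1 ⊆ E := hEU ▸ subset_union_left
  have hE2 : E2 ⊆ E := hEU ▸ subset_union_right
  have huv : u ≠ v := by rintro rfl; exact hSI _ hu hv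
  have hu2 : u ∉ S2 := hSI u hu
  have hv1 : v ∉ S1 := fun h => hSI v h hv
  obtain ⟨p1, L1, G1, F1⟩ := (G.restrict hS1 hE1 hm1).pendant (hS.subset hS1) (hE.subset hE1) hu hv1
  obtain ⟨p2, L2, G2, F2⟩ := (G.restrict hS2 hE2 hm2).pendant (hS.subset hS2) (hE.subset hE2) hv hu2
  rw [Free, openSegment_symm] at F2
  obtain ⟨pos', K', G', F⟩ := glue G1 G2 (x := u) (w := v) ⟨Or.inr hu, Or.inl rfl⟩
    ⟨Or.inl rfl, Or.inr hv⟩ huv (by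
      rintro z (rfl | h1) (h | h2)
      · exact Or.inr rfl
      · exact Or.inr rfl
      · exact Or.inl h
      · exact absurd h2 (hSI z h1)) hED F1 F2
  have hS' : insert v S1 ∪ insert u S2 = S := by
    rw [← hSU]; ext z; simp only [mem_union, mem_insert_iff]
    constructor
    · rintro ((rfl | h) | (rfl | h))
      · exact Or.inr hv
      · exact Or.inl h
      · exact Or.inl hu
      · exact Or.inr h
    · tauto
  rw [hEU, hS'] at G' F
  have huS := hS1 hu
  have hvS := hS2 hv
  let A := segment ℝ (pos' u) (pos' v)
  let K'' := Function.update K' r A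
  have hKr : K'' r = A := by simp [K'']
  have hK : ∀ h ∈ E, K'' h = K' h := by
    intro h hh
    have : h ≠ r := by rintro rfl; exact hr hh
    simp [K'', this]
  have G'' : Good S E en pos' K'' := G'.congr (fun _ _ => rfl) (fun _ _ => rfl) hK
  have hpne : pos' u ≠ pos' v := fun h => huv (G'.inj huS hvS h)
  have hAc : ∀ p ∈ A, p = pos' u ∨ p = pos' v ∨ p ∈ openSegment ℝ (pos' u) (pos' v) := by
    intro p hp
    have := (insert_endpoints_openSegment ℝ (pos' u) (pos' v)).symm.subset hp
    simpa using this
  have hAf : ∀ f ∈ E, ∀ p ∈ A, p ∈ K'' f → ∃ z, z ∈ en r ∧ z ∈ en f ∧ pos' z = p := by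
    intro f hf p hp hpf
    rcases hAc p hp with rfl | rfl | h
    · exact ⟨u, by simp [henr], G''.vert f hf u huS hpf, rfl⟩
    · exact ⟨v, by simp [henr], G''.vert f hf v hvS hpf, rfl⟩
    · rw [hK f hf] at hpf
      exact absurd hpf ((F p h).2 f hf)
  have key : ∀ f ∈ E, ¬ X en K'' r f := by
    intro f hf ⟨h1, p, hp, hp'⟩
    rw [hKr] at hp
    obtain ⟨z, a, b, -⟩ := hAf f hf p hp hp'
    exact h1 z a b
  refine ⟨pos', K'', G''.addEdge ?_ ?_ ?_ ?_ ?_ ?_⟩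
  · intro z hz
    rw [henr, Sym2.mem_iff] at hz
    rcases hz with rfl | rfl
    · exact huS
    · exact hvS
  · intro a b hab
    rw [henr] at hab
    rw [hKr]
    rcases Sym2.eq_iff.1 hab with ⟨rfl, rfl⟩ | ⟨rfl, rfl⟩
    · exact isArc_segment hpne
    · exact (isArc_segment hpne).symm
  · intro z hz hzA
    rw [hKr] at hzA
    rcases hAc _ hzA with h | h | h
    · simp [henr, G'.inj hz huS h]
    · simp [henr, G'.inj hz hvS h]
    · exact absurd rfl ((F _ h).1 z hz)
  · intro f hf _
    refine Set.Finite.subset (s := {pos' u, pos' v}) (by simp) ?_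
    rintro p ⟨hp, hp'⟩
    rw [hKr] at hp
    obtain ⟨z, a, b, rfl⟩ := hAf f hf p hp hp'
    rw [henr, Sym2.mem_iff] at a
    rcases a with rfl | rfl <;> simp
  · intro f hf _ z _ _ p hp hpf
    rw [hKr] at hp
    exact hAf f hf p hp hpf
  · intro f hf g hg h1
    exact absurd h1 (key f hf)

end QPA

end

section
open Set Metric

namespace QPA

variable {T ι : Type}
variable {S : Set T} {E : Set ι} {en : ι → Sym2 T} {pos : T → ℂ} {K : ι → Set ℂ}

theorem ev_thick {A B : Set ℂ} (hA : IsCompact A) (hB : IsCompact B) (h : Disjoint A B) :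
    ∀ᶠ δ : ℝ in nhdsWithin 0 (Ioi 0), Disjoint (thickening δ A) (thickening δ B) := by
  obtain ⟨δ, hδ, hd⟩ := h.exists_thickenings hA hB.isClosed
  filter_upwards [nhdsWithin_le_nhds (eventually_lt_nhds hδ)] with δ' hδ'
  exact hd.mono (thickening_mono hδ'.le _) (thickening_mono hδ'.le _)

theorem preconn_thick {A : Set ℂ} (hA : IsPreconnected A) {δ : ℝ} (hδ : 0 < δ) :
    IsPreconnected (thickening δ A) := by
  rcases A.eq_empty_or_nonempty with rfl | ⟨a, ha⟩
  · simpa using isPreconnected_empty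
  have : thickening δ A = ⋃₀ ((fun p => A ∪ ball p δ) '' A) := by
    rw [thickening_eq_biUnion_ball]
    ext z
    simp only [mem_iUnion, sUnion_image, mem_union, exists_prop]
    constructor
    · rintro ⟨p, hp, hz⟩; exact ⟨p, hp, Or.inr hz⟩
    · rintro ⟨p, hp, hz | hz⟩
      · exact ⟨z, hz, mem_ball_self hδ⟩
      · exact ⟨p, hp, hz⟩
  rw [this]
  refine isPreconnected_sUnion a _ ?_ ?_
  · rintro _ ⟨p, hp, rfl⟩; exact Or.inl ha
  · rintro _ ⟨p, hp, rfl⟩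
    exact hA.union p hp (mem_ball_self hδ) (convex_ball p δ).isPreconnected

theorem Good.common_radius (G : Good S E en pos K) (hS : S.Finite) (hE : E.Finite) :
    ∃ r > 0, (∀ x ∈ S, ∀ z ∈ S, z ≠ x → 2 * r < ‖pos z - pos x‖) ∧
      (∀ x ∈ S, ∀ h ∈ E, x ∉ en h → ∀ p ∈ K h, r < ‖p - pos x‖) := by
  have h1 : ∀ᶠ r : ℝ in nhdsWithin 0 (Ioi 0), ∀ x ∈ S,
      (∀ z ∈ S, z ≠ x → 2 * r < ‖pos z - pos x‖) ∧
      (∀ h ∈ E, x ∉ en h → ∀ p ∈ K h, r < ‖p - pos x‖) := by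
    rw [Filter.eventually_all_finite hS]
    intro x hx
    obtain ⟨r, hr, h1, h2⟩ := G.exists_radius hS hE hx
    filter_upwards [nhdsWithin_le_nhds (eventually_lt_nhds (half_pos hr)), self_mem_nhdsWithin]
      with s hs hs0
    simp only [mem_Ioi] at hs0
    constructor
    · intro z hz hzx
      linarith [h1 z hz hzx]
    · intro h hh hxh p hp
      linarith [h2 h hh hxh p hp]
  obtain ⟨r, h3, h5⟩ := (h1.and self_mem_nhdsWithin).exists
  exact ⟨r, h5, fun x hx => (h3 x hx).1, fun x hx => (h3 x hx).2⟩

theorem Good.PL (G : Good S E en pos K) (hS : S.Finite) (hE : E.Finite) :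
    ∃ K', Good S E en pos K' ∧ ∀ e ∈ E, ∀ a b, en e = s(a, b) → PArc (pos a) (pos b) (K' e) := by
  classical
  obtain ⟨r, hr, h1, h2⟩ := G.common_radius hS hE
  have hex : ∀ e : ι, ∃ (Q : T → ℂ) (M : Set ℂ), e ∈ E → M ⊆ K e ∧ IsCompact M ∧ IsPreconnected M ∧
      ∀ x ∈ en e, Q x ∈ M ∧ ‖Q x - pos x‖ = r ∧ ∀ p ∈ M, ‖p - pos x‖ ≤ r → p = Q x := by
    intro e
    by_cases he : e ∈ E
    swap
    · exact ⟨fun _ => 0, ∅, fun h => absurd h he⟩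
    induction hab : en e with
    | _ a b =>
    have haS : a ∈ S := G.mem e he a (by simp [hab])
    have hbS : b ∈ S := G.mem e he b (by simp [hab])
    have ha := G.arc e he a b hab
    have hne : b ≠ a := by rintro rfl; exact ha.ne rfl
    have hd := h1 a haS b hbS hne
    obtain ⟨q, hq, hqr, K2, hK2, hA, hlast⟩ :=
      ha.exit (c := pos a) (r := r) (by simpa using hr) (by linarith)
    have hqb : r < ‖q - pos b‖ := by
      have := norm_sub_le_norm_sub_add_norm_sub (pos b) q (pos a)
      rw [norm_sub_rev (pos b) q] at this
      linarith
    obtain ⟨q', hq', hqr', K3, hK3, hA', hlast'⟩ :=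
      hA.symm.exit (c := pos b) (r := r) (by simpa using hr) hqb
    refine ⟨fun x => if x = a then q else q', K3, fun _ => ⟨hK3.trans hK2, hA'.isCompact,
      hA'.isPreconnected, ?_⟩⟩
    intro x hx
    rw [Sym2.mem_iff] at hx
    rcases hx with rfl | rfl
    · simp only [if_true]
      exact ⟨hA'.right_mem, hqr, fun p hp hpr => hlast p (hK3 hp) hpr⟩
    · simp only [if_neg hne]
      exact ⟨hA'.left_mem, hqr', hlast'⟩
  choose Q M hQ using hex
  -- distinct exit points
  have hQne : ∀ e ∈ E, ∀ f ∈ E, e ≠ f → ∀ x, x ∈ en e → x ∈ en f → Q e x ≠ Q f x := by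
    intro e he f hf hne x hxe hxf heq
    obtain ⟨s1, -, -, s4⟩ := hQ e he
    obtain ⟨t1, -, -, t4⟩ := hQ f hf
    obtain ⟨a1, a2, a3⟩ := s4 x hxe
    obtain ⟨b1, b2, b3⟩ := t4 x hxf
    have hxS := G.mem e he x hxe
    obtain ⟨z, hz1, hz2, hz⟩ := G.sh e he f hf hne x hxe hxf (Q e x) ⟨s1 a1, heq ▸ t1 b1⟩
    rw [← hz] at a2
    by_cases hzx : z = x
    · subst hzx; simp at a2; linarith
    · linarith [h1 x hxS z (G.mem e he z hz1) hzx]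
  have hMv : ∀ e ∈ E, ∀ z ∈ S, pos z ∉ M e := by
    intro e he z hz hzM
    obtain ⟨s1, -, -, s4⟩ := hQ e he
    have hze := G.vert e he z hz (s1 hzM)
    obtain ⟨a1, a2, a3⟩ := s4 z hze
    have := a3 _ hzM (by simpa using hr.le)
    rw [← this] at a2
    simp at a2; linarith
  have hMseg : ∀ e ∈ E, ∀ f ∈ E, f ≠ e → ∀ x ∈ en f, Disjoint (M e) (segment ℝ (pos x) (Q f x)) := by
    intro e he f hf hne x hxf
    rw [Set.disjoint_left]
    intro p hp hps
    obtain ⟨s1, -, -, s4⟩ := hQ e he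
    obtain ⟨t1, -, -, t4⟩ := hQ f hf
    obtain ⟨b1, b2, b3⟩ := t4 x hxf
    have hpr := seg_closedBall b2 hps
    have hxS := G.mem f hf x hxf
    by_cases hxe : x ∈ en e
    · obtain ⟨a1, a2, a3⟩ := s4 x hxe
      have := a3 p hp hpr
      subst this
      exact hQne e he f hf hne.symm x hxe hxf
        (seg_sphere hr b2 hps (right_mem_segment _ _ _) a2 b2)
    · linarith [h2 x hxS e he hxe p (s1 hp)]
  have hMX : ∀ e ∈ E, ∀ f ∈ E, e ≠ f → ¬ Disjoint (M e) (M f) → X en K e f := by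
    intro e he f hf hne hd
    rw [Set.not_disjoint_iff] at hd
    obtain ⟨p, hp, hp'⟩ := hd
    have hp1 : p ∈ K e := (hQ e he).1 hp
    have hp2 : p ∈ K f := (hQ f hf).1 hp'
    refine ⟨fun z hz hz' => ?_, p, hp1, hp2⟩
    obtain ⟨z', a, b, rfl⟩ := G.sh e he f hf hne z hz hz' p ⟨hp1, hp2⟩
    exact hMv e he z' (G.mem e he z' a) hp
  -- common thickening
  have C1 : ∀ᶠ δ : ℝ in nhdsWithin 0 (Ioi 0), ∀ e ∈ E, ∀ f ∈ E, Disjoint (M e) (M f) →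
      Disjoint (thickening δ (M e)) (thickening δ (M f)) := by
    rw [Filter.eventually_all_finite hE]; intro e he
    rw [Filter.eventually_all_finite hE]; intro f hf
    rw [Filter.eventually_imp_distrib_left]; intro hd
    exact ev_thick (hQ e he).2.1 (hQ f hf).2.1 hd
  have C2 : ∀ᶠ δ : ℝ in nhdsWithin 0 (Ioi 0), ∀ e ∈ E, ∀ f ∈ E, ∀ x ∈ S, f ≠ e → x ∈ en f →
      Disjoint (thickening δ (M e)) (thickening δ (segment ℝ (pos x) (Q f x))) := by
    rw [Filter.eventually_all_finite hE]; intro e he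
    rw [Filter.eventually_all_finite hE]; intro f hf
    rw [Filter.eventually_all_finite hS]; intro x hx
    rw [Filter.eventually_imp_distrib_left]; intro hne
    rw [Filter.eventually_imp_distrib_left]; intro hxf
    exact ev_thick (hQ e he).2.1 (segment_isCompact _ _) (hMseg e he f hf hne x hxf)
  have C3 : ∀ᶠ δ : ℝ in nhdsWithin 0 (Ioi 0), ∀ e ∈ E, ∀ z ∈ S,
      Disjoint (thickening δ (M e)) (thickening δ {pos z}) := by
    rw [Filter.eventually_all_finite hE]; intro e he
    rw [Filter.eventually_all_finite hS]; intro z hz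
    exact ev_thick (hQ e he).2.1 isCompact_singleton (by simpa using hMv e he z hz)
  obtain ⟨δ, ⟨⟨c1, c2⟩, c3⟩, hδ⟩ := (((C1.and C2).and C3).and self_mem_nhdsWithin).exists
  obtain ⟨m, hm⟩ : ∃ m : ι → ℕ, InjOn m E := countable_iff_exists_injOn.1 hE.countable
  have hex2 : ∀ e : ι, ∃ (J K' : Set ℂ), e ∈ E → J ⊆ thickening δ (M e) ∧ Stair (m e) J ∧
      (∀ p ∈ K', p ∈ J ∨ ∃ x ∈ en e, p ∈ segment ℝ (pos x) (Q e x)) ∧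
      ∀ a b, en e = s(a, b) → PArc (pos a) (pos b) K' := by
    intro e
    by_cases he : e ∈ E
    swap
    · exact ⟨∅, ∅, fun h => absurd h he⟩
    induction hab : en e with
    | _ a b =>
    obtain ⟨s1, s2, s3, s4⟩ := hQ e he
    obtain ⟨a1, -, -⟩ := s4 a (by simp [hab])
    obtain ⟨b1, -, -⟩ := s4 b (by simp [hab])
    have hth := self_subset_thickening hδ (M e)
    obtain ⟨J, hJ, hSt, K', hK', hP⟩ := extract (m e) isOpen_thickening (preconn_thick s3 hδ)
      (hth a1) (hth b1) (G.arc e he a b hab).ne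
    refine ⟨J, K', fun _ => ⟨hJ, hSt, ?_, ?_⟩⟩
    · intro p hp
      rcases hK' hp with (h | h) | h
      · exact Or.inr ⟨a, by simp, h⟩
      · exact Or.inl h
      · exact Or.inr ⟨b, by simp, by rw [segment_symm]; exact h⟩
    · intro a' b' hab'
      rcases Sym2.eq_iff.1 hab' with ⟨rfl, rfl⟩ | ⟨rfl, rfl⟩
      · exact hP
      · exact hP.symm
  choose J K' hJ using hex2
  have key : ∀ e ∈ E, ∀ f ∈ E, e ≠ f → ∀ p ∈ K' e ∩ K' f,
      (∃ z', z' ∈ en e ∧ z' ∈ en f ∧ pos z' = p) ∨ (p ∈ J e ∩ J f ∧ X en K e f) := by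
    rintro e he f hf hne p ⟨hp, hp'⟩
    obtain ⟨u1, -, u3, -⟩ := hJ e he
    obtain ⟨v1, -, v3, -⟩ := hJ f hf
    rcases u3 p hp with hp | ⟨x, hx, hp⟩ <;> rcases v3 p hp' with hp' | ⟨y, hy, hp'⟩
    · refine Or.inr ⟨⟨hp, hp'⟩, hMX e he f hf hne fun hd => ?_⟩
      exact Set.disjoint_left.1 (c1 e he f hf hd) (u1 hp) (v1 hp')
    · exfalso
      exact Set.disjoint_left.1 (c2 e he f hf y (G.mem f hf y hy) hne.symm hy) (u1 hp)
        (self_subset_thickening hδ _ hp')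
    · exfalso
      exact Set.disjoint_left.1 (c2 f hf e he x (G.mem e he x hx) hne hx) (v1 hp')
        (self_subset_thickening hδ _ hp)
    · left
      obtain ⟨-, a2, -⟩ := (hQ e he).2.2.2 x hx
      obtain ⟨-, b2, -⟩ := (hQ f hf).2.2.2 y hy
      by_cases hxy : y = x
      · subst hxy
        have := (seg_radius hr a2 b2 hp hp').resolve_right (hQne e he f hf hne y hx hy)
        exact ⟨y, hx, hy, this.symm⟩
      · have l1 := seg_closedBall a2 hp
        have l2 := seg_closedBall b2 hp'
        have l3 := h1 x (G.mem e he x hx) y (G.mem f hf y hy) hxy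
        have l4 := norm_sub_le_norm_sub_add_norm_sub (pos y) p (pos x)
        rw [norm_sub_rev (pos y) p] at l4
        linarith
  refine ⟨K', G.redraw (fun e he a b hab => ((hJ e he).2.2.2 a b hab).isArc) ?_ ?_ ?_,
    fun e he a b hab => (hJ e he).2.2.2 a b hab⟩
  · intro e he z hz hzK
    rcases (hJ e he).2.2.1 _ hzK with h | ⟨x, hx, h⟩
    · exfalso
      exact Set.disjoint_left.1 (c3 e he z hz) ((hJ e he).1 h)
        (self_subset_thickening hδ _ (mem_singleton _))
    · obtain ⟨-, a2, -⟩ := (hQ e he).2.2.2 x hx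
      have l1 := seg_closedBall a2 h
      by_cases hzx : z = x
      · subst hzx; exact hx
      · linarith [h1 x (G.mem e he x hx) z hz hzx]
  · intro e he f hf hne
    refine ((hS.image pos).union ((hJ e he).2.1.fin_stair ?_ (hJ f hf).2.1)).subset ?_
    · exact fun h => hne (hm he hf h)
    · intro p hp
      rcases key e he f hf hne p hp with ⟨z, a, b, rfl⟩ | h
      · exact Or.inl ⟨z, G.mem e he z a, rfl⟩
      · exact Or.inr h.1
  · intro e he f hf hne p hp
    rcases key e he f hf hne p hp with h | h
    · exact Or.inl h
    · exact Or.inr h.2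

end QPA

end

section
open Set Metric

namespace QPA

variable {T ι : Type}
variable {S : Set T} {E : Set ι} {en en' : ι → Sym2 T} {pos : T → ℂ} {K : ι → Set ℂ}

theorem polar_arg (u : ℂ) : (‖u‖ : ℂ) * Complex.exp (u.arg * Complex.I) = u :=
  Complex.norm_mul_exp_arg_mul_I u

theorem sector_aux {R θ : ℝ} (hR : 0 < R) (h1 : -Real.pi < θ) (h2 : θ < Real.pi) :
    ∀ u : ℂ, u ≠ 0 → ‖u‖ < R → u.arg ≠ Real.pi → u.arg ≠ θ →
    ∃ A : Set ℂ, IsPreconnected A ∧ u ∈ A ∧ (∀ x ∈ A, x ≠ 0 ∧ ‖x‖ < R ∧ x.arg ≠ Real.pi ∧ x.arg ≠ θ) ∧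
      (∀ s : ℝ, 0 ≤ s → s < R → (-s : ℂ) ∈ closure A) ∧
      (∀ s : ℝ, 0 ≤ s → s < R → (s * Complex.exp (θ * Complex.I) : ℂ) ∈ closure A) := by
  intro u hu huR hu1 hu2
  set g : ℝ × ℝ → ℂ := fun p => p.1 * Complex.exp (p.2 * Complex.I) with hg
  have hgc : Continuous g := by fun_prop
  have key : ∀ α β : ℝ, α < β → -Real.pi ≤ α → β ≤ Real.pi → (α = -Real.pi ∧ β = θ ∨ α = θ ∧ β = Real.pi) →
      u.arg ∈ Ioo α β → ∃ A : Set ℂ, IsPreconnected A ∧ u ∈ A ∧ (∀ x ∈ A, x ≠ 0 ∧ ‖x‖ < R ∧ x.arg ≠ Real.pi ∧ x.arg ≠ θ) ∧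
      (∀ s : ℝ, 0 ≤ s → s < R → (-s : ℂ) ∈ closure A) ∧
      (∀ s : ℝ, 0 ≤ s → s < R → (s * Complex.exp (θ * Complex.I) : ℂ) ∈ closure A) := by
    intro α β hαβ hα hβ hc hua
    have hcl : ∀ s : ℝ, 0 ≤ s → s < R → ∀ φ ∈ Icc α β, g (s, φ) ∈ closure (g '' (Ioo 0 R ×ˢ Ioo α β)) := by
      intro s hs hsR φ hφ
      apply image_closure_subset_closure_image hgc
      refine ⟨(s, φ), ?_, rfl⟩
      rw [closure_prod_eq, closure_Ioo hR.ne, closure_Ioo hαβ.ne]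
      exact ⟨⟨hs, hsR.le⟩, hφ⟩
    refine ⟨g '' (Ioo 0 R ×ˢ Ioo α β), ?_, ?_, ?_, ?_, ?_⟩
    · exact (isPreconnected_Ioo.prod isPreconnected_Ioo).image g hgc.continuousOn
    · exact ⟨(‖u‖, u.arg), ⟨⟨norm_pos_iff.2 hu, huR⟩, hua⟩, polar_arg u⟩
    · rintro _ ⟨⟨r, φ⟩, ⟨⟨hr, hrR⟩, hφ, hφ'⟩, rfl⟩
      simp only at hr hrR hφ hφ'
      have harg : (g (r, φ)).arg = φ := by
        simp only [hg]
        rw [Complex.arg_real_mul _ hr, Complex.arg_exp_mul_I, toIocMod_eq_self]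
        exact ⟨by linarith, by linarith⟩
      have hn : ‖g (r, φ)‖ = r := by
        simp only [hg, norm_mul, Complex.norm_exp_ofReal_mul_I, Complex.norm_real, Real.norm_eq_abs, abs_of_pos hr, mul_one]
      refine ⟨?_, ?_, ?_, ?_⟩
      · rw [← norm_pos_iff, hn]; exact hr
      · rw [hn]; exact hrR
      · rw [harg]; linarith
      · rw [harg]
        rcases hc with ⟨rfl, rfl⟩ | ⟨rfl, rfl⟩
        · exact hφ'.ne
        · exact hφ.ne'
    · intro s hs hsR
      rcases hc with ⟨rfl, rfl⟩ | ⟨rfl, rfl⟩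
      · have := hcl s hs hsR (-Real.pi) ⟨le_rfl, hαβ.le⟩
        simpa [hg, Complex.exp_neg, Complex.exp_pi_mul_I] using this
      · have := hcl s hs hsR (Real.pi) ⟨hαβ.le, le_rfl⟩
        simpa [hg, Complex.exp_neg, Complex.exp_pi_mul_I] using this
    · intro s hs hsR
      refine hcl s hs hsR θ ?_
      rcases hc with ⟨rfl, rfl⟩ | ⟨rfl, rfl⟩
      · exact ⟨hαβ.le, le_rfl⟩
      · exact ⟨le_rfl, hαβ.le⟩
  rcases lt_or_gt_of_ne hu2 with h | h
  · exact key (-Real.pi) θ h1 le_rfl h2.le (Or.inl ⟨rfl, rfl⟩) ⟨Complex.neg_pi_lt_arg u, h⟩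
  · exact key θ Real.pi h2 h1.le le_rfl (Or.inr ⟨rfl, rfl⟩)
      ⟨h, lt_of_le_of_ne (Complex.arg_le_pi u) hu1⟩

theorem arg_eq_pi_of {u : ℂ} (h : u.arg = Real.pi) : u = -(‖u‖ : ℂ) := by
  have := polar_arg u
  rw [h, Complex.exp_pi_mul_I] at this
  rw [← this]; simp

theorem sector {z a b : ℂ} (ha : a ≠ 0) (hb : b ≠ 0) (hab : ∀ t : ℝ, 0 < t → b ≠ t * a) {ρ : ℝ}
    (hρ : 0 < ρ) {w : ℂ} (hw : w ∈ ball z ρ) (hwa : ∀ t : ℝ, 0 ≤ t → w ≠ z + t * a)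
    (hwb : ∀ t : ℝ, 0 ≤ t → w ≠ z + t * b) :
    ∃ A : Set ℂ, IsPreconnected A ∧ w ∈ A ∧ A ⊆ ball z ρ ∧
      (∀ x ∈ A, ∀ t : ℝ, 0 ≤ t → x ≠ z + t * a ∧ x ≠ z + t * b) ∧
      (∀ t : ℝ, 0 ≤ t → z + t * a ∈ ball z ρ → z + t * a ∈ closure A) ∧
      (∀ t : ℝ, 0 ≤ t → z + t * b ∈ ball z ρ → z + t * b ∈ closure A) := by
  have hna : 0 < ‖a‖ := norm_pos_iff.2 ha
  have hnb : 0 < ‖b‖ := norm_pos_iff.2 hb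
  set c : ℂ := -b / a with hc
  have hc0 : c ≠ 0 := div_ne_zero (neg_ne_zero.2 hb) ha
  have hcb : b = -(c * a) := by rw [hc]; field_simp
  have hcarg : c.arg ≠ Real.pi := by
    intro h
    have h' := arg_eq_pi_of h
    refine hab ‖c‖ (norm_pos_iff.2 hc0) ?_
    rw [hcb]; nth_rewrite 1 [h']; ring
  -- the linear chart
  have hexp : ∀ t : ℝ, z + t * b = z - ((t * ‖c‖ : ℝ) * Complex.exp (c.arg * Complex.I)) * a := by
    intro t
    have : c = ‖c‖ * Complex.exp (c.arg * Complex.I) := (polar_arg c).symm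
    rw [hcb]; nth_rewrite 1 [this]; push_cast; ring
  have hw0 : z - w ≠ 0 := by
    intro h; exact hwa 0 le_rfl (by simp; exact (sub_eq_zero.1 h).symm)
  have hnw : ‖z - w‖ < ρ := by rw [norm_sub_rev]; exact mem_ball_iff_norm.1 hw
  have h4 : ((z - w) / a).arg ≠ Real.pi := by
    intro h
    have h' := arg_eq_pi_of h
    refine hwa ‖(z - w) / a‖ (norm_nonneg _) ?_
    rw [div_eq_iff ha] at h'
    linear_combination -h'
  have h5 : ((z - w) / a).arg ≠ c.arg := by
    intro h
    have h1 := polar_arg ((z - w) / a)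
    have h2 := polar_arg c
    rw [h] at h1
    have hnc : (‖c‖ : ℂ) ≠ 0 := by simpa using hc0
    refine hwb (‖(z - w) / a‖ / ‖c‖) (by positivity) ?_
    rw [hexp]
    have : ((‖(z - w) / a‖ / ‖c‖ * ‖c‖ : ℝ) : ℂ) * Complex.exp (c.arg * Complex.I) = (z - w) / a := by
      refine Eq.trans ?_ h1
      rw [div_mul_cancel₀ _ (by simpa using hc0)]
    rw [this]; field_simp; ring
  obtain ⟨A, hA, hu, hA1, hA2, hA3⟩ := sector_aux (R := ρ / ‖a‖) (by positivity)
    (Complex.neg_pi_lt_arg c) (lt_of_le_of_ne (Complex.arg_le_pi c) hcarg) ((z - w) / a)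
    (div_ne_zero hw0 ha) (by rw [norm_div]; gcongr) h4 h5
  · have hgc : Continuous (fun x : ℂ => z - x * a) := by fun_prop
    refine ⟨(fun x => z - x * a) '' A, hA.image _ hgc.continuousOn, ⟨_, hu, ?_⟩, ?_, ?_, ?_, ?_⟩
    · simp only; field_simp; ring
    · rintro _ ⟨x, hx, rfl⟩
      rw [mem_ball_iff_norm]
      have := (hA1 x hx).2.1
      rw [lt_div_iff₀ hna] at this
      simpa using this
    · rintro _ ⟨x, hx, rfl⟩ t ht
      obtain ⟨h0, -, h1, h2⟩ := hA1 x hx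
      constructor
      · intro h
        have hx' : x = ((-t : ℝ) : ℂ) := by
          have : -x * a = t * a := by linear_combination h
          have := mul_right_cancel₀ ha this
          push_cast; linear_combination -this
        refine h1 ?_
        rw [hx']
        refine Complex.arg_ofReal_of_neg ?_
        rcases ht.eq_or_lt with rfl | h
        · simp at hx'; exact absurd hx' h0
        · linarith
      · intro h
        have hx' : x = t * c := by
          rw [hcb] at h
          have : x * a = (t * c) * a := by linear_combination -h
          exact mul_right_cancel₀ ha this
        rcases ht.eq_or_lt with rfl | ht
        · simp at hx'; exact absurd hx' h0
        · exact h2 (by rw [hx', Complex.arg_real_mul _ ht])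
    · intro t ht h
      have h3 : t < ρ / ‖a‖ := by
        rw [lt_div_iff₀ hna]
        simpa [mem_ball_iff_norm, abs_of_nonneg ht] using h
      refine image_closure_subset_closure_image hgc ⟨-t, hA2 t ht h3, ?_⟩
      simp
    · intro t ht h
      have h3 : t * ‖c‖ < ρ / ‖a‖ := by
        rw [lt_div_iff₀ hna, hc]
        simp [abs_of_nonneg ht] at h
        rw [norm_div, norm_neg]
        field_simp
        exact h
      rw [hexp t]
      exact image_closure_subset_closure_image hgc ⟨_, hA3 _ (by positivity) h3, rfl⟩

end QPA

end

section
open Set Metric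

namespace QPA

theorem mem_seg_of {z p : ℂ} {t : ℝ} (h0 : 0 ≤ t) (h1 : t ≤ 1) :
    z + t * (p - z) ∈ segment ℝ z p := by
  rw [segment_eq_image']
  exact ⟨t, ⟨h0, h1⟩, by simp⟩

theorem seg_of_mem {z p x : ℂ} (h : x ∈ segment ℝ z p) :
    ∃ t : ℝ, 0 ≤ t ∧ t ≤ 1 ∧ x = z + t * (p - z) := by
  rw [segment_eq_image'] at h
  obtain ⟨t, ⟨h0, h1⟩, rfl⟩ := h
  exact ⟨t, h0, h1, by simp⟩

theorem ray_le_one {z p : ℂ} {t ρ : ℝ} (h0 : 0 ≤ t) (hρ : ρ ≤ ‖p - z‖)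
    (h : z + t * (p - z) ∈ ball z ρ) : t ≤ 1 := by
  simp [abs_of_nonneg h0] at h
  by_contra hc
  push Not at hc
  nlinarith [norm_nonneg (p - z)]

theorem rays_of_inter {z p q : ℂ} (hp : p ≠ z) (h : segment ℝ z p ∩ segment ℝ z q ⊆ {z}) :
    ∀ t : ℝ, 0 < t → q - z ≠ t * (p - z) := by
  intro t ht heq
  have hp0 : p - z ≠ 0 := sub_ne_zero.2 hp
  set s : ℝ := min 1 (1 / t) with hs
  have hs0 : 0 < s := by rw [hs]; positivity
  have hs1 : s ≤ 1 := min_le_left _ _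
  have hs2 : s * t ≤ 1 := by
    have : s ≤ 1 / t := min_le_right _ _
    rwa [le_div_iff₀ ht] at this
  have hmem : z + s * (q - z) ∈ ({z} : Set ℂ) := by
    refine h ⟨?_, mem_seg_of hs0.le hs1⟩
    have := mem_seg_of (z := z) (p := p) (t := s * t) (by positivity) hs2
    rw [heq]
    push_cast at this
    rwa [mul_assoc] at this
  simp only [mem_singleton_iff, add_eq_left, mul_eq_zero, Complex.ofReal_eq_zero] at hmem
  rcases hmem with h | h
  · exact hs0.ne' h
  · rw [heq] at h
    rcases mul_eq_zero.1 h with h | h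
    · exact ht.ne' (by simpa using h)
    · exact hp0 h

theorem local_side {x y z : ℂ} {K U : Set ℂ} (hK : PArc x y K) (hz : z ∈ K) (hzx : z ≠ x)
    (hzy : z ≠ y) (hU : IsOpen U) (hzU : z ∈ U) :
    ∃ V, IsOpen V ∧ z ∈ V ∧ (V \ K).Nonempty ∧ V ⊆ U ∧
      ∀ w ∈ V \ K, ∃ A, IsPreconnected A ∧ w ∈ A ∧ A ⊆ U \ K ∧ K ∩ V ⊆ closure A := by
  obtain ⟨p, q, hp, hq, ρ, hρ, h1, h2, h3, h4⟩ := hK.loc hz hzx hzy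
  obtain ⟨ε, hε, hεU⟩ := Metric.isOpen_iff.1 hU z hzU
  have hp0 : p - z ≠ 0 := sub_ne_zero.2 hp
  have hq0 : q - z ≠ 0 := sub_ne_zero.2 hq
  have hpn : 0 < ‖p - z‖ := norm_pos_iff.2 hp0
  have hqn : 0 < ‖q - z‖ := norm_pos_iff.2 hq0
  obtain ⟨R, hR, hRρ, hRε, hRp, hRq⟩ : ∃ R > 0, R ≤ ρ ∧ R ≤ ε ∧ R ≤ ‖p - z‖ ∧ R ≤ ‖q - z‖ :=
    ⟨min (min ρ ε) (min ‖p - z‖ ‖q - z‖), by positivity,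
      (min_le_left _ _).trans (min_le_left _ _), (min_le_left _ _).trans (min_le_right _ _),
      (min_le_right _ _).trans (min_le_left _ _), (min_le_right _ _).trans (min_le_right _ _)⟩
  have hrays := rays_of_inter hp h3
  -- membership in K inside the ball
  have hKb : ∀ w ∈ ball z R, w ∈ K → (∃ t : ℝ, 0 ≤ t ∧ w = z + t * (p - z)) ∨
      (∃ t : ℝ, 0 ≤ t ∧ w = z + t * (q - z)) := by
    intro w hw hwK
    rcases h4 ⟨hwK, ball_subset_ball hRρ hw⟩ with h | h
    · obtain ⟨t, ht, -, h⟩ := seg_of_mem h; exact Or.inl ⟨t, ht, h⟩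
    · obtain ⟨t, ht, -, h⟩ := seg_of_mem h; exact Or.inr ⟨t, ht, h⟩
  have hpK : ∀ t : ℝ, 0 ≤ t → z + t * (p - z) ∈ ball z R → z + t * (p - z) ∈ K :=
    fun t ht h => h1 (mem_seg_of ht (ray_le_one ht hRp h))
  have hqK : ∀ t : ℝ, 0 ≤ t → z + t * (q - z) ∈ ball z R → z + t * (q - z) ∈ K :=
    fun t ht h => h2 (mem_seg_of ht (ray_le_one ht hRq h))
  refine ⟨ball z R, isOpen_ball, mem_ball_self hR, ?_, (ball_subset_ball hRε).trans hεU, ?_⟩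
  · -- existence of a point off K
    set s : ℝ := R / (2 * ‖p - z‖) with hs
    have hs0 : 0 < s := by positivity
    have hb : ∀ ζ : ℂ, ‖ζ‖ = 1 → z + (s * ζ) * (p - z) ∈ ball z R := by
      intro ζ hζ
      simp only [mem_ball_iff_norm, add_sub_cancel_left, norm_mul, hζ, Complex.norm_real,
        Real.norm_eq_abs, abs_of_pos hs0]
      rw [hs]
      field_simp
      linarith
    have hnp : ∀ ζ : ℂ, ζ.im ≠ 0 → ∀ t : ℝ, z + (s * ζ) * (p - z) ≠ z + t * (p - z) := by
      intro ζ hζ t h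
      have := mul_right_cancel₀ hp0 (add_left_cancel h)
      have := congrArg Complex.im this
      simp at this
      rcases this with h | h
      · exact hs0.ne' h
      · exact hζ h
    by_contra hcon
    rw [not_nonempty_iff_eq_empty, sdiff_eq_empty] at hcon
    have e1 := hKb _ (hb Complex.I (by simp)) (hcon (hb Complex.I (by simp)))
    have e2 := hKb _ (hb (-Complex.I) (by simp)) (hcon (hb (-Complex.I) (by simp)))
    rcases e1 with ⟨t, -, h⟩ | ⟨t, ht, e1⟩
    · exact hnp _ (by simp) _ h
    rcases e2 with ⟨t', -, h⟩ | ⟨t', ht', e2⟩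
    · exact hnp _ (by simp) _ h
    have e3 : ((t + t' : ℝ) : ℂ) * (q - z) = 0 := by
      push_cast
      linear_combination -e1 - e2
    rcases mul_eq_zero.1 e3 with h | h
    · have h : t + t' = 0 := by exact_mod_cast h
      have ht0 : t = 0 := by linarith
      subst ht0
      exact hnp Complex.I (by simp) 0 (by rw [e1]; simp)
    · exact hq0 h
  · rintro w ⟨hw, hwK⟩
    obtain ⟨A, a1, a2, a3, a4, a5, a6⟩ := sector hp0 hq0 hrays hR hw
      (fun t ht h => hwK (h ▸ hpK t ht (h ▸ hw))) (fun t ht h => hwK (h ▸ hqK t ht (h ▸ hw)))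
    refine ⟨A, a1, a2, ?_, ?_⟩
    · intro v hv
      refine ⟨hεU (ball_subset_ball hRε (a3 hv)), fun hvK => ?_⟩
      rcases hKb v (a3 hv) hvK with ⟨t, ht, h⟩ | ⟨t, ht, h⟩
      · exact (a4 v hv t ht).1 h
      · exact (a4 v hv t ht).2 h
    · rintro v ⟨hvK, hv⟩
      rcases hKb v hv hvK with ⟨t, ht, rfl⟩ | ⟨t, ht, rfl⟩
      · exact a5 t ht hv
      · exact a6 t ht hv

theorem side_closure {x y : ℂ} {K M U : Set ℂ} (hK : PArc x y K) (hM : M ⊆ K)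
    (hMc : IsPreconnected M) (hx : x ∉ M) (hy : y ∉ M) (hU : IsOpen U) (hMU : M ⊆ U)
    (hne : M.Nonempty) :
    ∃ C ⊆ U \ K, IsOpen C ∧ IsPreconnected C ∧ M ⊆ closure C := by
  have hloc : ∀ z : ℂ, ∃ V, z ∈ M → IsOpen V ∧ z ∈ V ∧ (V \ K).Nonempty ∧ V ⊆ U ∧
      ∀ w ∈ V \ K, ∃ A, IsPreconnected A ∧ w ∈ A ∧ A ⊆ U \ K ∧ K ∩ V ⊆ closure A := by
    intro z
    by_cases hz : z ∈ M
    · obtain ⟨V, hV⟩ := local_side hK (hM hz) (fun h => hx (h ▸ hz)) (fun h => hy (h ▸ hz)) hU (hMU hz)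
      exact ⟨V, fun _ => hV⟩
    · exact ⟨∅, fun h => absurd h hz⟩
  choose V hV using hloc
  obtain ⟨m0, hm0⟩ := hne
  obtain ⟨-, v2, ⟨w0, hw0⟩, v4, v5⟩ := hV m0 hm0
  have hO : IsOpen (U \ K) := hU.sdiff hK.isArc.isCompact.isClosed
  set C := connectedComponentIn (U \ K) w0 with hC
  have hstep : ∀ z ∈ M, (V z ∩ C).Nonempty → K ∩ V z ⊆ closure C := by
    rintro z hz ⟨w, hwV, hwC⟩
    have hwU := connectedComponentIn_subset _ _ hwC
    obtain ⟨A, a1, a2, a3, a4⟩ := (hV z hz).2.2.2.2 w ⟨hwV, hwU.2⟩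
    refine a4.trans (closure_mono ?_)
    rw [hC, connectedComponentIn_eq hwC]
    exact a1.subset_connectedComponentIn a2 a3
  have hstart : m0 ∈ closure C :=
    hstep m0 hm0 ⟨w0, hw0.1, mem_connectedComponentIn ⟨v4 hw0.1, hw0.2⟩⟩ ⟨hM hm0, v2⟩
  have hstep2 : ∀ z ∈ M, z ∈ closure C → K ∩ V z ⊆ closure C := by
    intro z hz hzC
    exact hstep z hz (mem_closure_iff.1 hzC _ (hV z hz).1 (hV z hz).2.1)
  refine ⟨C, connectedComponentIn_subset _ _, hO.connectedComponentIn,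
    isPreconnected_connectedComponentIn, ?_⟩
  by_contra hcon
  rw [not_subset] at hcon
  obtain ⟨m1, hm1, hm1C⟩ := hcon
  obtain ⟨z, hzM, hz1, hz2⟩ := hMc (⋃ z ∈ M ∩ closure C, V z) (closure C)ᶜ
    (isOpen_biUnion fun z hz => (hV z hz.1).1) isClosed_closure.isOpen_compl
    (fun z hz => by
      by_cases h : z ∈ closure C
      · exact Or.inl (mem_biUnion (⟨hz, h⟩ : z ∈ M ∩ closure C) (hV z hz).2.1)
      · exact Or.inr h)
    ⟨m0, hm0, mem_biUnion (⟨hm0, hstart⟩ : m0 ∈ M ∩ closure C) v2⟩ ⟨m1, hm1, hm1C⟩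
  rw [mem_iUnion₂] at hz1
  obtain ⟨z', ⟨hz', hz'C⟩, hzV⟩ := hz1
  exact hz2 (hstep2 z' hz' hz'C ⟨hM hzM, hzV⟩)

end QPA

end

section
open Set Metric

namespace QPA

variable {T ι : Type}
variable {S : Set T} {E : Set ι} {en en' : ι → Sym2 T} {pos : T → ℂ} {K : ι → Set ℂ}

theorem isClosed_ray (z a : ℂ) : IsClosed {w : ℂ | ∃ t : ℝ, 0 ≤ t ∧ w = z + t * a} := by
  have h1 : IsClosed ((fun t : ℝ => t • a) '' Ici 0) := isClosedMap_smul_left a _ isClosed_Ici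
  have h2 := h1.preimage (f := fun w : ℂ => w - z) (by fun_prop)
  convert h2 using 1
  ext w
  simp only [mem_ofPred_eq, mem_preimage, mem_image, mem_Ici, Complex.real_smul]
  constructor
  · rintro ⟨t, ht, rfl⟩; exact ⟨t, ht, by ring⟩
  · rintro ⟨t, ht, h⟩; exact ⟨t, ht, by rw [h]; ring⟩

theorem Good.wedge (G : Good S E en pos K) (hS : S.Finite) (hE : E.Finite)
    (hPL : ∀ e ∈ E, ∀ a b, en e = s(a, b) → PArc (pos a) (pos b) (K e))
    {f : ι} (hf : f ∈ E) {x y : T} (hxy : en f = s(x, y)) :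
    ∃ a ∈ K f, a ≠ pos x ∧ a ≠ pos y ∧ ∃ N, IsOpen N ∧ a ∈ N ∧ ∀ w ∈ N \ K f,
      ∀ p ∈ segment ℝ (pos x) w, (∀ z ∈ S, pos z = p → z = x) ∧
        ∀ h ∈ E, p ∈ K h → x ∈ en h ∧ p = pos x := by
  have hxS : x ∈ S := G.mem f hf x (by simp [hxy])
  have hyS : y ∈ S := G.mem f hf y (by simp [hxy])
  have hxf : x ∈ en f := by simp [hxy]
  have hyx : y ≠ x := by
    rintro rfl; exact (G.arc f hf _ _ hxy).ne rfl
  obtain ⟨r, hr, r1, r2⟩ := G.exists_radius hS hE hxS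
  have hst : ∀ h : ι, ∃ (P : ℂ) (ρ : ℝ), h ∈ E → x ∈ en h → P ≠ pos x ∧ 0 < ρ ∧
      segment ℝ (pos x) P ⊆ K h ∧ K h ∩ ball (pos x) ρ ⊆ segment ℝ (pos x) P := by
    intro h
    by_cases hh : h ∈ E ∧ x ∈ en h
    · obtain ⟨b, hb⟩ := Sym2.mem_iff_exists.1 hh.2
      obtain ⟨P, hP, ρ, hρ, p1, p2⟩ := (hPL h hh.1 x b hb).start
      exact ⟨P, ρ, fun _ _ => ⟨hP, hρ, p1, p2⟩⟩
    · exact ⟨0, 0, fun a b => absurd ⟨a, b⟩ hh⟩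
  choose P ρ hP using hst
  have hev : ∀ᶠ R : ℝ in nhdsWithin 0 (Ioi 0), ∀ h ∈ E, x ∈ en h → R < ρ h ∧ R < ‖P h - pos x‖ := by
    rw [Filter.eventually_all_finite hE]
    intro h hh
    rw [Filter.eventually_imp_distrib_left]; intro hxh
    obtain ⟨p1, p2, -⟩ := hP h hh hxh
    exact Filter.Eventually.and (nhdsWithin_le_nhds (eventually_lt_nhds p2))
      (nhdsWithin_le_nhds (eventually_lt_nhds (norm_pos_iff.2 (sub_ne_zero.2 p1))))
  obtain ⟨R, ⟨hR1, hR2⟩, hR⟩ := ((hev.and (nhdsWithin_le_nhds (eventually_lt_nhds hr))).and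
    self_mem_nhdsWithin).exists
  have hR : 0 < R := hR
  have hKb : ∀ h ∈ E, ∀ w ∈ ball (pos x) R, w ∈ K h → x ∈ en h ∧ ∃ t : ℝ, 0 ≤ t ∧
      w = pos x + t * (P h - pos x) := by
    intro h hh w hw hwK
    have hxh : x ∈ en h := by
      by_contra hxh
      have := r2 h hh hxh w hwK
      rw [mem_ball_iff_norm] at hw
      linarith
    refine ⟨hxh, ?_⟩
    obtain ⟨t, ht, -, h⟩ := seg_of_mem ((hP h hh hxh).2.2.2 ⟨hwK, ball_subset_ball (hR1 h hh hxh).1.le hw⟩)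
    exact ⟨t, ht, h⟩
  have hKc : ∀ h ∈ E, x ∈ en h → ∀ t : ℝ, 0 ≤ t → pos x + t * (P h - pos x) ∈ ball (pos x) R →
      pos x + t * (P h - pos x) ∈ K h := fun h hh hxh t ht hb =>
    (hP h hh hxh).2.2.1 (mem_seg_of ht (ray_le_one ht (hR1 h hh hxh).2.le hb))
  have hPf0 : P f - pos x ≠ 0 := sub_ne_zero.2 (hP f hf hxf).1
  have hPn : 0 < ‖P f - pos x‖ := norm_pos_iff.2 hPf0
  set τ : ℝ := R / (2 * ‖P f - pos x‖) with hτ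
  have hτ0 : 0 < τ := by positivity
  set a : ℂ := pos x + τ * (P f - pos x) with ha
  have hab : a ∈ ball (pos x) R := by
    simp only [ha, mem_ball_iff_norm, add_sub_cancel_left, norm_mul, Complex.norm_real,
        Real.norm_eq_abs, abs_of_pos hτ0]
    rw [hτ]; field_simp; linarith
  have haK : a ∈ K f := hKc f hf hxf τ hτ0.le hab
  have hvb : ∀ z ∈ S, pos z ∈ ball (pos x) R → z = x := by
    intro z hz hb
    by_contra hzx
    have := r1 z hz hzx
    rw [mem_ball_iff_norm] at hb
    linarith
  have hax : a ≠ pos x := by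
    intro h
    rw [ha, add_eq_left, mul_eq_zero] at h
    rcases h with h | h
    · exact hτ0.ne' (by exact_mod_cast h)
    · exact hPf0 h
  have hay : a ≠ pos y := by
    intro h; exact hyx (hvb y hyS (h ▸ hab))
  set N : Set ℂ := ball (pos x) R ∩ ⋂ h ∈ {h ∈ E | x ∈ en h ∧ h ≠ f},
    {w : ℂ | ∃ t : ℝ, 0 ≤ t ∧ w = pos x + t * (P h - pos x)}ᶜ with hN
  refine ⟨a, haK, hax, hay, N, ?_, ?_, ?_⟩
  · exact isOpen_ball.inter ((hE.subset fun h hh => hh.1).isOpen_biInter fun h _ =>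
      (isClosed_ray _ _).isOpen_compl)
  · refine ⟨hab, ?_⟩
    rw [mem_iInter₂]
    rintro h ⟨hh, hxh, hhf⟩ ⟨t, ht, hat⟩
    have haKh : a ∈ K h := by rw [hat]; exact hKc h hh hxh t ht (hat ▸ hab)
    obtain ⟨z, z1, z2, z3⟩ := G.sh f hf h hh hhf.symm x hxf hxh a ⟨haK, haKh⟩
    exact hax (by rw [← z3, hvb z (G.mem f hf z z1) (z3 ▸ hab)])
  · rintro w ⟨⟨hwb, hwN⟩, hwK⟩ p hp
    have hpb : p ∈ ball (pos x) R := (convex_ball _ _).segment_subset (mem_ball_self hR) hwb hp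
    refine ⟨fun z hz hzp => hvb z hz (hzp ▸ hpb), fun h hh hpK => ?_⟩
    obtain ⟨hxh, t, ht, hpt⟩ := hKb h hh p hpb hpK
    refine ⟨hxh, ?_⟩
    by_contra hpx
    obtain ⟨s, hs0, -, hs⟩ := seg_of_mem hp
    have hs0 : 0 < s := by
      rcases hs0.eq_or_lt with rfl | h
      · simp at hs; exact absurd hs hpx
      · exact h
    have hw : w = pos x + ((t / s : ℝ) : ℂ) * (P h - pos x) := by
      have h1 : (s : ℂ) ≠ 0 := by exact_mod_cast hs0.ne'
      have h2 : (s : ℂ) * (w - pos x) = t * (P h - pos x) := by linear_combination hpt - hs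
      push_cast
      field_simp
      linear_combination h2
    by_cases hhf : h = f
    · subst hhf
      exact hwK (hw ▸ hKc h hh hxh (t / s) (by positivity) (hw ▸ hwb))
    · rw [mem_iInter₂] at hwN
      exact hwN h ⟨hh, hxh, hhf⟩ ⟨t / s, by positivity, hw⟩

theorem Good.par (G0 : Good S E en pos K) (hS : S.Finite) (hE : E.Finite)
    {f f' : ι} (hf : f ∈ E) (hf' : f' ∉ E) {x y : T} (hxy : en f = s(x, y))
    (hen : ∀ h ∈ E, en' h = en h) (henf : en' f' = s(x, y)) :
    ∃ K', Good S (insert f' E) en' pos K' := by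
  classical
  obtain ⟨K, G, hPL⟩ := G0.PL hS hE
  have hyx : en f = s(y, x) := by rw [hxy, Sym2.eq_swap]
  obtain ⟨a, haK, hax, hay, Na, hNa, haN, hwa⟩ := G.wedge hS hE hPL hf hxy
  obtain ⟨b, hbK, hby, hbx, Nb, hNb, hbN, hwb⟩ := G.wedge hS hE hPL hf hyx
  have hA := G.arc f hf x y hxy
  obtain ⟨M, hMK, hMc, hMp, hxM, hyM, haM, hbM⟩ := hA.mid haK hbK hax hay hbx hby
  have hMv : ∀ z ∈ S, pos z ∉ M := by
    intro z hz hzM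
    have := G.vert f hf z hz (hMK hzM)
    rw [hxy, Sym2.mem_iff] at this
    rcases this with rfl | rfl
    · exact hxM hzM
    · exact hyM hzM
  have C1 : ∀ᶠ δ : ℝ in nhdsWithin 0 (Ioi 0), ∀ h ∈ E, Disjoint M (K h) →
      Disjoint (thickening δ M) (thickening δ (K h)) := by
    rw [Filter.eventually_all_finite hE]; intro h hh
    rw [Filter.eventually_imp_distrib_left]; intro hd
    refine ev_thick hMc ?_ hd
    induction hab : en h with
    | _ c d => exact (G.arc h hh c d hab).isCompact
  have C3 : ∀ᶠ δ : ℝ in nhdsWithin 0 (Ioi 0), ∀ z ∈ S,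
      Disjoint (thickening δ M) (thickening δ {pos z}) := by
    rw [Filter.eventually_all_finite hS]; intro z hz
    exact ev_thick hMc isCompact_singleton (by simpa using hMv z hz)
  obtain ⟨δ, ⟨c1, c3⟩, hδ⟩ := ((C1.and C3).and self_mem_nhdsWithin).exists
  have hδ : 0 < δ := hδ
  obtain ⟨C, hCU, hCo, hCp, hCl⟩ := side_closure (hPL f hf x y hxy) hMK hMp hxM hyM
    (isOpen_thickening (δ := δ)) (self_subset_thickening hδ M) ⟨a, haM⟩
  obtain ⟨α, hαN, hαC⟩ := mem_closure_iff.1 (hCl haM) Na hNa haN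
  obtain ⟨β, hβN, hβC⟩ := mem_closure_iff.1 (hCl hbM) Nb hNb hbN
  have hm : ∃ m : ℕ, ∀ h ∈ E, ∀ J, Stair m J → (J ∩ K h).Finite := by
    have : ∀ᶠ m : ℕ in Filter.atTop, ∀ h ∈ E, ∀ J, Stair m J → (J ∩ K h).Finite := by
      rw [Filter.eventually_all_finite hE]; intro h hh
      rw [Filter.eventually_atTop]
      induction hab : en h with
      | _ c d => exact (hPL h hh c d hab).segFin.eventually
    exact this.exists
  obtain ⟨m, hm⟩ := hm
  obtain ⟨J, hJ, hSt, L, hL, hLP⟩ := extract m hCo hCp hαC hβC hA.ne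
  have hwα := hwa α ⟨hαN, (hCU hαC).2⟩
  have hwβ := hwb β ⟨hβN, (hCU hβC).2⟩
  -- the analysis of the new curve
  have hLv : ∀ z ∈ S, pos z ∈ L → z = x ∨ z = y := by
    intro z hz hzL
    rcases hL hzL with (h | h) | h
    · exact Or.inl ((hwα _ h).1 z hz rfl)
    · exact absurd (self_subset_thickening hδ _ (mem_singleton _))
        (Set.disjoint_left.1 (c3 z hz) (hCU (hJ h)).1)
    · rw [segment_symm] at h
      exact Or.inr ((hwβ _ h).1 z hz rfl)
  have hLK : ∀ h ∈ E, ∀ p ∈ L, p ∈ K h → (x ∈ en h ∧ p = pos x) ∨ (y ∈ en h ∧ p = pos y) ∨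
      (p ∈ J ∧ X en K f h) := by
    intro h hh p hp hpK
    rcases hL hp with (h1 | h1) | h1
    · exact Or.inl ((hwα _ h1).2 h hh hpK)
    · refine Or.inr (Or.inr ⟨h1, ?_⟩)
      have hhf : h ≠ f := by
        rintro rfl; exact (hCU (hJ h1)).2 hpK
      have hnd : ¬ Disjoint M (K h) := fun hd =>
        Set.disjoint_left.1 (c1 h hh hd) (hCU (hJ h1)).1 (self_subset_thickening hδ _ hpK)
      rw [Set.not_disjoint_iff] at hnd
      obtain ⟨q, hqM, hqK⟩ := hnd
      refine ⟨fun z hz hz' => ?_, q, hMK hqM, hqK⟩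
      obtain ⟨z', a, b, rfl⟩ := G.sh f hf h hh hhf.symm z hz hz' q ⟨hMK hqM, hqK⟩
      exact hMv z' (G.mem f hf z' a) hqM
    · rw [segment_symm] at h1
      exact Or.inr (Or.inl ((hwβ _ h1).2 h hh hpK))
  have hne : ∀ h ∈ E, h ≠ f' := fun h hh hc => hf' (hc ▸ hh)
  have hK' : ∀ h ∈ E, Function.update K f' L h = K h := fun h hh => Function.update_of_ne (hne h hh) _ _
  have G' : Good S E en' pos (Function.update K f' L) := G.congr hen (fun _ _ => rfl) hK'
  refine ⟨Function.update K f' L, G'.addEdge ?_ ?_ ?_ ?_ ?_ ?_⟩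
  · rw [henf, ← hxy]; exact G.mem f hf
  · intro c d hcd
    rw [henf] at hcd
    rw [Function.update_self]
    rcases Sym2.eq_iff.1 hcd with ⟨rfl, rfl⟩ | ⟨rfl, rfl⟩
    · exact hLP.isArc
    · exact hLP.isArc.symm
  · intro z hz hzL
    rw [Function.update_self] at hzL
    rw [henf, Sym2.mem_iff]
    exact hLv z hz hzL
  · intro h hh hhf
    rw [Function.update_self, hK' h hh]
    refine ((hm h hh J hSt).union (toFinite {pos x, pos y})).subset ?_
    rintro p ⟨hp, hpK⟩
    rcases hLK h hh p hp hpK with h1 | h1 | h1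
    · exact Or.inr (Or.inl h1.2)
    · exact Or.inr (Or.inr h1.2)
    · exact Or.inl ⟨h1.1, hpK⟩
  · intro h hh hhf z hz hz' p hp hpK
    rw [Function.update_self] at hp
    rw [hK' h hh] at hpK
    rw [hen h hh] at hz' ⊢
    rw [henf] at hz ⊢
    rcases hLK h hh p hp hpK with h1 | h1 | h1
    · exact ⟨x, by simp, h1.1, h1.2.symm⟩
    · exact ⟨y, by simp, h1.1, h1.2.symm⟩
    · exact absurd hz' (h1.2.1 z (hxy ▸ hz))
  · intro g hg h hh h1 h2 h3
    have key : ∀ g ∈ E, X en' (Function.update K f' L) f' g → X en K f g := by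
      rintro g hg ⟨k1, p, k2, k3⟩
      rw [Function.update_self] at k2
      rw [hK' g hg] at k3
      rw [hen g hg, henf] at k1
      rcases hLK g hg p k2 k3 with h | h | h
      · exact absurd h.1 (k1 x (by simp))
      · exact absurd h.1 (k1 y (by simp))
      · exact h.2
    refine G.qp f hf g hg h hh (key g hg h1) (key h hh h2) ?_
    simpa [X, hen g hg, hen h hh, hK' g hg, hK' h hh] using h3

end QPA

end

section
open Set Metric

namespace QPA

variable {V : Type}

def Sv (V : Type) (m : ℕ) : Set (V ⊕ ℕ) := {x | Sum.elim (fun _ => True) (fun j => 1 ≤ j ∧ j < m) x}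
def Ev (G : SimpleGraph V) (m : ℕ) : Set (Sym2 V ⊕ ℕ) :=
  {x | Sum.elim (fun e => e ∈ G.edgeSet) (fun j => j < m) x}

def pv (u y : V) (m j : ℕ) : V ⊕ ℕ := if j = 0 then Sum.inl u else if j < m then Sum.inr j else Sum.inl y

def ev (u y : V) (m : ℕ) : Sym2 V ⊕ ℕ → Sym2 (V ⊕ ℕ) :=
  Sum.elim (fun e => e.map Sum.inl) (fun j => s(pv u y m j, pv u y m (j + 1)))

@[simp] theorem inl_mem_Sv (a : V) (m : ℕ) : (Sum.inl a : V ⊕ ℕ) ∈ Sv V m := by simp [Sv]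
@[simp] theorem inr_mem_Sv (j m : ℕ) : (Sum.inr j : V ⊕ ℕ) ∈ Sv V m ↔ 1 ≤ j ∧ j < m := by simp [Sv]
@[simp] theorem inl_mem_Ev (G : SimpleGraph V) (e : Sym2 V) (m : ℕ) :
    (Sum.inl e : Sym2 V ⊕ ℕ) ∈ Ev G m ↔ e ∈ G.edgeSet := by simp [Ev]
@[simp] theorem inr_mem_Ev (G : SimpleGraph V) (j m : ℕ) :
    (Sum.inr j : Sym2 V ⊕ ℕ) ∈ Ev G m ↔ j < m := by simp [Ev]
@[simp] theorem ev_inl (u y : V) (m : ℕ) (e : Sym2 V) : ev u y m (Sum.inl e) = e.map Sum.inl := rfl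
theorem ev_inr (u y : V) (m j : ℕ) :
    ev u y m (Sum.inr j) = s(pv u y m j, pv u y m (j + 1)) := rfl

theorem Sv_fin [Finite V] (m : ℕ) : (Sv V m).Finite := by
  refine ((finite_range Sum.inl).union ((finite_Iio m).image Sum.inr)).subset ?_
  rintro (a | j) h
  · exact Or.inl ⟨a, rfl⟩
  · exact Or.inr ⟨j, ((inr_mem_Sv j m).1 h).2, rfl⟩

theorem Ev_fin [Finite V] (G : SimpleGraph V) (m : ℕ) : (Ev G m).Finite := by
  refine ((finite_range Sum.inl).union ((finite_Iio m).image Sum.inr)).subset ?_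
  rintro (a | j) h
  · exact Or.inl ⟨a, rfl⟩
  · exact Or.inr ⟨j, (inr_mem_Ev G j m).1 h, rfl⟩

theorem Sv_succ {m : ℕ} (hm : 1 ≤ m) : insert (Sum.inr m) (Sv V m) = Sv V (m + 1) := by
  ext (a | j)
  · simp
  · simp only [mem_insert_iff, Sum.inr.injEq, inr_mem_Sv]; omega

theorem Ev_succ (G : SimpleGraph V) (m : ℕ) : insert (Sum.inr m) (Ev G m) = Ev G (m + 1) := by
  ext (a | j)
  · simp
  · simp only [mem_insert_iff, Sum.inr.injEq, inr_mem_Ev]; omega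

theorem pv_lt (u y z : V) {m m' j : ℕ} (h : j < m) (h' : j < m') : pv u y m j = pv u z m' j := by
  simp [pv, h, h']

theorem pv_self (u y : V) {m : ℕ} (h : 1 ≤ m) : pv u y m m = Sum.inl y := by
  simp [pv]; omega

theorem pv_inr (u y : V) {m j : ℕ} (h : 1 ≤ j) (h' : j < m) : pv u y m j = Sum.inr j := by
  simp [pv, h']; omega

theorem pv_mem (u y : V) (m j : ℕ) : pv u y m j ∈ Sv V m := by
  unfold pv
  split_ifs
  · simp
  · simp; omega
  · simp

/-- there is a good drawing of `G` plus a path of length `m` from `u` to `y` -/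
def HasP (G : SimpleGraph V) (u y : V) (m : ℕ) : Prop :=
  ∃ pos K, Good (Sv V m) (Ev G m) (ev u y m) pos K

variable {G : SimpleGraph V} {u y z : V} {m : ℕ}

theorem HasP.succ [Finite V] (hm : 1 ≤ m) (h : HasP G u y m) : HasP G u y (m + 1) := by
  obtain ⟨pos, K, D⟩ := h
  have := D.sub (Ev_fin G m) (e := Sum.inr (m - 1)) (e1 := Sum.inr m) (w := Sum.inr m)
    (x := Sum.inl y) (y := pv u y m (m - 1)) (en' := ev u y (m + 1)) (by simp; omega) (by simp)
    ?_ (by simp) ?_ ?_ ?_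
  · rwa [Sv_succ hm, Ev_succ] at this
  · rw [ev_inr, Nat.sub_add_cancel hm, pv_self u y hm]
  · rintro (e | j) he hne
    · simp
    · simp only [inr_mem_Ev] at he
      have hj : j ≠ m - 1 := fun hc => hne (by rw [hc])
      rw [ev_inr, ev_inr, pv_lt u y y (by omega) he, pv_lt u y y (by omega) (show j + 1 < m by omega)]
  · rw [ev_inr, Nat.sub_add_cancel hm, pv_inr u y hm (by omega), pv_lt u y y (by omega) (show m - 1 < m by omega)]
  · rw [ev_inr, pv_inr u y hm (by omega), pv_self u y (by omega)]

theorem HasP.mono [Finite V] (hm : 1 ≤ m) (h : HasP G u y m) {m' : ℕ} (hmm : m ≤ m') : HasP G u y m' := by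
  induction m', hmm using Nat.le_induction with
  | base => exact h
  | succ n hn ih => exact ih.succ (hm.trans hn)

theorem hasP_adj [Finite V] (h0 : HasP G u u 0) (h : G.Adj u y) : HasP G u y 1 := by
  obtain ⟨pos, K, D⟩ := h0
  have := D.par (Sv_fin 0) (Ev_fin G 0) (f := Sum.inl s(u, y)) (f' := Sum.inr 0) (x := Sum.inl u)
    (y := Sum.inl y) (en' := ev u y 1) (by simpa using h) (by simp) (by simp) ?_ (by simp [ev_inr, pv])
  · obtain ⟨K', D'⟩ := this
    rw [Ev_succ] at D'
    refine ⟨pos, K', ?_⟩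
    convert D' using 1
    ext (a | j)
    · simp
    · simp only [inr_mem_Sv]; omega
  · rintro (e | j) he
    · simp
    · simp at he

open Classical in
theorem HasP.par [Finite V] (hm : 1 ≤ m) (h : HasP G u y m) (hyz : G.Adj y z) {j : ℕ} (hj : m ≤ j) :
    ∃ pos K, Good (Sv V m) (insert (Sum.inr j) (Ev G m))
      (Function.update (ev u y m) (Sum.inr j) s(Sum.inl y, Sum.inl z)) pos K := by
  obtain ⟨pos, K, D⟩ := h
  have := D.par (Sv_fin m) (Ev_fin G m) (f := Sum.inl s(y, z)) (f' := Sum.inr j)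
    (x := Sum.inl y) (y := Sum.inl z)
    (en' := Function.update (ev u y m) (Sum.inr j) s(Sum.inl y, Sum.inl z)) (by simpa using hyz)
    (by simpa using hj) (by simp) ?_ (by simp)
  · exact ⟨pos, this⟩
  · rintro (e | i) he
    · simp
    · simp only [inr_mem_Ev] at he
      rw [Function.update_of_ne]
      simp; omega

open Classical in
theorem HasP.rot [Finite V] (hm : 1 ≤ m) (h : HasP G u y m) (hyz : G.Adj y z) : HasP G u z (m + 2) := by
  obtain ⟨pos, K, D⟩ := h.par hm hyz (j := m + 1) (by omega)
  have := D.rot (Sv_fin m) ((Ev_fin G m).insert _) (e := Sum.inr (m - 1)) (e' := Sum.inr (m + 1))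
    (r := Sum.inr m) (x := Sum.inl y) (y := pv u y m (m - 1)) (z := Sum.inl z) (w := Sum.inr m)
    (w' := Sum.inr (m + 1)) (en' := ev u z (m + 2)) (by right; simp; omega) (by simp)
    (by simp) (by simp) ?_ (by simp) (by simp) (by simp) (by simp) ?_ ?_ ?_ ?_
  · rw [Sv_succ hm, Sv_succ (by omega), Set.insert_comm, Ev_succ, Ev_succ] at this
    exact this
  · rw [Function.update_of_ne (by simp), ev_inr, Nat.sub_add_cancel hm, pv_self u y hm]
  · rintro (e | j) he h1 h2
    · simp
    · rw [Function.update_of_ne h2]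
      have hj : j < m := by
        rcases he with he | he
        · exact absurd he h2
        · simpa using he
      have hj1 : j ≠ m - 1 := fun hc => h1 (by rw [hc])
      rw [ev_inr, ev_inr, pv_lt u y z hj (show j < m + 2 by omega),
        pv_lt u y z (show j + 1 < m by omega) (show j + 1 < m + 2 by omega)]
  · rw [ev_inr, Nat.sub_add_cancel hm, pv_inr u z hm (by omega),
      pv_lt u y z (show m - 1 < m by omega) (show m - 1 < m + 2 by omega)]
  · rw [ev_inr, pv_inr u z (by omega) (by omega), pv_self u z (by omega)]
  · rw [ev_inr, pv_inr u z (by omega) (by omega), pv_inr u z (by omega) (by omega)]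

open Classical in
theorem HasP.cut [Finite V] (hm : 1 ≤ m) (h : HasP G u y m) (hyz : G.Adj y z) {B : Set V} (hu : u ∈ B)
    (hy : y ∈ B) (hz : z ∉ B) (hB : ∀ a ∈ B, a ≠ y → ∀ b, G.Adj a b → b ∈ B) :
    HasP G u z (m + 1) := by
  obtain ⟨pos, K, D⟩ := h.par hm hyz (j := m) le_rfl
  have := D.cutDetach (Sv_fin m) ((Ev_fin G m).insert _) (e1 := Sum.inr (m - 1)) (e2 := Sum.inr m)
    (S1 := {x ∈ Sv V m | ∀ a, x = Sum.inl a → a ∈ B})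
    (S2 := {x | ∃ a, x = Sum.inl a ∧ (a ∉ B ∨ a = y)})
    (E1 := {x ∈ Ev G m | ∀ e, x = Sum.inl e → ∃ a ∈ e, a ∈ B ∧ a ≠ y})
    (E2 := {x | x = Sum.inr m ∨ ∃ e ∈ G.edgeSet, x = Sum.inl e ∧ ∀ a ∈ e, a ∉ B ∨ a = y})
    (x := Sum.inl y) (y := pv u y m (m - 1)) (z := Sum.inl z) (w := Sum.inr m)
    (en' := ev u z (m + 1)) ?_ ?_ ?_ ?_ ?_ ?_ (Or.inl rfl) ?_ ?_ (by simp) (by simp) ?_ ?_ ?_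
  · rw [Sv_succ hm, Ev_succ] at this
    exact this
  · ext (a | j)
    · simp; tauto
    · simp
  · ext (e | j)
    · simp
      constructor
      · rintro (h | h)
        · exact h.1
        · exact h.1
      · intro he
        by_cases h : ∃ a ∈ e, a ∈ B ∧ a ≠ y
        · exact Or.inl ⟨he, h⟩
        · push Not at h
          refine Or.inr ⟨he, fun a ha => ?_⟩
          by_cases haB : a ∈ B
          · exact Or.inr (h a ha haB)
          · exact Or.inl haB
    · simp; tauto
  · rintro (e | j) ⟨he, he'⟩ x hx
    · rw [Function.update_of_ne (by simp)] at hx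
      obtain ⟨a, hae, haB, hay⟩ := he' e rfl
      obtain ⟨b, rfl⟩ := Sym2.mem_iff_exists.1 hae
      simp at he
      have hb := hB a haB hay b he
      simp at hx
      rcases hx with rfl | rfl
      · exact ⟨by simp, fun c hc => by rw [← Sum.inl.inj hc]; exact haB⟩
      · exact ⟨by simp, fun c hc => by rw [← Sum.inl.inj hc]; exact hb⟩
    · simp only [inr_mem_Ev] at he
      rw [Function.update_of_ne (by simp; omega), ev_inr] at hx
      have key : ∀ i, pv u y m i ∈ {x ∈ Sv V m | ∀ a, x = Sum.inl a → a ∈ B} := by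
        intro i
        refine ⟨pv_mem _ _ _ _, fun a ha => ?_⟩
        unfold pv at ha
        split_ifs at ha
        · rw [← Sum.inl.inj ha]; exact hu
        · rw [← Sum.inl.inj ha]; exact hy
      rcases Sym2.mem_iff.1 hx with rfl | rfl
      · exact key _
      · exact key _
  · rintro x (rfl | ⟨e, he, rfl, he'⟩) p hp
    · rw [Function.update_self] at hp
      rcases Sym2.mem_iff.1 hp with rfl | rfl
      · exact ⟨y, rfl, Or.inr rfl⟩
      · exact ⟨z, rfl, Or.inl hz⟩
    · rw [Function.update_of_ne (by simp), ev_inl, Sym2.mem_map] at hp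
      obtain ⟨a, ha, rfl⟩ := hp
      exact ⟨a, rfl, he' a ha⟩
  · rintro x ⟨hx, hx'⟩ (rfl | ⟨e, he, rfl, he'⟩)
    · simp at hx
    · obtain ⟨a, ha, h1, h2⟩ := hx' e rfl
      rcases he' a ha with h | h
      · exact h h1
      · exact h2 h
  · exact ⟨by simp; omega, by simp⟩
  · rintro x ⟨-, hx⟩ ⟨a, rfl, h⟩
    rcases h with h | h
    · exact absurd (hx a rfl) h
    · rw [h]
  · rw [Function.update_of_ne (by simp; omega), ev_inr, Nat.sub_add_cancel hm, pv_self u y hm]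
  · rintro (e | j) he h1 h2
    · simp
    · rw [Function.update_of_ne h2]
      have hj : j < m := by
        rcases he with he | he
        · exact absurd he h2
        · simpa using he
      have hj1 : j ≠ m - 1 := fun hc => h1 (by rw [hc])
      rw [ev_inr, ev_inr, pv_lt u y z hj (show j < m + 1 by omega),
        pv_lt u y z (show j + 1 < m by omega) (show j + 1 < m + 1 by omega)]
  · rw [ev_inr, Nat.sub_add_cancel hm, pv_inr u z hm (by omega),
      pv_lt u y z (show m - 1 < m by omega) (show m - 1 < m + 1 by omega)]
  · rw [ev_inr, pv_inr u z (by omega) (by omega), pv_self u z (by omega)]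

/-- the balls around `u` -/
def Bl (G : SimpleGraph V) (u : V) : ℕ → Set V
  | 0 => {u}
  | k + 1 => {a | a ∈ Bl G u k ∨ ∃ b ∈ Bl G u k, G.Adj b a}

theorem Bl_u (G : SimpleGraph V) (u : V) (k : ℕ) : u ∈ Bl G u k := by
  induction k with
  | zero => exact rfl
  | succ k ih => exact Or.inl ih

theorem hasP_layer [Finite V] (h0 : HasP G u u 0) (k : ℕ) : ∀ y ∈ Bl G u (k + 1), y ∉ Bl G u k →
    ∃ m, 1 ≤ m ∧ m ≤ (Bl G u k).ncard ∧ HasP G u y m := by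
  induction k with
  | zero =>
    rintro y (hy | ⟨b, hb, hby⟩) hy'
    · exact absurd hy hy'
    · have : b = u := hb
      subst this
      exact ⟨1, le_rfl, by simp [Bl], hasP_adj h0 hby⟩
  | succ k ih =>
    rintro z (hz | ⟨y, hy, hyz⟩) hz'
    · exact absurd hz hz'
    have hyk : y ∉ Bl G u k := fun h => hz' (Or.inr ⟨y, h, hyz⟩)
    obtain ⟨m, hm, hmc, hP⟩ := ih y hy hyk
    have hsub : Bl G u k ⊆ Bl G u (k + 1) := fun a ha => Or.inl ha
    by_cases hlay : ∃ y' ∈ Bl G u (k + 1), y' ∉ Bl G u k ∧ y' ≠ y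
    · obtain ⟨y', h1, h2, h3⟩ := hlay
      refine ⟨m + 2, by omega, ?_, hP.rot hm hyz⟩
      have : insert y' (insert y (Bl G u k)) ⊆ Bl G u (k + 1) :=
        insert_subset h1 (insert_subset hy hsub)
      have h4 := ncard_le_ncard this (toFinite _)
      rw [ncard_insert_of_notMem (by simp [h2, h3]) (toFinite _), ncard_insert_of_notMem hyk (toFinite _)] at h4
      omega
    · push Not at hlay
      refine ⟨m + 1, by omega, ?_, hP.cut hm hyz (B := Bl G u (k + 1)) (Bl_u _ _ _) hy hz' ?_⟩
      · have h4 := ncard_le_ncard (insert_subset hy hsub) (toFinite _)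
        rw [ncard_insert_of_notMem hyk (toFinite _)] at h4
        omega
      · intro a ha hay b hab
        by_cases hak : a ∈ Bl G u k
        · exact Or.inr ⟨a, hak, hab⟩
        · exact absurd (hlay a ha hak) hay

theorem hasP_disc [Finite V] (h0 : HasP G u u 0) (hy : ∀ k, y ∉ Bl G u k) : HasP G u y 1 := by
  obtain ⟨pos, K, D⟩ := h0
  have D1 : Good (Sv V 1) (Ev G 0) (ev u y 1) pos K := by
    have : Sv V 1 = Sv V 0 := by
      ext (a | j)
      · simp
      · simp only [inr_mem_Sv]; omega
    rw [this]
    refine D.congr ?_ (fun _ _ => rfl) (fun _ _ => rfl)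
    rintro (e | j) he
    · simp
    · simp at he
  have hcl : ∀ a b, G.Adj a b → (∃ k, a ∈ Bl G u k) → ∃ k, b ∈ Bl G u k := by
    rintro a b hab ⟨k, hk⟩
    exact ⟨k + 1, Or.inr ⟨a, hk, hab⟩⟩
  have := D1.disconnect (Sv_fin 1) (Ev_fin G 0)
    (S1 := {x | ∃ a, x = Sum.inl a ∧ ∃ k, a ∈ Bl G u k})
    (S2 := {x | ∃ a, x = Sum.inl a ∧ ¬ ∃ k, a ∈ Bl G u k})
    (E1 := {x | ∃ e ∈ G.edgeSet, x = Sum.inl e ∧ ∀ a ∈ e, ∃ k, a ∈ Bl G u k})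
    (E2 := {x | ∃ e ∈ G.edgeSet, x = Sum.inl e ∧ ∀ a ∈ e, ¬ ∃ k, a ∈ Bl G u k})
    (u := Sum.inl u) (v := Sum.inl y) (r := Sum.inr 0) ?_ ?_ ?_ ?_ ?_ ⟨u, rfl, 0, rfl⟩
    ⟨y, rfl, by simpa using hy⟩ ?_ (by simp) (by simp [ev_inr, pv])
  · rw [Ev_succ] at this
    exact this
  · ext (a | j)
    · simp only [mem_union, mem_ofPred_eq, Sum.inl.injEq, exists_eq_left', inl_mem_Sv, iff_true]
      exact em _
    · simp; omega
  · ext (e | j)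
    · simp only [mem_union, mem_ofPred_eq, Sum.inl.injEq, inl_mem_Ev]
      constructor
      · rintro (⟨e', h, rfl, -⟩ | ⟨e', h, rfl, -⟩) <;> exact h
      · intro he
        induction e with
        | _ a b =>
        by_cases ha : ∃ k, a ∈ Bl G u k
        · refine Or.inl ⟨_, he, rfl, fun c hc => ?_⟩
          rcases Sym2.mem_iff.1 hc with rfl | rfl
          · exact ha
          · exact hcl _ _ he ha
        · refine Or.inr ⟨_, he, rfl, fun c hc => ?_⟩
          rcases Sym2.mem_iff.1 hc with rfl | rfl
          · exact ha
          · exact fun h => ha (hcl _ _ (SimpleGraph.Adj.symm he) h)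
    · simp
  · rintro _ ⟨e, he, rfl, h⟩ p hp
    rw [ev_inl, Sym2.mem_map] at hp
    obtain ⟨a, ha, rfl⟩ := hp
    exact ⟨a, rfl, h a ha⟩
  · rintro _ ⟨e, he, rfl, h⟩ p hp
    rw [ev_inl, Sym2.mem_map] at hp
    obtain ⟨a, ha, rfl⟩ := hp
    exact ⟨a, rfl, h a ha⟩
  · rintro _ ⟨e, he, rfl, h⟩ ⟨e', he', heq, h'⟩
    obtain rfl := Sum.inl.inj heq
    induction e with
    | _ a b => exact h' a (by simp) (h a (by simp))
  · rintro _ ⟨a, rfl, h⟩ ⟨b, heq, h'⟩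
    obtain rfl := Sum.inl.inj heq
    exact h' h

theorem hasP_final [Finite V] (h0 : HasP G u u 0) {v : V} (huv : u ≠ v) {t : ℕ} (ht : Nat.card V - 1 ≤ t + 1) :
    HasP G u v (t + 1) := by
  classical
  by_cases hv : ∃ k, v ∈ Bl G u k
  · have hmin := Nat.find_spec hv
    have hlt := fun k => Nat.find_min hv (m := k)
    rcases hk : Nat.find hv with _ | k
    · rw [hk] at hmin
      exact absurd (show v = u from hmin).symm huv
    · rw [hk] at hmin hlt
      have hvk := hlt k (by omega)
      obtain ⟨m, h1, h2, h3⟩ := hasP_layer h0 k v hmin hvk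
      refine h3.mono h1 ?_
      have : (insert v (Bl G u k)).ncard ≤ Nat.card V := ncard_le_card _
      rw [ncard_insert_of_notMem hvk (toFinite _)] at this
      omega
  · exact (hasP_disc h0 (by simpa using hv)).mono le_rfl (by omega)

end QPA

end

section
open Set Metric

namespace QPA

/-- the identification of the two planes -/
noncomputable abbrev toC : (ℝ × ℝ) ≃ₜ ℂ := Complex.equivRealProdCLM.symm.toHomeomorph

theorem ends_cases {W : Type} {H : SimpleGraph W} (D : Drawing H) {a b : W} (h : H.Adj a b) :
    (D.curve s(a, b) 0 = D.pos a ∧ D.curve s(a, b) 1 = D.pos b) ∨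
    (D.curve s(a, b) 0 = D.pos b ∧ D.curve s(a, b) 1 = D.pos a) := by
  have h1 := D.curve_ends a b h
  have hne : D.pos a ≠ D.pos b := fun hc => h.ne (D.pos_inj hc)
  rw [Set.pair_eq_pair_iff] at h1
  exact h1

theorem Ioo_or {s : ℝ} (h : s ∈ Icc (0 : ℝ) 1) : s = 0 ∨ s = 1 ∨ s ∈ Ioo (0 : ℝ) 1 := by
  rcases h.1.eq_or_lt with h0 | h0
  · exact Or.inl h0.symm
  rcases h.2.eq_or_lt with h1 | h1
  · exact Or.inr (Or.inl h1)
  · exact Or.inr (Or.inr ⟨h0, h1⟩)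

/-- a point on a curve is a vertex of the edge or an interior point -/
theorem curve_pt {W : Type} {H : SimpleGraph W} (D : Drawing H) {e : Sym2 W} (he : e ∈ H.edgeSet)
    {s : ℝ} (hs : s ∈ Icc (0 : ℝ) 1) : s ∈ Ioo (0 : ℝ) 1 ∨ ∃ a ∈ e, D.curve e s = D.pos a := by
  induction e with
  | _ a b =>
  have ha : a ∈ s(a, b) := by simp
  have hb : b ∈ s(a, b) := by simp
  rcases Ioo_or hs with rfl | rfl | h
  · rcases ends_cases D he with h | h
    · exact Or.inr ⟨a, ha, h.1⟩
    · exact Or.inr ⟨b, hb, h.1⟩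
  · rcases ends_cases D he with h | h
    · exact Or.inr ⟨b, hb, h.2⟩
    · exact Or.inr ⟨a, ha, h.2⟩
  · exact Or.inl h

theorem vertex_on_curve {W : Type} {H : SimpleGraph W} (D : Drawing H) {e : Sym2 W}
    (he : e ∈ H.edgeSet) {a : W} (h : D.pos a ∈ D.curve e '' Icc 0 1) : a ∈ e := by
  obtain ⟨s, hs, hsa⟩ := h
  rcases curve_pt D he hs with h | ⟨b, hb, h⟩
  · exact absurd hsa (D.no_vertex_interior e he s h a)
  · rw [hsa] at h
    exact D.pos_inj h ▸ hb

theorem hasP_zero {W : Type} {H : SimpleGraph W} (hH : IsQuasiPlanarGraph H) (u : W) :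
    HasP H u u 0 := by
  obtain ⟨D, hD⟩ := hH
  refine ⟨Sum.elim (fun a => toC (D.pos a)) (fun _ => 0),
    Sum.elim (fun e => toC '' (D.curve e '' Icc 0 1)) (fun _ => ∅), ?_⟩
  have hX : ∀ e ∈ H.edgeSet, ∀ f ∈ H.edgeSet, X (ev u u 0)
      (Sum.elim (fun e => toC '' (D.curve e '' Icc 0 1)) (fun _ => ∅)) (Sum.inl e) (Sum.inl f) →
      D.Crosses e f := by
    intro e he f hf hx
    have hef : e ≠ f := fun hc => hx.ne (by rw [hc])
    obtain ⟨hd, q, hq1, hq2⟩ := hx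
    simp only [Sum.elim_inl] at hq1 hq2
    obtain ⟨p, hp, rfl⟩ := hq1
    obtain ⟨p', hp', hpp⟩ := hq2
    obtain rfl := toC.injective hpp
    have hd' : ∀ a ∈ e, a ∉ f := by
      intro a ha ha'
      exact hd (Sum.inl a) (by rw [ev_inl, Sym2.mem_map]; exact ⟨a, ha, rfl⟩)
        (by rw [ev_inl, Sym2.mem_map]; exact ⟨a, ha', rfl⟩)
    have hp0 := hp
    have hp0' := hp'
    obtain ⟨s, hs, hsp⟩ := hp
    obtain ⟨s', hs', hsp'⟩ := hp'
    refine ⟨p', he, hf, hef, ⟨s, ?_, hsp⟩, ⟨s', ?_, hsp'⟩⟩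
    · rcases curve_pt D he hs with h | ⟨a, ha, h⟩
      · exact h
      · rw [← hsp, h] at hp0'
        exact absurd (vertex_on_curve D hf hp0') (hd' a ha)
    · rcases curve_pt D hf hs' with h | ⟨a, ha, h⟩
      · exact h
      · rw [← hsp', h] at hp0
        exact absurd ha (hd' a (vertex_on_curve D he hp0))
  refine ⟨?_, ?_, ?_, ?_, ?_, ?_, ?_⟩
  · rintro (a | j) ha (b | k) hb hab
    · simp only [Sum.elim_inl] at hab
      rw [D.pos_inj (toC.injective hab)]
    · simp at hb
    · simp at ha
    · simp at ha
  · rintro (e | j) he z hz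
    · rw [ev_inl, Sym2.mem_map] at hz
      obtain ⟨a, -, rfl⟩ := hz
      simp
    · simp at he
  · rintro (e | j) he z z' hz
    · rw [inl_mem_Ev] at he
      induction e with
      | _ a b =>
      have harc : IsArc (toC (D.pos a)) (toC (D.pos b)) (toC '' (D.curve s(a, b) '' Icc 0 1)) := by
        rw [← image_comp]
        have hc : ContinuousOn (toC ∘ D.curve s(a, b)) (Icc 0 1) :=
          toC.continuous.comp_continuousOn (D.curve_cont _ he)
        have hi : InjOn (toC ∘ D.curve s(a, b)) (Icc 0 1) :=
          toC.injective.comp_injOn (D.curve_inj _ he)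
        rcases ends_cases D he with h | h
        · exact ⟨_, hc, hi, by simp [h.1], by simp [h.2], rfl⟩
        · exact IsArc.symm ⟨_, hc, hi, by simp [h.1], by simp [h.2], rfl⟩
      rw [ev_inl, Sym2.map_mk] at hz
      rcases Sym2.eq_iff.1 hz with ⟨rfl, rfl⟩ | ⟨rfl, rfl⟩
      · exact harc
      · exact harc.symm
    · simp at he
  · rintro (e | j) he (a | k) ha h
    · rw [inl_mem_Ev] at he
      simp only [Sum.elim_inl] at h
      obtain ⟨p, hp, hpp⟩ := h
      obtain rfl := toC.injective hpp
      rw [ev_inl, Sym2.mem_map]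
      exact ⟨a, vertex_on_curve D he hp, rfl⟩
    · simp at ha
    · simp at he
    · simp at he
  · rintro (e | j) he (f | k) hf hef
    · rw [inl_mem_Ev] at he hf
      simp only [Sum.elim_inl]
      rw [← image_inter toC.injective]
      exact (D.finite_meets e he f hf fun hc => hef (by rw [hc])).image _
    · simp at hf
    · simp at he
    · simp at he
  · rintro (e | j) he (f | k) hf hef z hz hz' p hp
    · rw [inl_mem_Ev] at he hf
      simp only [Sum.elim_inl] at hp
      rw [← image_inter toC.injective] at hp
      obtain ⟨p, hp, rfl⟩ := hp
      have hz0 := hz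
      rw [ev_inl, Sym2.mem_map] at hz0
      obtain ⟨a, ha, rfl⟩ := hz0
      have ha' : a ∈ f := by
        rw [ev_inl, Sym2.mem_map] at hz'
        obtain ⟨b, hb, hba⟩ := hz'
        exact Sum.inl.inj hba ▸ hb
      have := D.shared_endpoint e he f hf (fun hc => hef (by rw [hc])) a ha ha' hp
      rw [mem_singleton_iff] at this
      exact ⟨_, hz, hz', by rw [this]; rfl⟩
    · simp at hf
    · simp at he
    · simp at he
  · rintro (e | j) he (f | k) hf (g | l) hg h1 h2 h3
    · rw [inl_mem_Ev] at he hf hg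
      exact hD ⟨e, f, g, hX e he f hf h1, hX e he g hg h2, hX f hf g hg h3⟩
    all_goals simp at he hf hg

theorem toQP {T ι W : Type} {S : Set T} {E : Set ι} {en : ι → Sym2 T} {pos : T → ℂ}
    {K : ι → Set ℂ} (G : Good S E en pos K) (H : SimpleGraph W) (σ : W → T)
    (hσ : Function.Injective σ) (hσS : ∀ w, σ w ∈ S)
    (hlab : ∀ e ∈ H.edgeSet, ∃ l ∈ E, en l = e.map σ) : IsQuasiPlanarGraph H := by
  have hex : ∀ e : Sym2 W, ∃ γ : ℝ → ℂ, e ∈ H.edgeSet → ∃ l ∈ E, en l = e.map σ ∧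
      ContinuousOn γ (Icc 0 1) ∧ InjOn γ (Icc 0 1) ∧ γ '' Icc 0 1 = K l ∧
      ∀ a b, e = s(a, b) → ({γ 0, γ 1} : Set ℂ) = {pos (σ a), pos (σ b)} := by
    intro e
    by_cases he : e ∈ H.edgeSet
    · obtain ⟨l, hl, hle⟩ := hlab e he
      induction e with
      | _ a b =>
      obtain ⟨γ, g1, g2, g3, g4, g5⟩ := G.arc l hl (σ a) (σ b) (by simpa using hle)
      refine ⟨γ, fun _ => ⟨l, hl, hle, g1, g2, g5, ?_⟩⟩
      intro a' b' hab
      rw [g3, g4]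
      rcases Sym2.eq_iff.1 hab with ⟨rfl, rfl⟩ | ⟨rfl, rfl⟩
      · rfl
      · exact Set.pair_comm _ _
    · exact ⟨fun _ => 0, fun h => absurd h he⟩
  choose γ hγ using hex
  have hmem : ∀ (e : Sym2 W) (a : W), σ a ∈ e.map σ → a ∈ e := by
    intro e a h
    rw [Sym2.mem_map] at h
    obtain ⟨b, hb, hba⟩ := h
    exact hσ hba ▸ hb
  have hmem' : ∀ (e : Sym2 W) (a : W), a ∈ e → σ a ∈ e.map σ := fun e a h =>
    Sym2.mem_map.2 ⟨a, h, rfl⟩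
  -- no vertex in the interior of a curve
  have hinter : ∀ e ∈ H.edgeSet, ∀ s ∈ Ioo (0 : ℝ) 1, ∀ x : W, γ e s ≠ pos (σ x) := by
    intro e he s hs x hsx
    obtain ⟨l, hl, hle, g1, g2, g5, g6⟩ := hγ e he
    have hs' : s ∈ Icc (0 : ℝ) 1 := Ioo_subset_Icc_self hs
    have hxl : σ x ∈ en l := G.vert l hl _ (hσS x) (by rw [← hsx, ← g5]; exact ⟨s, hs', rfl⟩)
    rw [hle] at hxl
    obtain ⟨b, rfl⟩ := Sym2.mem_iff_exists.1 (hmem e x hxl)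
    have h7 := g6 x b rfl
    have : γ s(x, b) s ∈ ({γ s(x, b) 0, γ s(x, b) 1} : Set ℂ) := by
      rw [h7, hsx]; exact Or.inl rfl
    rcases this with h | h
    · exact hs.1.ne' (g2 hs' ⟨le_rfl, zero_le_one⟩ h)
    · exact hs.2.ne (g2 hs' ⟨zero_le_one, le_rfl⟩ h)
  have hshare : ∀ e ∈ H.edgeSet, ∀ f ∈ H.edgeSet, e ≠ f → ∀ x : W, x ∈ e → x ∈ f →
      ∀ p ∈ γ e '' Icc 0 1, p ∈ γ f '' Icc 0 1 → p = pos (σ x) := by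
    intro e he f hf hef x hxe hxf p hp hp'
    obtain ⟨l, hl, hle, -, -, g5, -⟩ := hγ e he
    obtain ⟨l', hl', hle', -, -, g5', -⟩ := hγ f hf
    have hll : l ≠ l' := by
      rintro rfl
      exact hef (Sym2.map.injective hσ (hle.symm.trans hle'))
    obtain ⟨z, z1, z2, rfl⟩ := G.sh l hl l' hl' hll (σ x) (hle ▸ hmem' e x hxe)
      (hle' ▸ hmem' f x hxf) p ⟨g5 ▸ hp, g5' ▸ hp'⟩
    rw [hle, Sym2.mem_map] at z1
    obtain ⟨a, ha, rfl⟩ := z1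
    rw [hle'] at z2
    have ha' := hmem f a z2
    by_cases hax : a = x
    · rw [hax]
    · exact absurd (((Sym2.mem_and_mem_iff hax).1 ⟨ha, hxe⟩).trans
        ((Sym2.mem_and_mem_iff hax).1 ⟨ha', hxf⟩).symm) hef
  let D : Drawing H :=
    { pos := fun w => toC.symm (pos (σ w))
      curve := fun e s => toC.symm (γ e s)
      pos_inj := fun a b h => hσ (G.inj (hσS a) (hσS b) (toC.symm.injective h))
      curve_cont := by
        intro e he
        obtain ⟨l, hl, hle, g1, g2, g5, g6⟩ := hγ e he
        exact toC.symm.continuous.comp_continuousOn g1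
      curve_inj := by
        intro e he
        obtain ⟨l, hl, hle, g1, g2, g5, g6⟩ := hγ e he
        exact toC.symm.injective.comp_injOn g2
      curve_ends := by
        intro a b hab
        obtain ⟨l, hl, hle, g1, g2, g5, g6⟩ := hγ s(a, b) hab
        have := congrArg (fun A => toC.symm '' A) (g6 a b rfl)
        simpa only [image_pair] using this
      no_vertex_interior := fun e he s hs x h => hinter e he s hs x (toC.symm.injective h)
      finite_meets := by
        intro e he f hf hef
        obtain ⟨l, hl, hle, -, -, g5, -⟩ := hγ e he
        obtain ⟨l', hl', hle', -, -, g5', -⟩ := hγ f hf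
        have hll : l ≠ l' := by
          rintro rfl
          exact hef (Sym2.map.injective hσ (hle.symm.trans hle'))
        have h1 : ∀ e : Sym2 W, (fun s => toC.symm (γ e s)) '' Icc 0 1 = toC.symm '' (γ e '' Icc 0 1) :=
          fun e => by rw [← image_comp]; rfl
        rw [h1, h1, g5, g5', ← image_inter toC.symm.injective]
        exact (G.fin l hl l' hl' hll).image _
      shared_endpoint := by
        rintro e he f hf hef x hxe hxf _ ⟨⟨s, hs, rfl⟩, ⟨s', hs', h⟩⟩
        have h := toC.symm.injective h
        have := hshare e he f hf hef x hxe hxf (γ e s) ⟨s, hs, rfl⟩ ⟨s', hs', h⟩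
        exact congrArg toC.symm this }
  have hX : ∀ e f, D.Crosses e f → ∀ l ∈ E, ∀ l' ∈ E, en l = e.map σ → en l' = f.map σ →
      γ e '' Icc 0 1 = K l → γ f '' Icc 0 1 = K l' → X en K l l' := by
    rintro e f ⟨p, he, hf, hef, ⟨s, hs, hsp⟩, ⟨s', hs', hsp'⟩⟩ l hl l' hl' hle hle' g5 g5'
    have heq : γ e s = γ f s' := toC.symm.injective (hsp.trans hsp'.symm)
    have hI := Ioo_subset_Icc_self hs
    have hI' := Ioo_subset_Icc_self hs'
    refine ⟨?_, γ e s, g5 ▸ ⟨s, hI, rfl⟩, g5' ▸ ⟨s', hI', heq.symm⟩⟩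
    intro z hz hz'
    rw [hle, Sym2.mem_map] at hz
    obtain ⟨a, ha, rfl⟩ := hz
    rw [hle'] at hz'
    exact hinter e he s hs a (hshare e he f hf hef a ha (hmem f a hz') _ ⟨s, hI, rfl⟩
      ⟨s', hI', heq.symm⟩)
  refine ⟨D, ?_⟩
  rintro ⟨e, f, g, h1, h2, h3⟩
  have he : e ∈ H.edgeSet := h1.choose_spec.1
  have hf : f ∈ H.edgeSet := h3.choose_spec.1
  have hg : g ∈ H.edgeSet := h3.choose_spec.2.1
  obtain ⟨l1, hl1, e1, -, -, k1, -⟩ := hγ e he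
  obtain ⟨l2, hl2, e2, -, -, k2, -⟩ := hγ f hf
  obtain ⟨l3, hl3, e3, -, -, k3, -⟩ := hγ g hg
  exact G.qp l1 hl1 l2 hl2 l3 hl3 (hX e f h1 _ hl1 _ hl2 e1 e2 k1 k2)
    (hX e g h2 _ hl1 _ hl3 e1 e3 k1 k3) (hX f g h3 _ hl2 _ hl3 e2 e3 k2 k3)

theorem final {V : Type} {G : SimpleGraph V} {u v : V} {t : ℕ} (h : HasP G u v (t + 1)) :
    IsQuasiPlanarGraph (pathAdd G u v t ∅) := by
  obtain ⟨pos, K, D⟩ := h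
  refine toQP D _ (Sum.map id (fun i : Fin t => (i : ℕ) + 1)) ?_ ?_ ?_
  · refine Sum.map_injective.2 ⟨Function.injective_id, fun i j h => ?_⟩
    simp only [Nat.add_right_cancel_iff] at h
    exact Fin.ext h
  · rintro (a | i)
    · simp
    · simp
  · intro e he
    rw [pathAdd, SimpleGraph.edgeSet_fromEdgeSet] at he
    rcases he.1 with (⟨e0, he0, rfl⟩ | ⟨i, rfl⟩) | h
    · refine ⟨Sum.inl e0, by simpa using he0, ?_⟩
      rw [ev_inl, Sym2.map_map]
      rfl
    · refine ⟨Sum.inr i, by simp; omega, ?_⟩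
      have key : ∀ j : Fin (t + 2), Sum.map id (fun i : Fin t => (i : ℕ) + 1)
          (chainVertex (Sum.inl u) (Sum.inl v) (fun i => Sum.inr i) j : V ⊕ Fin t) =
          pv u v (t + 1) j := by
        intro j
        have := j.isLt
        unfold chainVertex pv
        by_cases h0 : (j : ℕ) = 0
        · simp [h0]
        · by_cases h1 : (j : ℕ) = t + 1
          · simp [h1]
          · rw [dif_neg h0, dif_neg h1, if_neg h0, if_pos (by omega)]
            simp only [Sum.map_inr, Sum.inr.injEq]
            omega
      rw [ev_inr, Sym2.map_mk, key, key]
      rfl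
    · exact absurd h (by simp)

end QPA

end

/-- The class of quasi-planar graphs is closed under path-addition
(with empty supplementary edge set, the class being hereditary). -/
theorem quasiPlanar_closed_under_pathAddition
    {V : Type} [Fintype V] (G : SimpleGraph V) (hG : IsQuasiPlanarGraph G)
    (u v : V) (huv : u ≠ v)
    (t : ℕ) (ht : Fintype.card V - 1 ≤ t + 1) :
    IsQuasiPlanarGraph (pathAdd G u v t ∅) := by
  classical
  refine QPA.final (QPA.hasP_final (QPA.hasP_zero hG u) huv ?_)
  rw [Nat.card_eq_fintype_card]
  exact ht
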